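/- arXiv:1805.00102 — 2 statements merged into one kernel-verified Lean document; each statement's English description precedes it below -/
import Mathlib

section
/- Let n ≥ 1 and let f be a real-valued function that is real analytic on an open neighborhood of 0 in ℝⁿ. Then there exist θ ∈ (0,1) and an open neighborhood U of 0, contained in the domain of f, such that for every y ∈ U one has ‖∇f(y)‖ ≥ |f(y) − f(0)|^θ. -/
namespace Loj
open Filter Topology

section Division
variable {E : Type*} [NormedAddCommGroup E] [NormedSpace ℝ E]

/-- The projection `z ↦ z - ℓ z • e`. -/
noncomputable def prj (l : E →L[ℝ] ℝ) (e : E) : E →L[ℝ] E :=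
  ContinuousLinearMap.id ℝ E - l.smulRight e

/-- The divided-difference power series. -/
noncomputable def divSeries (l : E →L[ℝ] ℝ) (e : E) (p : FormalMultilinearSeries ℝ E ℝ) :
    FormalMultilinearSeries ℝ E ℝ := fun n =>
  ∑ i : Fin (n + 1), ((p (n + 1)).curryMid i e).compContinuousLinearMap
    (fun j => if i.succAbove j < i then ContinuousLinearMap.id ℝ E else prj l e)

lemma divSeries_apply (l : E →L[ℝ] ℝ) (e : E) (p : FormalMultilinearSeries ℝ E ℝ) (n : ℕ) (z : E) :
    p (n + 1) (fun _ => z) - p (n + 1) (fun _ => prj l e z) =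
      l z * divSeries l e p n (fun _ => z) := by
  have h := (p (n+1)).toMultilinearMap.map_sub_map_piecewise (fun _ => z) (fun _ => prj l e z)
    Finset.univ
  simp only [Finset.piecewise_univ, Finset.mem_univ, true_imp_iff] at h
  refine h.trans ?_
  simp only [divSeries, _root_.sum_apply, Finset.mul_sum]
  refine Finset.sum_congr rfl fun i _ => ?_
  rw [ContinuousMultilinearMap.compContinuousLinearMap_apply,
    ContinuousMultilinearMap.curryMid_apply]
  have e1 : (fun j : Fin (n+1) => if j < i then z else if i = j then z - prj l e z else prj l e z)
      = Function.update (i.insertNth e (fun j : Fin n =>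
        (if i.succAbove j < i then ContinuousLinearMap.id ℝ E else prj l e) z) : Fin (n+1) → E)
         i (l z • e) := by
    funext j
    rcases eq_or_ne j i with rfl | hj
    · simp [prj]
    · obtain ⟨k, rfl⟩ := Fin.exists_succAbove_eq hj
      rw [Function.update_of_ne hj]
      simp only [Fin.insertNth_apply_succAbove]
      rw [if_neg (Ne.symm hj)]
      split_ifs <;> rfl
  change (p (n+1)).toMultilinearMap _ = _
  rw [e1, MultilinearMap.map_update_smul]
  simp

lemma divSeries_norm (l : E →L[ℝ] ℝ) (e : E) (p : FormalMultilinearSeries ℝ E ℝ) (n : ℕ) :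
    ‖divSeries l e p n‖ ≤ (n + 1) * (‖p (n + 1)‖ * ‖e‖ * (1 + ‖prj l e‖) ^ n) := by
  unfold divSeries
  refine (norm_sum_le _ _).trans ?_
  have : ∀ i ∈ (Finset.univ : Finset (Fin (n+1))),
      ‖((p (n + 1)).curryMid i e).compContinuousLinearMap
    (fun j => if i.succAbove j < i then ContinuousLinearMap.id ℝ E else prj l e)‖
     ≤ ‖p (n + 1)‖ * ‖e‖ * (1 + ‖prj l e‖) ^ n := by
    intro i _
    refine (ContinuousMultilinearMap.norm_compContinuousLinearMap_le _ _).trans ?_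
    gcongr
    · refine (ContinuousLinearMap.le_opNorm _ _).trans ?_
      rw [ContinuousMultilinearMap.norm_curryMid]
    · refine (Finset.prod_le_prod (g := fun _ => 1 + ‖prj l e‖) (fun _ _ => norm_nonneg _) ?_).trans ?_
      · intro j _
        split_ifs
        · have := ContinuousLinearMap.norm_id_le (𝕜 := ℝ) (E := E)
          have := norm_nonneg (prj l e)
          linarith
        · linarith
      · simp
  refine (Finset.sum_le_sum this).trans ?_
  simp

lemma divSeries_radius (l : E →L[ℝ] ℝ) (e : E) (p : FormalMultilinearSeries ℝ E ℝ)
    (hp : 0 < p.radius) : 0 < (divSeries l e p).radius := by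
  obtain ⟨r, hr0, hr⟩ := ENNReal.lt_iff_exists_nnreal_btwn.1 hp
  have hr0' : (0:ℝ) < r := by exact_mod_cast hr0
  obtain ⟨C, hC, hb⟩ := p.norm_mul_pow_le_of_lt_radius hr
  set K := 1 + ‖prj l e‖ with hK
  have hK0 : 0 < K := by positivity
  let s : NNReal := ⟨r / (2 * K), by positivity⟩
  have hs : (0 : ℝ) < s := by change 0 < (r:ℝ) / (2*K); positivity
  have : (s : ENNReal) ≤ (divSeries l e p).radius := by
    refine FormalMultilinearSeries.le_radius_of_bound _ (C / r * ‖e‖) fun n => ?_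
    have h1 := divSeries_norm l e p n
    have h2 := hb (n+1)
    have h3 : ((n:ℝ) + 1) ≤ 2 ^ n := by
      have := Nat.lt_two_pow_self (n := n)
      exact_mod_cast this
    have hs' : (s:ℝ) = r / (2*K) := rfl
    calc ‖divSeries l e p n‖ * (s:ℝ)^n ≤ ((n + 1) * (‖p (n + 1)‖ * ‖e‖ * K ^ n)) * (s:ℝ)^n := by
          gcongr
      _ = ((n+1) / 2^n) * (‖p (n+1)‖ * r^(n+1) / r * ‖e‖) := by
          rw [hs', div_pow, mul_pow]; field_simp; ring
      _ ≤ 1 * (C / r * ‖e‖) := by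
          gcongr
          rw [div_le_one (by positivity)]; exact h3
      _ = _ := one_mul _
  exact lt_of_lt_of_le (by exact_mod_cast hs) this

/-- Division with remainder by a linear form. -/
lemma exists_div (l : E →L[ℝ] ℝ) (e : E) (g : E → ℝ) (hg : AnalyticAt ℝ g 0) :
    ∃ h : E → ℝ, AnalyticAt ℝ h 0 ∧ ∀ᶠ z in 𝓝 0, g z = g (z - l z • e) + l z * h z := by
  obtain ⟨p, r, hp⟩ := hg
  have hr := divSeries_radius l e p (hp.r_pos.trans_le hp.r_le)
  have hq := (divSeries l e p).hasFPowerSeriesOnBall hr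
  refine ⟨(divSeries l e p).sum, hq.analyticAt, ?_⟩
  have hc : Tendsto (prj l e) (𝓝 0) (𝓝 0) := by
    simpa using (prj l e).continuous.tendsto 0
  have b1 : ∀ᶠ z in 𝓝 (0:E), z ∈ Metric.eball (0:E) r := Metric.eball_mem_nhds _ hp.r_pos
  have b2 : ∀ᶠ z in 𝓝 (0:E), z ∈ Metric.eball (0:E) (divSeries l e p).radius :=
    Metric.eball_mem_nhds _ hr
  filter_upwards [b1, b2, hc.eventually b1] with z h1 h2 h3
  have s1 := hp.hasSum h1
  have s3 := hp.hasSum h3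
  have s2 := hq.hasSum h2
  rw [zero_add] at s1 s2 s3
  have s4 := s1.sub s3
  rw [← hasSum_nat_add_iff' 1] at s4
  have s5 := s2.mul_left (l z)
  have : z - l z • e = prj l e z := by simp [prj]
  rw [this]
  have e3 : (fun n => p (n+1) (fun _ => z) - p (n+1) (fun _ => prj l e z)) =
      fun n => l z * divSeries l e p n (fun _ => z) := funext fun n => divSeries_apply l e p n z
  rw [e3] at s4
  have e2 := s4.unique s5
  have e0 : p 0 (fun _ => z) = p 0 (fun _ => prj l e z) := by
    congr 1; funext i; exact i.elim0
  simp [e0] at e2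
  linarith

end Division
end Loj

namespace Loj
open Filter Topology

section Germs
variable {E : Type*} [NormedAddCommGroup E] [NormedSpace ℝ E]

lemma exists_ball_analytic {f : E → ℝ} (hf : AnalyticAt ℝ f 0) :
    ∃ r > 0, AnalyticOnNhd ℝ f (Metric.ball 0 r) := by
  obtain ⟨r, hr, h⟩ := Metric.eventually_nhds_iff_ball.1 hf.eventually_analyticAt
  exact ⟨r, hr, h⟩

lemma germ_mul_eq_zero {f g : E → ℝ} (hf : AnalyticAt ℝ f 0) (hg : AnalyticAt ℝ g 0)
    (h : ∀ᶠ z in 𝓝 0, f z * g z = 0) : f =ᶠ[𝓝 0] 0 ∨ g =ᶠ[𝓝 0] 0 := by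
  by_contra hcon
  push Not at hcon
  obtain ⟨h1, h2⟩ := hcon
  obtain ⟨r, hr, hra⟩ := exists_ball_analytic hg
  have h1' : ∃ᶠ z in 𝓝 0, f z ≠ 0 := fun hh => h1 (hh.mono fun z hz => by simpa using hz)
  have hb : ∀ᶠ z in 𝓝 (0:E), z ∈ Metric.ball (0:E) r := Metric.ball_mem_nhds _ hr
  obtain ⟨z, hz, hzb, hza, hzz⟩ := (h1'.and_eventually
    (hb.and (hf.eventually_analyticAt.and h.eventually_nhds))).exists
  apply h2
  have : g =ᶠ[𝓝 z] 0 := by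
    filter_upwards [hza.continuousAt.eventually_ne hz, hzz] with w hw hw'
    simpa [hw] using hw'
  have := hra.eqOn_zero_of_preconnected_of_eventuallyEq_zero
    (convex_ball (0:E) r).isPreconnected hzb this
  filter_upwards [hb] with w hw using this hw

lemma exists_direction {f : E → ℝ} (hf : AnalyticAt ℝ f 0) (h : ¬ f =ᶠ[𝓝 0] 0) :
    ∃ v : E, ¬ (fun t : ℝ => f (t • v)) =ᶠ[𝓝 0] 0 := by
  by_contra hcon
  push Not at hcon
  apply h
  obtain ⟨r, hr, hra⟩ := exists_ball_analytic hf
  have hb : ∀ᶠ z in 𝓝 (0:E), z ∈ Metric.ball (0:E) r := Metric.ball_mem_nhds _ hr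
  filter_upwards [hb] with v hv
  let U : Set ℝ := (fun t : ℝ => t • v) ⁻¹' Metric.ball 0 r
  have hU : Convex ℝ U := by
    have := (convex_ball (0:E) r).linear_preimage (LinearMap.toSpanSingleton ℝ E v)
    exact this
  have hA : AnalyticOnNhd ℝ (fun t : ℝ => f (t • v)) U := by
    intro t ht
    exact AnalyticAt.fun_comp (hra _ ht) (by fun_prop)
  have := hA.eqOn_zero_of_preconnected_of_eventuallyEq_zero hU.isPreconnected
    (z₀ := 0) (by simp [U, hr]) (hcon v)
  have := this (x := 1) (by simpa [U] using hv)
  simpa using this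

end Germs

section Dy
variable {E : Type*} [NormedAddCommGroup E] [NormedSpace ℝ E]

/-- Derivative in the last variable. -/
noncomputable def Dy (g : E × ℝ → ℝ) : E × ℝ → ℝ := fun z => fderiv ℝ g z (0, 1)

lemma Dy_analytic {g : E × ℝ → ℝ} {z} (hg : AnalyticAt ℝ g z) : AnalyticAt ℝ (Dy g) z :=
  ((ContinuousLinearMap.apply ℝ ℝ ((0:E), (1:ℝ))).analyticAt _).comp hg.fderiv

lemma Dy_iter_analytic {g : E × ℝ → ℝ} {z} (hg : AnalyticAt ℝ g z) (k : ℕ) :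
    AnalyticAt ℝ (Dy^[k] g) z := by
  induction k with
  | zero => exact hg
  | succ k ih => rw [Function.iterate_succ_apply']; exact Dy_analytic ih

lemma Dy_congr {g g' : E × ℝ → ℝ} {z} (h : g =ᶠ[𝓝 z] g') : Dy g =ᶠ[𝓝 z] Dy g' := by
  filter_upwards [h.fderiv (𝕜 := ℝ)] with w hw
  simp [Dy, hw]

lemma Dy_iter_congr {g g' : E × ℝ → ℝ} {z} (h : g =ᶠ[𝓝 z] g') (k : ℕ) :
    Dy^[k] g =ᶠ[𝓝 z] Dy^[k] g' := by
  induction k with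
  | zero => exact h
  | succ k ih => rw [Function.iterate_succ_apply', Function.iterate_succ_apply']; exact Dy_congr ih

lemma Dy_add_mul {a : E → ℝ} {h : E × ℝ → ℝ} (ha : AnalyticAt ℝ a 0) (hh : AnalyticAt ℝ h 0) :
    Dy (fun z => a z.1 + z.2 * h z) =ᶠ[𝓝 0] fun z => z.2 * Dy h z + h z := by
  have t1 : Tendsto (fun z : E × ℝ => z.1) (𝓝 0) (𝓝 0) := continuous_fst.tendsto' _ _ rfl
  filter_upwards [t1.eventually ha.eventually_analyticAt, hh.eventually_analyticAt] with z h1 h2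
  have e1 : HasFDerivAt (fun z : E × ℝ => a z.1)
    ((fderiv ℝ a z.1).comp (ContinuousLinearMap.fst ℝ E ℝ)) z :=
    h1.differentiableAt.hasFDerivAt.comp z hasFDerivAt_fst
  have e2 : HasFDerivAt (fun z : E × ℝ => z.2 * h z) _ z :=
    (hasFDerivAt_snd).mul h2.differentiableAt.hasFDerivAt
  have := (e1.add e2).fderiv
  unfold Dy
  erw [this]
  simp

lemma Dy_iter_add_mul {a : E → ℝ} {h : E × ℝ → ℝ} (ha : AnalyticAt ℝ a 0)
    (hh : AnalyticAt ℝ h 0) (k : ℕ) :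
    Dy^[k+1] (fun z => a z.1 + z.2 * h z) =ᶠ[𝓝 0]
      fun z => z.2 * Dy^[k+1] h z + (k+1) * Dy^[k] h z := by
  induction k with
  | zero => simpa using Dy_add_mul ha hh
  | succ k ih =>
    rw [Function.iterate_succ_apply']
    refine (Dy_congr ih).trans ?_
    have A1 := Dy_iter_analytic hh (k+1)
    have A0 := Dy_iter_analytic hh k
    filter_upwards [A1.eventually_analyticAt, A0.eventually_analyticAt] with z h1 h0
    have e2 : HasFDerivAt (fun z : E × ℝ => z.2 * Dy^[k+1] h z) _ z :=
      (hasFDerivAt_snd).mul h1.differentiableAt.hasFDerivAt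
    have e3 : HasFDerivAt (fun z : E × ℝ => ((k:ℝ)+1) * Dy^[k] h z) _ z :=
      h0.differentiableAt.hasFDerivAt.const_mul _
    have := (e2.add e3).fderiv
    conv_lhs => unfold Dy
    erw [this]
    rw [Function.iterate_succ_apply' _ (k+1)]
    have e4 : fderiv ℝ (Dy^[k] h) z (0,1) = Dy^[k+1] h z := by
      rw [Function.iterate_succ_apply']; rfl
    simp only [_root_.add_apply, _root_.smul_apply, e4,
      ContinuousLinearMap.coe_snd', smul_eq_mul]
    push_cast
    change z.2 * Dy (Dy^[k+1] h) z + _ + _ = _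
    ring

lemma tendsto_axis : Tendsto (fun x : E => (x, (0:ℝ))) (𝓝 0) (𝓝 0) :=
  (Continuous.prodMk_left (0:ℝ)).tendsto' _ _ rfl

lemma analyticAt_axis : AnalyticAt ℝ (fun x : E => (x, (0:ℝ))) 0 := by fun_prop

lemma taylor (d : ℕ) : ∀ (g : E × ℝ → ℝ), AnalyticAt ℝ g 0 →
    ∃ (a : ℕ → E → ℝ) (v : E × ℝ → ℝ), (∀ i, AnalyticAt ℝ (a i) 0) ∧ AnalyticAt ℝ v 0 ∧
      (∀ᶠ z in 𝓝 0, g z = ∑ i ∈ Finset.range d, a i z.1 * z.2 ^ i + z.2 ^ d * v z) ∧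
      (∀ i < d, ∀ᶠ x in 𝓝 0, Dy^[i] g (x, 0) = i.factorial * a i x) ∧
      (∀ᶠ x in 𝓝 0, Dy^[d] g (x, 0) = d.factorial * v (x, 0)) := by
  induction d with
  | zero =>
    intro g hg
    exact ⟨fun _ _ => 0, g, fun _ => analyticAt_const, hg, by simp, by simp, by simp⟩
  | succ d ih =>
    intro g hg
    obtain ⟨h, hh, hgh⟩ := exists_div (ContinuousLinearMap.snd ℝ E ℝ) (0,1) g hg
    obtain ⟨a, v, ha, hv, hsum, hD, hDv⟩ := ih h hh
    have ha0 : AnalyticAt ℝ (fun x : E => g (x, 0)) 0 :=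
      AnalyticAt.fun_comp (f := fun x : E => (x, (0:ℝ))) (x := 0) hg analyticAt_axis
    have hgh' : g =ᶠ[𝓝 0] fun z => (fun x : E => g (x, 0)) z.1 + z.2 * h z := by
      filter_upwards [hgh] with z hz
      rw [hz]
      have : z - (ContinuousLinearMap.snd ℝ E ℝ) z • ((0:E), (1:ℝ)) = (z.1, 0) := by
        ext <;> simp
      rw [this]; simp
    have key : ∀ k, ∀ᶠ x : E in 𝓝 0, Dy^[k+1] g (x, 0) = (k+1) * Dy^[k] h (x, 0) := by
      intro k
      have := (Dy_iter_congr hgh' (k+1)).trans (Dy_iter_add_mul ha0 hh k)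
      filter_upwards [tendsto_axis.eventually this] with x hx
      rw [hx]; simp
    refine ⟨fun i => Nat.casesOn i (fun x => g (x, 0)) a, v, ?_, hv, ?_, ?_, ?_⟩
    · intro i
      cases i with
      | zero => exact ha0
      | succ i => exact ha i
    · filter_upwards [hgh', hsum] with z h1 h2
      rw [h1, h2, Finset.sum_range_succ', mul_add, Finset.mul_sum]
      simp only [pow_zero, mul_one, pow_succ]
      have : ∀ i, z.2 * (a i z.1 * z.2 ^ i) = a i z.1 * (z.2 ^ i * z.2) := fun i => by ring
      simp only [this]
      change _ = _ + g (z.1, 0) + _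
      ring
    · intro i hi
      cases i with
      | zero => simp
      | succ i =>
        filter_upwards [key i, hD i (by omega)] with x h1 h2
        rw [h1, h2, Nat.factorial_succ]; push_cast; ring
    · filter_upwards [key d, hDv] with x h1 h2
      rw [h1, h2, Nat.factorial_succ]; push_cast; ring

lemma exists_implicit [CompleteSpace E] {h : E × ℝ → ℝ} (hh : AnalyticAt ℝ h 0) (h0 : h 0 = 0)
    (hD : Dy h 0 ≠ 0) :
    ∃ ψ : E → ℝ, AnalyticAt ℝ ψ 0 ∧ ψ 0 = 0 ∧ ∀ᶠ x in 𝓝 0, h (x, ψ x) = 0 := by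
  have hc : ContDiffAt ℝ ⊤ h ((0:E), (0:ℝ)) := hh.contDiffAt
  have inv : (fderiv ℝ h ((0:E), (0:ℝ)) ∘L .inr ℝ E ℝ).IsInvertible := by
    refine ⟨ContinuousLinearEquiv.unitsEquivAut ℝ (Units.mk0 _ hD), ?_⟩
    ext
    simp [Dy]
    rfl
  refine ⟨hc.implicitFunction (by simp) inv, ?_, ?_, ?_⟩
  · exact (hc.contDiffAt_implicitFunction (by simp) inv).analyticAt
  · exact hc.implicitFunction_apply_self (by simp) inv
  · filter_upwards [hc.eventually_apply_implicitFunction (by simp) inv] with x hx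
    exact hx.trans h0

lemma Dy_iter_translate {g : E × ℝ → ℝ} (hg : AnalyticAt ℝ g 0) {ψ : E → ℝ}
    (hψ : AnalyticAt ℝ ψ 0) (hψ0 : ψ 0 = 0) (k : ℕ) :
    Dy^[k] (fun z => g (z.1, z.2 + ψ z.1)) =ᶠ[𝓝 0] fun z => (Dy^[k] g) (z.1, z.2 + ψ z.1) := by
  have t1 : Tendsto (fun z : E × ℝ => z.1) (𝓝 0) (𝓝 0) := continuous_fst.tendsto' _ _ rfl
  have hτ : AnalyticAt ℝ (fun z : E × ℝ => (z.1, z.2 + ψ z.1)) 0 := by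
    have : AnalyticAt ℝ (fun z : E × ℝ => ψ z.1) 0 := AnalyticAt.fun_comp (x := (0:E×ℝ)) hψ analyticAt_fst
    exact analyticAt_fst.prod (analyticAt_snd.add this)
  have t2 : Tendsto (fun z : E × ℝ => (z.1, z.2 + ψ z.1)) (𝓝 0) (𝓝 0) := by
    have := hτ.continuousAt.tendsto
    simpa only [Prod.fst_zero, Prod.snd_zero, hψ0, add_zero, Prod.mk_zero_zero] using this
  induction k with
  | zero => exact EventuallyEq.rfl
  | succ k ih =>
    rw [Function.iterate_succ_apply']
    refine (Dy_congr ih).trans ?_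
    have A := Dy_iter_analytic hg k
    filter_upwards [t2.eventually A.eventually_analyticAt, t1.eventually hψ.eventually_analyticAt]
      with z h1 h2
    have e1 : HasFDerivAt (fun z : E × ℝ => ψ z.1)
      ((fderiv ℝ ψ z.1).comp (ContinuousLinearMap.fst ℝ E ℝ)) z :=
      h2.differentiableAt.hasFDerivAt.comp z hasFDerivAt_fst
    have e2 : HasFDerivAt (fun z : E × ℝ => (z.1, z.2 + ψ z.1)) _ z :=
      hasFDerivAt_fst.prodMk (hasFDerivAt_snd.add e1)
    have e3 := h1.differentiableAt.hasFDerivAt.comp z e2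
    rw [Function.iterate_succ_apply']
    change fderiv ℝ (Dy^[k] g ∘ fun z => (z.1, z.2 + ψ z.1)) z (0, 1) =
      fderiv ℝ (Dy^[k] g) (z.1, z.2 + ψ z.1) (0, 1)
    rw [e3.fderiv]
    simp

end Dy
end Loj

namespace Loj
open Filter Topology

/-- Monomials. -/
def mono {n : ℕ} (α : Fin n → ℕ) (x : Fin n → ℝ) : ℝ := ∏ i, x i ^ α i

lemma mono_add {n : ℕ} (α β : Fin n → ℕ) (x : Fin n → ℝ) :
    mono (α + β) x = mono α x * mono β x := by
  simp [mono, pow_add, Finset.prod_mul_distrib]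

lemma mono_single {n : ℕ} (i : Fin n) (x : Fin n → ℝ) : mono (Pi.single i 1) x = x i := by
  unfold mono
  rw [Finset.prod_eq_single i]
  · simp
  · intro j _ hj; simp [hj]
  · simp

lemma mono_zero {n : ℕ} (x : Fin n → ℝ) : mono 0 x = 1 := by simp [mono]

lemma mono_smul {n : ℕ} (k : ℕ) (α : Fin n → ℕ) (x : Fin n → ℝ) :
    mono (k • α) x = mono α x ^ k := by
  simp [mono, Finset.prod_pow, pow_mul']

lemma analyticAt_coord {n : ℕ} (i : Fin n) (z : Fin n → ℝ) :
    AnalyticAt ℝ (fun x : Fin n → ℝ => x i) z :=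
  (ContinuousLinearMap.proj (R := ℝ) (φ := fun _ : Fin n => ℝ) i).analyticAt z

lemma mono_analytic {n : ℕ} (α : Fin n → ℕ) (z : Fin n → ℝ) : AnalyticAt ℝ (mono α) z := by
  unfold mono
  exact Finset.analyticAt_fun_prod _ fun i _ => (analyticAt_coord i z).pow _

lemma mono_apply_zero {n : ℕ} {α : Fin n → ℕ} (h : α ≠ 0) : mono α 0 = 0 := by
  obtain ⟨i, hi⟩ := Function.ne_iff.1 h
  exact Finset.prod_eq_zero (Finset.mem_univ i) (by simpa using hi)

/-- `f` is a unit times the monomial `x ^ α`. -/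
def IsMono {n : ℕ} (f : (Fin n → ℝ) → ℝ) (α : Fin n → ℕ) : Prop :=
  ∃ u : (Fin n → ℝ) → ℝ, AnalyticAt ℝ u 0 ∧ u 0 ≠ 0 ∧ f =ᶠ[𝓝 0] fun x => u x * mono α x

/-- normal crossings -/
def NC {n : ℕ} (f : (Fin n → ℝ) → ℝ) : Prop := ∃ α, IsMono f α

lemma single_decomp {n : ℕ} (α : Fin n → ℕ) (i : Fin n) (hi : α i ≠ 0) :
    ∃ α' : Fin n → ℕ, α = α' + Pi.single i 1 ∧ ∑ j, α j = ∑ j, α' j + 1 := by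
  have : α = (α - Pi.single i 1) + Pi.single i 1 := by
    funext j
    rcases eq_or_ne j i with rfl | hj
    · simp; omega
    · simp [hj]
  refine ⟨_, this, ?_⟩
  conv_lhs => rw [this]
  simp [Finset.sum_add_distrib]

lemma coord_not_zero {n : ℕ} (i : Fin n) : ¬ (fun x : Fin n → ℝ => x i) =ᶠ[𝓝 0] 0 := by
  intro h
  have hc : Tendsto (fun t : ℝ => (Pi.single i t : Fin n → ℝ)) (𝓝 0) (𝓝 0) := by
    have : Continuous (fun t : ℝ => (Pi.single i t : Fin n → ℝ)) :=
      continuous_single (A := fun _ : Fin n => ℝ) i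
    exact this.tendsto' _ _ (by simp)
  have := hc.eventually h
  simp at this
  have h2 : ∀ᶠ t : ℝ in 𝓝[≠] 0, t = 0 := this.filter_mono nhdsWithin_le_nhds
  obtain ⟨t, ht, ht'⟩ := (h2.and self_mem_nhdsWithin).exists
  exact ht' ht

lemma factor_aux {n : ℕ} (N : ℕ) : ∀ (α : Fin n → ℕ) (f g u : (Fin n → ℝ) → ℝ),
    ∑ j, α j = N → AnalyticAt ℝ f 0 → AnalyticAt ℝ g 0 → AnalyticAt ℝ u 0 → u 0 ≠ 0 →
    (∀ᶠ x in 𝓝 0, f x * g x = u x * mono α x) → NC f := by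
  induction N with
  | zero =>
    intro α f g u hα hf hg hu hu0 h
    have h0 := h.self_of_nhds
    have hα0 : α = 0 := by
      funext j
      simp only [Finset.sum_eq_zero_iff, Finset.mem_univ, true_imp_iff] at hα
      exact hα j
    subst hα0
    rw [mono_zero, mul_one] at h0
    refine ⟨0, f, hf, ?_, ?_⟩
    · intro hf0; rw [hf0, zero_mul] at h0; exact hu0 h0.symm
    · exact Eventually.of_forall fun x => by simp [mono_zero]
  | succ N ih =>
    intro α f g u hα hf hg hu hu0 h
    obtain ⟨i, hi⟩ : ∃ i, α i ≠ 0 := by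
      by_contra hcon; push Not at hcon; simp [hcon] at hα
    obtain ⟨α', hα', hs⟩ := single_decomp α i hi
    have hs' : ∑ j, α' j = N := by omega
    let l := ContinuousLinearMap.proj (R := ℝ) (φ := fun _ : Fin n => ℝ) i
    let e : Fin n → ℝ := Pi.single i 1
    have hπ : AnalyticAt ℝ (fun z : Fin n → ℝ => z - l z • e) 0 :=
      analyticAt_id.sub ((l.analyticAt 0).smul analyticAt_const)
    have hπ0 : (0 : Fin n → ℝ) - l 0 • e = 0 := by simp
    have tπ : Tendsto (fun z : Fin n → ℝ => z - l z • e) (𝓝 0) (𝓝 0) := by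
      have := hπ.continuousAt.tendsto
      rwa [hπ0] at this
    have hprod : ∀ᶠ z in 𝓝 (0 : Fin n → ℝ), f (z - l z • e) * g (z - l z • e) = 0 := by
      filter_upwards [tπ.eventually h] with z hz
      rw [hz, hα', mono_add, mono_single]
      simp [l, e]
    have key : ∀ f : (Fin n → ℝ) → ℝ, AnalyticAt ℝ f 0 →
        (fun z : Fin n → ℝ => f (z - l z • e)) =ᶠ[𝓝 0] 0 → ∃ k, AnalyticAt ℝ k 0 ∧
          f =ᶠ[𝓝 0] fun z => z i * k z := by
      intro f hf h0
      obtain ⟨k, hk, hfk⟩ := exists_div l e f hf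
      refine ⟨k, hk, ?_⟩
      filter_upwards [hfk, h0] with z h1 h2
      rw [h1]
      simp only [Pi.zero_apply] at h2
      rw [h2, zero_add]; rfl
    have cancel : ∀ k : (Fin n → ℝ) → ℝ, AnalyticAt ℝ k 0 →
        (∀ᶠ z in 𝓝 (0 : Fin n → ℝ), z i * k z = u z * mono α z) →
        ∀ᶠ z in 𝓝 (0 : Fin n → ℝ), k z = u z * mono α' z := by
      intro k hk hkz
      have := germ_mul_eq_zero (analyticAt_coord i 0) (hk.sub (hu.mul (mono_analytic α' 0))) (by
        filter_upwards [hkz] with z hz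
        simp only [Pi.sub_apply, Pi.mul_apply]
        rw [hα', mono_add, mono_single] at hz
        rw [mul_sub, hz]; ring)
      rcases this with h1 | h1
      · exact absurd h1 (coord_not_zero i)
      · filter_upwards [h1] with z hz
        simpa [sub_eq_zero] using hz
    have hf' : AnalyticAt ℝ (fun z => f (z - l z • e)) 0 := AnalyticAt.fun_comp (by simpa using hf) hπ
    have hg' : AnalyticAt ℝ (fun z => g (z - l z • e)) 0 := AnalyticAt.fun_comp (by simpa using hg) hπ
    rcases germ_mul_eq_zero hf' hg' hprod with h1 | h1
    · obtain ⟨k, hk, hfk⟩ := key f hf h1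
      have h2 := cancel (k * g) (hk.mul hg) (by
        filter_upwards [h, hfk] with z h3 h4
        rw [← h3, h4, Pi.mul_apply]; ring)
      obtain ⟨γ, w, hw, hw0, hkw⟩ := ih α' k g u hs' hk hg hu hu0 h2
      refine ⟨γ + Pi.single i 1, w, hw, hw0, ?_⟩
      filter_upwards [hfk, hkw] with z h3 h4
      rw [h3, h4, mono_add, mono_single]; ring
    · obtain ⟨k, hk, hfk⟩ := key g hg h1
      have h2 := cancel (f * k) (hf.mul hk) (by
        filter_upwards [h, hfk] with z h3 h4
        rw [← h3, h4, Pi.mul_apply]; ring)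
      exact ih α' f k u hs' hf hk hu hu0 h2

lemma NC.of_mul {n : ℕ} {f g : (Fin n → ℝ) → ℝ} (hf : AnalyticAt ℝ f 0) (hg : AnalyticAt ℝ g 0)
    (h : NC (fun x => f x * g x)) : NC f ∧ NC g := by
  obtain ⟨α, u, hu, hu0, he⟩ := h
  refine ⟨factor_aux _ α f g u rfl hf hg hu hu0 he, factor_aux _ α g f u rfl hg hf hu hu0 ?_⟩
  filter_upwards [he] with x hx
  rw [← hx, mul_comm]

lemma NC.of_prod {n : ℕ} {ι : Type*} (s : Finset ι) (f : ι → (Fin n → ℝ) → ℝ)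
    (hf : ∀ i ∈ s, AnalyticAt ℝ (f i) 0)
    (h : NC (fun x => ∏ i ∈ s, f i x)) : ∀ i ∈ s, NC (f i) := by
  classical
  intro i hi
  have : (fun x => ∏ i ∈ s, f i x) = fun x => f i x * ∏ j ∈ s.erase i, f j x := by
    funext x; rw [Finset.mul_prod_erase s (fun i => f i x) hi]
  rw [this] at h
  refine (NC.of_mul (hf i hi) ?_ h).1
  exact Finset.analyticAt_fun_prod _ fun j hj => hf j (Finset.mem_of_mem_erase hj)

lemma germ_prod_ne_zero {E : Type*} [NormedAddCommGroup E] [NormedSpace ℝ E] {ι : Type*}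
    (s : Finset ι) (f : ι → E → ℝ)
    (hf : ∀ i ∈ s, AnalyticAt ℝ (f i) 0) (h : ∀ i ∈ s, ¬ f i =ᶠ[𝓝 0] 0) :
    ¬ (fun x => ∏ i ∈ s, f i x) =ᶠ[𝓝 0] 0 := by
  classical
  induction s using Finset.induction_on with
  | empty =>
    intro h0
    have := h0.self_of_nhds
    simp at this
  | insert a s ha ih =>
    intro h0
    rcases germ_mul_eq_zero (f := f a) (g := fun x => ∏ i ∈ s, f i x) (hf a (by simp))
      (Finset.analyticAt_fun_prod _ fun j hj => hf j (by simp [hj])) (by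
        filter_upwards [h0] with x hx
        rw [← Finset.prod_insert (f := fun i => f i x) ha]; exact hx) with h1 | h1
    · exact h a (by simp) h1
    · exact ih (fun i hi => hf i (by simp [hi])) (fun i hi => h i (by simp [hi])) h1

lemma one_var_order {U V W : ℝ → ℝ} {U0 V0 W0 : ℝ} {a b c : ℕ}
    (hU : Tendsto U (𝓝[>] 0) (𝓝 U0)) (hV : Tendsto V (𝓝[>] 0) (𝓝 V0))
    (hW : Tendsto W (𝓝[>] 0) (𝓝 W0)) (hW0 : W0 ≠ 0)
    (h : ∀ᶠ t in 𝓝[>] 0, U t * t ^ a + V t * t ^ b = W t * t ^ c) : min a b ≤ c := by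
  by_contra hlt
  push Not at hlt
  have ha : c < a := lt_of_lt_of_le hlt (min_le_left _ _)
  have hb : c < b := lt_of_lt_of_le hlt (min_le_right _ _)
  have ht : ∀ k, 0 < k → Tendsto (fun t : ℝ => t ^ k) (𝓝[>] 0) (𝓝 0) := by
    intro k hk
    have : Tendsto (fun t : ℝ => t ^ k) (𝓝 0) (𝓝 0) :=
      (continuous_pow k).tendsto' _ _ (by simp; omega)
    exact this.mono_left nhdsWithin_le_nhds
  have h1 : Tendsto (fun t => U t * t ^ (a - c) + V t * t ^ (b - c)) (𝓝[>] 0) (𝓝 0) := by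
    have := (hU.mul (ht (a-c) (by omega))).add (hV.mul (ht (b-c) (by omega)))
    simpa using this
  have h2 : Tendsto W (𝓝[>] 0) (𝓝 0) := by
    refine h1.congr' ?_
    filter_upwards [h, self_mem_nhdsWithin] with t h3 h4
    have h4' : (0:ℝ) < t := h4
    have : t ^ c ≠ 0 := by positivity
    apply mul_right_cancel₀ this
    rw [← h3, add_mul, mul_assoc, mul_assoc, ← pow_add, ← pow_add,
      Nat.sub_add_cancel ha.le, Nat.sub_add_cancel hb.le]
  exact hW0 (tendsto_nhds_unique hW h2)

lemma comparable {n : ℕ} {f g h : (Fin n → ℝ) → ℝ} {α β γ : Fin n → ℕ} (hf : IsMono f α)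
    (hg : IsMono g β) (hh : IsMono h γ) (he : h =ᶠ[𝓝 0] f - g) : α ≤ β ∨ β ≤ α := by
  obtain ⟨u, hu, hu0, hfu⟩ := hf
  obtain ⟨v, hv, hv0, hgv⟩ := hg
  obtain ⟨w, hw, hw0, hhw⟩ := hh
  let dot : (Fin n → ℕ) → (Fin n → ℕ) → ℕ := fun s a => ∑ i, s i * a i
  have hcurve : ∀ s : Fin n → ℕ, (∀ i, 0 < s i) →
      Tendsto (fun t : ℝ => (fun i => t ^ s i : Fin n → ℝ)) (𝓝[>] 0) (𝓝 0) := by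
    intro s hs
    have : Continuous (fun t : ℝ => (fun i => t ^ s i : Fin n → ℝ)) := by fun_prop
    have h2 : Tendsto (fun t : ℝ => (fun i => t ^ s i : Fin n → ℝ)) (𝓝 0) (𝓝 0) :=
      this.tendsto' _ _ (by funext i; simpa using (hs i).ne')
    exact h2.mono_left nhdsWithin_le_nhds
  have hm : ∀ (s a : Fin n → ℕ) (t : ℝ), mono a (fun i => t ^ s i) = t ^ dot s a := by
    intro s a t
    simp [mono, dot, ← pow_mul, Finset.prod_pow_eq_pow_sum]
  have hrel : ∀ s : Fin n → ℕ, (∀ i, 0 < s i) →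
      min (dot s α) (dot s β) ≤ dot s γ ∧ min (dot s γ) (dot s β) ≤ dot s α ∧
      min (dot s α) (dot s γ) ≤ dot s β := by
    intro s hs
    have hc := hcurve s hs
    have tu := (hu.continuousAt.tendsto).comp hc
    have tv := (hv.continuousAt.tendsto).comp hc
    have tw := (hw.continuousAt.tendsto).comp hc
    have hev := hc.eventually ((hfu.and hgv).and (hhw.and he))
    refine ⟨one_var_order tu tv.neg tw hw0 ?_, one_var_order tw tv tu hu0 ?_,
      one_var_order tu tw.neg tv hv0 ?_⟩
    all_goals
      filter_upwards [hev] with t ht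
      obtain ⟨⟨h1, h2⟩, h3, h4⟩ := ht
      rw [Pi.sub_apply, h1, h2, h3, hm, hm, hm] at h4
      simp only [Function.comp_apply]
      linarith
  by_contra hcon
  push Not at hcon
  obtain ⟨h1, h2⟩ := hcon
  simp only [Pi.le_def, not_forall, not_le] at h1 h2
  obtain ⟨j, hj⟩ := h1
  obtain ⟨i, hi⟩ := h2
  have hex : ∀ (a b : Fin n → ℕ) (i : Fin n), a i < b i → ∃ s : Fin n → ℕ, (∀ i, 0 < s i) ∧
      dot s a < dot s b := by
    intro a b i hab
    let K := ∑ k, a k + 1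
    refine ⟨fun k => 1 + if k = i then K else 0, fun k => by positivity, ?_⟩
    simp only [dot, add_mul, Finset.sum_add_distrib, ite_mul, zero_mul, one_mul,
      Finset.sum_ite_eq', Finset.mem_univ, if_true]
    have : K * (a i + 1) ≤ K * b i := Nat.mul_le_mul_left _ hab
    have hK : K = ∑ k, a k + 1 := rfl
    rw [mul_add, mul_one] at this
    clear_value K
    omega
  obtain ⟨s, hs, hs'⟩ := hex α β i hi
  obtain ⟨s', hs2, hs2'⟩ := hex β α j hj
  have hadd : ∀ a, dot (s + s') a = dot s a + dot s' a := by
    intro a; simp [dot, add_mul, Finset.sum_add_distrib]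
  have r1 := hrel s hs
  have r2 := hrel s' hs2
  have r3 := hrel (s + s') (fun i => by simp [hs i])
  rw [hadd, hadd, hadd] at r3
  omega

end Loj

namespace Loj
open Filter Topology

section Charts
variable {X : Type*} {E F G : Type*} [NormedAddCommGroup E] [NormedSpace ℝ E]
  [NormedAddCommGroup F] [NormedSpace ℝ F] [NormedAddCommGroup G] [NormedSpace ℝ G]

/-- `φ` is an analytic germ through which the given points factor. -/
def Chart (l : Filter X) (ξ' : X → E) (ξ : X → F) (φ : E → F) : Prop :=
  Tendsto ξ' l (𝓝 0) ∧ AnalyticAt ℝ φ 0 ∧ φ 0 = 0 ∧ ∀ᶠ p in l, φ (ξ' p) = ξ p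

lemma Chart.tendsto {l : Filter X} {ξ' : X → E} {ξ : X → F} {φ : E → F}
    (h : Chart l ξ' ξ φ) : Tendsto φ (𝓝 0) (𝓝 0) := by
  have := h.2.1.continuousAt.tendsto
  rwa [h.2.2.1] at this

lemma tendsto_of_analytic_zero {φ : E → F} (h : AnalyticAt ℝ φ 0) (h0 : φ 0 = 0) :
    Tendsto φ (𝓝 0) (𝓝 0) := by
  have := h.continuousAt.tendsto
  rwa [h0] at this

lemma analytic_comp_zero {φ : E → F} {g : F → G} (hg : AnalyticAt ℝ g 0) (h : AnalyticAt ℝ φ 0)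
    (h0 : φ 0 = 0) : AnalyticAt ℝ (fun z => g (φ z)) 0 :=
  AnalyticAt.fun_comp (by rwa [h0]) h

lemma Chart.comp {l : Filter X} {ξ₂ : X → E} {ξ₁ : X → F} {ξ : X → G} {φ : E → F} {ψ : F → G}
    (h : Chart l ξ₂ ξ₁ φ) (h' : Chart l ξ₁ ξ ψ) : Chart l ξ₂ ξ (fun z => ψ (φ z)) := by
  refine ⟨h.1, analytic_comp_zero h'.2.1 h.2.1 h.2.2.1, by simp [h.2.2.1, h'.2.2.1], ?_⟩
  filter_upwards [h.2.2.2, h'.2.2.2] with p h1 h2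
  rw [h1, h2]

lemma ultra_lim (l : Ultrafilter X) (r : X → ℝ) (C : ℝ) (h : ∀ᶠ p in (l : Filter X), |r p| ≤ C) :
    ∃ c, Tendsto r l (𝓝 c) := by
  have hc : IsCompact (Set.Icc (-C) C) := isCompact_Icc
  obtain ⟨c, _, hc'⟩ := hc.ultrafilter_le_nhds (l.map r) (by
    rw [le_principal_iff, Ultrafilter.coe_map, Filter.mem_map]
    filter_upwards [h] with p hp
    exact abs_le.1 hp)
  exact ⟨c, hc'⟩

end Charts

/-- Normal crossings on `(Fin n → ℝ) × ℝ`. -/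
def NCP {n : ℕ} (f : (Fin n → ℝ) × ℝ → ℝ) : Prop :=
  ∃ (α : Fin n → ℕ) (k : ℕ) (u : (Fin n → ℝ) × ℝ → ℝ), AnalyticAt ℝ u 0 ∧ u 0 ≠ 0 ∧
    f =ᶠ[𝓝 0] fun z => u z * (mono α z.1 * z.2 ^ k)

section NCP
variable {n : ℕ}

lemma NCP.congr {f g : (Fin n → ℝ) × ℝ → ℝ} (hf : NCP f) (h : g =ᶠ[𝓝 0] f) : NCP g := by
  obtain ⟨α, k, u, hu, hu0, he⟩ := hf
  exact ⟨α, k, u, hu, hu0, h.trans he⟩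

lemma NCP.unit {f : (Fin n → ℝ) × ℝ → ℝ} (hf : AnalyticAt ℝ f 0) (h0 : f 0 ≠ 0) : NCP f :=
  ⟨0, 0, f, hf, h0, Eventually.of_forall fun z => by simp [mono_zero]⟩

lemma NCP.fst (i : Fin n) : NCP (fun z : (Fin n → ℝ) × ℝ => z.1 i) :=
  ⟨Pi.single i 1, 0, fun _ => 1, analyticAt_const, one_ne_zero,
    Eventually.of_forall fun z => by simp [mono_single]⟩

lemma NCP.snd : NCP (fun z : (Fin n → ℝ) × ℝ => z.2) :=
  ⟨0, 1, fun _ => 1, analyticAt_const, one_ne_zero,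
    Eventually.of_forall fun z => by simp [mono_zero]⟩

lemma NCP.mul {f g : (Fin n → ℝ) × ℝ → ℝ} (hf : NCP f) (hg : NCP g) :
    NCP (fun z => f z * g z) := by
  obtain ⟨α, k, u, hu, hu0, he⟩ := hf
  obtain ⟨β, m, v, hv, hv0, he'⟩ := hg
  refine ⟨α + β, k + m, fun z => u z * v z, hu.mul hv, mul_ne_zero hu0 hv0, ?_⟩
  filter_upwards [he, he'] with z h1 h2
  rw [h1, h2, mono_add, pow_add]; ring

lemma NCP.pow {f : (Fin n → ℝ) × ℝ → ℝ} (hf : NCP f) (k : ℕ) : NCP (fun z => f z ^ k) := by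
  induction k with
  | zero => exact (NCP.unit (f := fun _ => 1) analyticAt_const one_ne_zero).congr
              (Eventually.of_forall fun z => by simp)
  | succ k ih => exact (ih.mul hf).congr (Eventually.of_forall fun z => by simp [pow_succ])

lemma NCP.prod {ι : Type*} (s : Finset ι) (f : ι → (Fin n → ℝ) × ℝ → ℝ) (hf : ∀ i ∈ s, NCP (f i)) :
    NCP (fun z => ∏ i ∈ s, f i z) := by
  classical
  induction s using Finset.induction_on with
  | empty => exact (NCP.unit (f := fun _ => 1) analyticAt_const one_ne_zero).congr
              (Eventually.of_forall fun z => by simp)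
  | insert a s ha ih =>
    refine ((hf a (by simp)).mul (ih fun i hi => hf i (by simp [hi]))).congr
      (Eventually.of_forall fun z => ?_)
    simp [Finset.prod_insert ha]

lemma NCP.mono {α : Fin n → ℕ} {φ : (Fin n → ℝ) × ℝ → (Fin n → ℝ)}
    (h : ∀ i, NCP (fun z => φ z i)) : NCP (fun z => mono α (φ z)) := by
  unfold Loj.mono
  exact NCP.prod _ _ fun i _ => (h i).pow _

end NCP

lemma analyticAt_pfst {n : ℕ} (i : Fin n) (z : (Fin n → ℝ) × ℝ) :
    AnalyticAt ℝ (fun z : (Fin n → ℝ) × ℝ => z.1 i) z :=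
  AnalyticAt.fun_comp (analyticAt_coord i _) analyticAt_fst

section Toric
variable {n : ℕ} {X : Type*}

lemma toric (l : Ultrafilter X) (N : ℕ) : ∀ (β : Fin n → ℕ) (ξ : X → (Fin n → ℝ) × ℝ),
    ∑ i, β i = N → Tendsto ξ l (𝓝 0) → (∀ᶠ p in (l : Filter X), (ξ p).2 ≠ 0) →
    Tendsto (fun p => mono β (ξ p).1 / (ξ p).2) l (𝓝 0) →
    ∃ (ξ' : X → (Fin n → ℝ) × ℝ) (φ : (Fin n → ℝ) × ℝ → (Fin n → ℝ) × ℝ)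
      (W : (Fin n → ℝ) × ℝ → ℝ), Chart (l : Filter X) ξ' ξ φ ∧
      (∀ i, NCP (fun z => (φ z).1 i)) ∧ NCP (fun z => (φ z).2) ∧ AnalyticAt ℝ W 0 ∧
      ∀ᶠ z in 𝓝 0, mono β (φ z).1 = (φ z).2 * W z := by
  induction N with
  | zero =>
    intro β ξ hβ hξ hy hw
    exfalso
    have hβ0 : β = 0 := by
      funext j
      simp only [Finset.sum_eq_zero_iff, Finset.mem_univ, true_imp_iff] at hβ
      exact hβ j
    subst hβ0
    simp only [mono_zero] at hw
    have h2 : Tendsto (fun p => (ξ p).2) l (𝓝 0) :=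
      (continuous_snd.tendsto' (0 : (Fin n → ℝ) × ℝ) 0 rfl).comp hξ
    have h3 := h2.mul hw
    have h4 : Tendsto (fun _ : X => (1:ℝ)) l (𝓝 (0 * 0)) := by
      refine h3.congr' ?_
      filter_upwards [hy] with p hp
      field_simp
    have := tendsto_nhds_unique h4 tendsto_const_nhds
    norm_num at this
  | succ N ih =>
    intro β ξ hβ hξ hy hw
    obtain ⟨i, hi⟩ : ∃ i, β i ≠ 0 := by
      by_contra hcon; push Not at hcon; simp [hcon] at hβ
    obtain ⟨β', hβ', hs⟩ := single_decomp β i hi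
    have hs' : ∑ j, β' j = N := by omega
    have h1 : Tendsto (fun p => (ξ p).1) l (𝓝 0) :=
      (continuous_fst.tendsto' (0 : (Fin n → ℝ) × ℝ) 0 rfl).comp hξ
    have h2 : Tendsto (fun p => (ξ p).2) l (𝓝 0) :=
      (continuous_snd.tendsto' (0 : (Fin n → ℝ) × ℝ) 0 rfl).comp hξ
    by_cases hcase : ∀ᶠ p in (l : Filter X), |(ξ p).2| ≤ |(ξ p).1 i|
    · have hx : ∀ᶠ p in (l : Filter X), (ξ p).1 i ≠ 0 := by
        filter_upwards [hcase, hy] with p h3 h4 h5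
        rw [h5, abs_zero] at h3
        exact h4 (abs_nonpos_iff.1 h3)
      obtain ⟨c, hc⟩ := ultra_lim l (fun p => (ξ p).2 / (ξ p).1 i) 1 (by
        filter_upwards [hcase, hx] with p h3 h4
        rw [abs_div]
        exact div_le_one_of_le₀ h3 (abs_nonneg _))
      have hφ : AnalyticAt ℝ (fun z : (Fin n → ℝ) × ℝ => (z.1, z.1 i * (c + z.2))) 0 :=
        analyticAt_fst.prod ((analyticAt_pfst i 0).mul (analyticAt_const.add analyticAt_snd))
      have hch : Chart (l : Filter X) (fun p => ((ξ p).1, (ξ p).2 / (ξ p).1 i - c)) ξ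
          (fun z : (Fin n → ℝ) × ℝ => (z.1, z.1 i * (c + z.2))) := by
        refine ⟨?_, hφ, by simp, ?_⟩
        · have := h1.prodMk_nhds (hc.sub_const c)
          rwa [sub_self] at this
        · filter_upwards [hx] with p hp
          ext1
          · rfl
          · simp only []
            field_simp
            ring
      by_cases hc0 : c = 0
      · subst hc0
        have hξ2 := hch.1
        obtain ⟨ξ', φ, W, hC, hN1, hN2, hW, hWe⟩ := ih β' _ hs' hξ2 (by
          filter_upwards [hy, hx] with p h3 h4
          simp [h3, h4]) (by
          refine hw.congr' ?_
          filter_upwards [hy, hx] with p h3 h4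
          rw [hβ', mono_add, mono_single]
          simp only [sub_zero]
          field_simp)
        refine ⟨ξ', _, W, hC.comp hch, hN1, ?_, hW, ?_⟩
        · simp only [zero_add]
          exact (hN1 i).mul hN2
        · filter_upwards [hWe] with z hz
          rw [hβ', mono_add, mono_single]
          simp only [zero_add]
          rw [hz]; ring
      · have hu : AnalyticAt ℝ (fun z : (Fin n → ℝ) × ℝ => c + z.2) 0 :=
          analyticAt_const.add analyticAt_snd
        have hu0 : (fun z : (Fin n → ℝ) × ℝ => c + z.2) 0 ≠ 0 := by simpa using hc0
        refine ⟨_, _, fun z => mono β' z.1 / (c + z.2), hch, fun j => NCP.fst j,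
          (NCP.fst i).mul (NCP.unit hu hu0), ?_, ?_⟩
        · exact (AnalyticAt.fun_comp (mono_analytic β' _) analyticAt_fst).div hu hu0
        · filter_upwards [hu.continuousAt.eventually_ne hu0] with z hz
          rw [hβ', mono_add, mono_single]
          field_simp
    · have hcase' : ∀ᶠ p in (l : Filter X), |(ξ p).1 i| < |(ξ p).2| := by
        have := Ultrafilter.eventually_not.2 hcase
        filter_upwards [this] with p hp
        exact not_le.1 hp
      obtain ⟨c, hc⟩ := ultra_lim l (fun p => (ξ p).1 i / (ξ p).2) 1 (by
        filter_upwards [hcase'] with p h3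
        rw [abs_div]
        exact div_le_one_of_le₀ h3.le (abs_nonneg _))
      let φ : (Fin n → ℝ) × ℝ → (Fin n → ℝ) × ℝ := fun z =>
        (fun j => if j = i then z.2 * (c + z.1 i) else z.1 j, z.2)
      have hu : AnalyticAt ℝ (fun z : (Fin n → ℝ) × ℝ => c + z.1 i) 0 :=
        analyticAt_const.add (analyticAt_pfst i 0)
      have hφ1 : AnalyticAt ℝ (fun z => (φ z).1) 0 := by
        refine AnalyticAt.pi fun j => ?_
        by_cases hj : j = i
        · simp only [φ, hj, if_true]
          exact analyticAt_snd.mul hu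
        · simp only [φ, hj, if_false]
          exact analyticAt_pfst j 0
      have hφ : AnalyticAt ℝ φ 0 := hφ1.prod analyticAt_snd
      have hch : Chart (l : Filter X)
          (fun p => ((fun j => if j = i then (ξ p).1 i / (ξ p).2 - c else (ξ p).1 j), (ξ p).2)) ξ
          φ := by
        refine ⟨?_, hφ, ?_, ?_⟩
        · have : Tendsto (fun p => (fun j => if j = i then (ξ p).1 i / (ξ p).2 - c
              else (ξ p).1 j : Fin n → ℝ)) l (𝓝 0) := by
            rw [tendsto_pi_nhds]
            intro j
            by_cases hj : j = i
            · simp only [hj, if_true]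
              simpa using hc.sub_const c
            · simp only [hj, if_false]
              exact (tendsto_pi_nhds.1 h1) j
          exact this.prodMk_nhds h2
        · ext j
          · by_cases hj : j = i <;> simp [φ, hj]
          · simp [φ]
        · filter_upwards [hy] with p hp
          ext j
          · by_cases hj : j = i
            · subst hj
              simp only [φ, if_true]
              field_simp
              ring
            · simp [φ, hj]
          · rfl
      refine ⟨_, φ, fun z => mono β' (φ z).1 * (c + z.1 i), hch, ?_, NCP.snd, ?_, ?_⟩
      · intro j
        by_cases hj : j = i
        · simp only [φ, hj, if_true]
          refine NCP.snd.mul ?_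
          by_cases hc0 : c = 0
          · subst hc0
            simpa using NCP.fst i
          · exact NCP.unit hu (by simpa using hc0)
        · simp only [φ, hj, if_false]
          exact NCP.fst j
      · exact (AnalyticAt.fun_comp (mono_analytic β' _) hφ1).mul hu
      · refine Eventually.of_forall fun z => ?_
        rw [hβ', mono_add, mono_single]
        simp only [φ, if_true]
        ring

end Toric
end Loj

namespace Loj
open Filter Topology

section PowerSub
variable {n : ℕ} {X : Type*}

/-- The power substitution. -/
def psub (D : ℕ) (ε : Fin n → ℝ) (x : Fin n → ℝ) : Fin n → ℝ := fun i => ε i * x i ^ D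

lemma psub_analytic (D : ℕ) (ε : Fin n → ℝ) (z : Fin n → ℝ) : AnalyticAt ℝ (psub D ε) z :=
  AnalyticAt.pi fun i => analyticAt_const.mul ((analyticAt_coord i z).pow D)

lemma psub_zero {D : ℕ} (hD : D ≠ 0) (ε : Fin n → ℝ) : psub D ε 0 = 0 := by
  funext i
  simp [psub, hD]

lemma mono_psub (D : ℕ) (ε : Fin n → ℝ) (α : Fin n → ℕ) (x : Fin n → ℝ) :
    mono α (psub D ε x) = mono α ε * mono (D • α) x := by
  simp only [mono, psub, mul_pow, Finset.prod_mul_distrib, ← pow_mul, Pi.smul_apply, smul_eq_mul]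

lemma mono_ne_zero (α : Fin n → ℕ) {x : Fin n → ℝ} (h : ∀ i, x i ≠ 0) : mono α x ≠ 0 :=
  Finset.prod_ne_zero_iff.2 fun i _ => pow_ne_zero _ (h i)

lemma exists_psub (l : Ultrafilter X) {D : ℕ} (hD : D ≠ 0) (ξ : X → Fin n → ℝ)
    (hξ : Tendsto ξ l (𝓝 0)) :
    ∃ (ξ' : X → Fin n → ℝ) (ε : Fin n → ℝ), (∀ i, ε i ≠ 0) ∧
      Chart (l : Filter X) ξ' ξ (psub D ε) := by
  classical
  have hs : ∀ i : Fin n, ∃ e : ℝ, e ≠ 0 ∧ ∀ᶠ p in (l : Filter X), e * |ξ p i| = ξ p i := by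
    intro i
    by_cases h : ∀ᶠ p in (l : Filter X), 0 ≤ ξ p i
    · refine ⟨1, one_ne_zero, ?_⟩
      filter_upwards [h] with p hp
      rw [abs_of_nonneg hp, one_mul]
    · refine ⟨-1, by norm_num, ?_⟩
      filter_upwards [Ultrafilter.eventually_not.2 h] with p hp
      rw [abs_of_neg (not_le.1 hp)]; ring
  choose ε hε hε' using hs
  refine ⟨fun p i => |ξ p i| ^ ((D : ℝ)⁻¹), ε, hε, ?_, psub_analytic D ε 0, psub_zero hD ε, ?_⟩
  · rw [tendsto_pi_nhds]
    intro i
    have h1 : Tendsto (fun p => |ξ p i|) l (𝓝 0) := by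
      simpa using ((tendsto_pi_nhds.1 hξ) i).abs
    have h2 := h1.rpow_const (p := (D : ℝ)⁻¹) (Or.inr (by positivity))
    rwa [Real.zero_rpow (by positivity)] at h2
  · filter_upwards [eventually_all.2 hε'] with p hp
    funext i
    simp only [psub]
    rw [Real.rpow_inv_natCast_pow (abs_nonneg _) hD]
    exact hp i

lemma IsMono.psub {f : (Fin n → ℝ) → ℝ} {α : Fin n → ℕ} (h : IsMono f α) {D : ℕ} (hD : D ≠ 0)
    {ε : Fin n → ℝ} (hε : ∀ i, ε i ≠ 0) : IsMono (fun x => f (psub D ε x)) (D • α) := by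
  obtain ⟨u, hu, hu0, he⟩ := h
  refine ⟨fun x => u (Loj.psub D ε x) * mono α ε,
    (analytic_comp_zero hu (psub_analytic D ε 0) (psub_zero hD ε)).mul analyticAt_const, ?_, ?_⟩
  · simp only [psub_zero hD]
    exact mul_ne_zero hu0 (mono_ne_zero α hε)
  · filter_upwards [(tendsto_of_analytic_zero (psub_analytic D ε 0) (psub_zero hD ε)).eventually he]
      with x hx
    rw [hx, mono_psub]; ring

lemma IsMono.mul {f g : (Fin n → ℝ) → ℝ} {α β : Fin n → ℕ} (hf : IsMono f α) (hg : IsMono g β) :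
    IsMono (fun x => f x * g x) (α + β) := by
  obtain ⟨u, hu, hu0, he⟩ := hf
  obtain ⟨v, hv, hv0, he'⟩ := hg
  refine ⟨fun x => u x * v x, hu.mul hv, mul_ne_zero hu0 hv0, ?_⟩
  filter_upwards [he, he'] with x h1 h2
  rw [h1, h2, mono_add]; ring

lemma IsMono.pow {f : (Fin n → ℝ) → ℝ} {α : Fin n → ℕ} (hf : IsMono f α) (k : ℕ) :
    IsMono (fun x => f x ^ k) (k • α) := by
  obtain ⟨u, hu, hu0, he⟩ := hf
  refine ⟨fun x => u x ^ k, hu.pow k, pow_ne_zero _ hu0, ?_⟩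
  filter_upwards [he] with x h1
  rw [h1, mono_smul, mul_pow]

lemma comparable_of_eq {f g : (Fin n → ℝ) → ℝ} {α β : Fin n → ℕ} (hf : IsMono f α)
    (hg : IsMono g β) (h : f =ᶠ[𝓝 0] g) : α ≤ β ∨ β ≤ α := by
  obtain ⟨u, hu, hu0, he⟩ := hf
  refine comparable (f := fun x => 2 * f x) (g := g) (h := f) (γ := α) ?_ hg ⟨u, hu, hu0, he⟩ ?_
  · refine ⟨fun x => 2 * u x, analyticAt_const.mul hu, mul_ne_zero two_ne_zero hu0, ?_⟩
    filter_upwards [he] with x hx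
    rw [hx]; ring
  · filter_upwards [h] with x hx
    simp only [Pi.sub_apply]
    linarith

end PowerSub

/-- Local uniformization in dimension `n` along the ultrafilter `l`. -/
def LU {X : Type*} (l : Ultrafilter X) (n : ℕ) : Prop :=
  ∀ (ξ : X → Fin n → ℝ) (f : (Fin n → ℝ) → ℝ), Tendsto ξ l (𝓝 0) → AnalyticAt ℝ f 0 →
    ¬ f =ᶠ[𝓝 0] 0 → ∃ (ξ' : X → Fin n → ℝ) (φ : (Fin n → ℝ) → Fin n → ℝ),
      Chart (l : Filter X) ξ' ξ φ ∧ NC (fun x => f (φ x))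

section Prep
variable {n : ℕ} {X : Type*}

lemma germ_mul_ne {f g : (Fin n → ℝ) → ℝ} (hf : AnalyticAt ℝ f 0) (hg : AnalyticAt ℝ g 0)
    (h1 : ¬ f =ᶠ[𝓝 0] 0) (h2 : ¬ g =ᶠ[𝓝 0] 0) : ¬ (fun x => f x * g x) =ᶠ[𝓝 0] 0 := by
  intro h
  rcases germ_mul_eq_zero hf hg h with h | h
  exacts [h1 h, h2 h]

lemma NC.ne_zero {f : (Fin n → ℝ) → ℝ} (h : NC f) : ¬ f =ᶠ[𝓝 0] 0 := by
  obtain ⟨α, u, hu, hu0, he⟩ := h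
  intro h0
  have : (fun x => u x * mono α x) =ᶠ[𝓝 0] 0 := he.symm.trans h0
  have hm : AnalyticAt ℝ (mono α : (Fin n → ℝ) → ℝ) 0 := mono_analytic α 0
  rcases germ_mul_eq_zero hu hm this with h | h
  · exact hu0 h.self_of_nhds
  · have h3 : ¬ (fun x : Fin n → ℝ => ∏ i ∈ Finset.univ, x i ^ α i) =ᶠ[𝓝 0] 0 := by
      refine germ_prod_ne_zero _ _ (fun i _ => (analyticAt_coord i 0).pow _) fun i _ hi => ?_
      apply coord_not_zero i
      filter_upwards [hi] with x hx
      exact eq_zero_of_pow_eq_zero (n := α i) hx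
    exact h3 h

lemma NC.analytic {f : (Fin n → ℝ) → ℝ} (h : NC f) : AnalyticAt ℝ f 0 := by
  obtain ⟨α, u, hu, hu0, he⟩ := h
  exact (hu.mul (mono_analytic α 0)).congr he.symm

lemma prep (l : Ultrafilter X) (hU : LU l n) (d : ℕ) (ξ : X → Fin n → ℝ)
    (hξ : Tendsto ξ l (𝓝 0)) (M : (Fin n → ℝ) → ℝ) (hM : NC M)
    (a : ℕ → (Fin n → ℝ) → ℝ) (ha : ∀ i, AnalyticAt ℝ (a i) 0) (h0 : ∀ i < d, a i 0 = 0)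
    (hex : ∃ i < d, ¬ a i =ᶠ[𝓝 0] 0) :
    ∃ (ξ' : X → Fin n → ℝ) (φ : (Fin n → ℝ) → Fin n → ℝ) (β : Fin n → ℕ)
      (b : ℕ → (Fin n → ℝ) → ℝ), Chart (l : Filter X) ξ' ξ φ ∧ NC (fun x => M (φ x)) ∧ β ≠ 0 ∧
      (∀ i, AnalyticAt ℝ (b i) 0) ∧
      (∀ i < d, ∀ᶠ x in 𝓝 0, a i (φ x) = b i x * mono β x ^ (d - i)) ∧
      (∃ i < d, b i 0 ≠ 0) ∧ (∀ i, a i =ᶠ[𝓝 0] 0 → b i = 0) := by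
  classical
  let N : ℕ → ℕ := fun i => d.factorial / (d - i)
  have hN : ∀ i < d, (d - i) * N i = d.factorial := fun i hi =>
    Nat.mul_div_cancel' (Nat.dvd_factorial (by omega) (by omega))
  let I := (Finset.range d).filter (fun i => ¬ a i =ᶠ[𝓝 0] 0)
  let Δ : ℕ × ℕ → (Fin n → ℝ) → ℝ := fun q x => a q.1 x ^ N q.1 - a q.2 x ^ N q.2
  have hΔ : ∀ q, AnalyticAt ℝ (Δ q) 0 := fun q => ((ha _).pow _).sub ((ha _).pow _)
  let J := (I ×ˢ I).filter (fun q => ¬ Δ q =ᶠ[𝓝 0] 0)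
  have hP1 : AnalyticAt ℝ (fun x => ∏ i ∈ I, a i x) 0 :=
    Finset.analyticAt_fun_prod _ fun i _ => ha i
  have hP2 : AnalyticAt ℝ (fun x => ∏ q ∈ J, Δ q x) 0 :=
    Finset.analyticAt_fun_prod _ fun q _ => hΔ q
  have hP1' : ¬ (fun x => ∏ i ∈ I, a i x) =ᶠ[𝓝 0] 0 :=
    germ_prod_ne_zero _ _ (fun i _ => ha i) fun i hi => (Finset.mem_filter.1 hi).2
  have hP2' : ¬ (fun x => ∏ q ∈ J, Δ q x) =ᶠ[𝓝 0] 0 :=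
    germ_prod_ne_zero _ _ (fun q _ => hΔ q) fun q hq => (Finset.mem_filter.1 hq).2
  obtain ⟨ξ₁, φ₁, hc1, hnc⟩ := hU ξ _ hξ (hM.analytic.mul (hP1.mul hP2))
    (germ_mul_ne hM.analytic (hP1.mul hP2) hM.ne_zero (germ_mul_ne hP1 hP2 hP1' hP2'))
  have hcomp : ∀ {g : (Fin n → ℝ) → ℝ}, AnalyticAt ℝ g 0 → AnalyticAt ℝ (fun x => g (φ₁ x)) 0 :=
    fun hg => analytic_comp_zero hg hc1.2.1 hc1.2.2.1
  obtain ⟨hncM, hnc2⟩ := NC.of_mul (hcomp hM.analytic) ((hcomp hP1).mul (hcomp hP2)) hnc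
  obtain ⟨hncI, hncJ⟩ := NC.of_mul (hcomp hP1) (hcomp hP2) hnc2
  have hI := NC.of_prod I (fun i x => a i (φ₁ x)) (fun i _ => hcomp (ha i)) hncI
  have hJ := NC.of_prod J (fun q x => Δ q (φ₁ x)) (fun q _ => hcomp (hΔ q)) hncJ
  choose! α hα using hI
  have htot : ∀ i ∈ I, ∀ j ∈ I, N i • α i ≤ N j • α j ∨ N j • α j ≤ N i • α i := by
    intro i hi j hj
    by_cases hD : Δ (i, j) =ᶠ[𝓝 0] 0
    · refine comparable_of_eq ((hα i hi).pow (N i)) ((hα j hj).pow (N j)) ?_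
      filter_upwards [hc1.tendsto.eventually hD] with x hx
      exact sub_eq_zero.1 hx
    · obtain ⟨γ, hγ⟩ := hJ (i, j) (Finset.mem_filter.2 ⟨Finset.mk_mem_product hi hj, hD⟩)
      exact comparable ((hα i hi).pow (N i)) ((hα j hj).pow (N j)) hγ
        (Eventually.of_forall fun x => rfl)
  have hIne : I.Nonempty := by
    obtain ⟨i, hi, hi'⟩ := hex
    exact ⟨i, Finset.mem_filter.2 ⟨Finset.mem_range.2 hi, hi'⟩⟩
  obtain ⟨i₀, hi₀, hmin⟩ := Finset.exists_min_image I (fun i => ∑ k, (N i • α i) k) hIne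
  have hle : ∀ j ∈ I, N i₀ • α i₀ ≤ N j • α j := by
    intro j hj
    rcases htot i₀ hi₀ j hj with h | h
    · exact h
    · have h2 := (Finset.sum_eq_sum_iff_of_le (s := Finset.univ) fun k _ => h k).1
        (le_antisymm (Finset.sum_le_sum fun k _ => h k) (hmin j hj))
      exact fun k => (h2 k (Finset.mem_univ k)).ge
  have hfac : d.factorial ≠ 0 := Nat.factorial_ne_zero d
  obtain ⟨ξ₂, ε, hε, hc2⟩ := exists_psub l hfac ξ₁ hc1.1
  have hα2 := fun i hi => (hα i hi).psub hfac hε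
  set β := N i₀ • α i₀ with hβ
  have hexp : ∀ i ∈ I, d.factorial • α i = (d - i) • β + (d - i) • (N i • α i - β) := by
    intro i hi
    have hid : i < d := Finset.mem_range.1 (Finset.mem_filter.1 hi).1
    rw [← smul_add, add_tsub_cancel_of_le (hle i hi), smul_smul, hN i hid]
  have hb : ∀ i, ∃ b : (Fin n → ℝ) → ℝ, AnalyticAt ℝ b 0 ∧ (i ∉ I → b = 0) ∧
      (i = i₀ → b 0 ≠ 0) ∧ (i < d → ∀ᶠ x in 𝓝 0,
        a i (φ₁ (psub d.factorial ε x)) = b x * mono β x ^ (d - i)) := by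
    intro i
    by_cases hi : i ∈ I
    · obtain ⟨u, hu, hu0, he⟩ := hα2 i hi
      refine ⟨fun x => u x * mono ((d - i) • (N i • α i - β)) x,
        hu.mul (mono_analytic _ _), fun h => absurd hi h, ?_, fun hid => ?_⟩
      · rintro rfl
        simpa only [hβ, tsub_self, smul_zero, mono_zero, mul_one] using hu0
      · filter_upwards [he] with x hx
        rw [hx, hexp i hi, mono_add, mono_smul]; ring
    · refine ⟨0, analyticAt_const, fun _ => rfl, fun h => absurd (h ▸ hi₀) hi, fun hid => ?_⟩
      have hz : a i =ᶠ[𝓝 0] 0 := by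
        by_contra hcon
        exact hi (Finset.mem_filter.2 ⟨Finset.mem_range.2 hid, hcon⟩)
      filter_upwards [(hc2.comp hc1).tendsto.eventually hz] with x hx
      rw [hx]; simp
  choose b hb1 hb2 hb3 hb4 using hb
  have hi₀d : i₀ < d := Finset.mem_range.1 (Finset.mem_filter.1 hi₀).1
  obtain ⟨αM, hαM⟩ := hncM
  refine ⟨ξ₂, _, β, b, hc2.comp hc1, ⟨_, hαM.psub hfac hε⟩, ?_, hb1, hb4, ⟨i₀, hi₀d, hb3 i₀ rfl⟩,
    fun i hi => hb2 i fun hmem => (Finset.mem_filter.1 hmem).2 hi⟩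
  intro hβ0
  have h1 := (hb4 i₀ hi₀d).self_of_nhds
  rw [hβ0, mono_zero, one_pow, mul_one, psub_zero hfac, hc1.2.2.1, h0 i₀ hi₀d] at h1
  exact hb3 i₀ rfl h1.symm

end Prep
end Loj

namespace Loj
open Filter Topology

section Poly
open Polynomial

lemma poly_dvd (d : ℕ) : ∀ (R : ℝ[X]) (V : ℝ → ℝ), ContinuousAt V 0 →
    (∀ᶠ t in 𝓝[≠] (0:ℝ), R.eval t = t ^ d * V t) → X ^ d ∣ R := by
  induction d with
  | zero => intro R V _ _; simp
  | succ d ih =>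
    intro R V hV h
    have h1 : Tendsto (fun t => R.eval t) (𝓝[≠] (0:ℝ)) (𝓝 (R.eval 0)) :=
      (R.continuous.tendsto 0).mono_left nhdsWithin_le_nhds
    have h2 : Tendsto (fun t : ℝ => t ^ (d + 1) * V t) (𝓝[≠] (0:ℝ)) (𝓝 (0 ^ (d + 1) * V 0)) :=
      (((continuous_pow (d + 1)).tendsto 0).mul hV.tendsto).mono_left nhdsWithin_le_nhds
    have h3 : R.eval 0 = 0 := by
      have := tendsto_nhds_unique (h1.congr' h) h2
      rw [this]; simp
    obtain ⟨S, rfl⟩ : X ∣ R := by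
      rw [X_dvd_iff, coeff_zero_eq_eval_zero, h3]
    have h4 : X ^ d ∣ S := by
      refine ih S V hV ?_
      filter_upwards [h, self_mem_nhdsWithin] with t ht ht0
      have ht0' : t ≠ 0 := ht0
      rw [eval_mul, eval_X, pow_succ', mul_assoc] at ht
      exact mul_left_cancel₀ ht0' ht
    rw [pow_succ']
    exact mul_dvd_mul_left _ h4

lemma poly_contra (d : ℕ) (hd : 1 ≤ d) (q : ℕ → ℝ) (c v : ℝ) (hv : v ≠ 0) (hq : q (d - 1) = 0)
    (V : ℝ → ℝ) (hV : ContinuousAt V 0)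
    (h : ∀ᶠ t in 𝓝 (0:ℝ), ∑ i ∈ Finset.range d, q i * (c + t) ^ i + (c + t) ^ d * v = t ^ d * V t) :
    ∀ i < d, q i = 0 := by
  let Q : ℝ[X] := ∑ i ∈ Finset.range d, C (q i) * X ^ i + C v * X ^ d
  have hco : ∀ i < d, Q.coeff i = q i := by
    intro i hi
    simp only [Q, coeff_add, finsetSum_coeff, coeff_C_mul_X_pow]
    rw [Finset.sum_eq_single i]
    · simp [hi.ne]
    · intro j _ hj; simp [hj.symm]
    · intro hi'; exact absurd (Finset.mem_range.2 hi) hi'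
  have hcd : Q.coeff d = v := by
    simp only [Q, coeff_add, finsetSum_coeff, coeff_C_mul_X_pow]
    rw [Finset.sum_eq_zero]
    · simp
    · intro j hj; simp [(Finset.mem_range.1 hj).ne']
  have hdeg : Q.natDegree ≤ d := by
    refine natDegree_add_le_of_degree_le (natDegree_sum_le_of_forall_le _ _ fun i hi => ?_)
      (natDegree_C_mul_X_pow_le _ _)
    exact (natDegree_C_mul_X_pow_le _ _).trans (Finset.mem_range.1 hi).le
  have hQ0 : Q ≠ 0 := by
    intro h0; rw [h0, coeff_zero] at hcd; exact hv hcd.symm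
  obtain ⟨S, hS⟩ := poly_dvd d (Q.comp (X + C c)) V hV (by
    filter_upwards [h.filter_mono nhdsWithin_le_nhds] with t ht
    rw [← ht, eval_comp]
    simp only [Q, eval_add, eval_finsetSum, eval_mul, eval_C, eval_pow, eval_X]
    rw [add_comm t c]; ring)
  have hQ : Q = (X - C c) ^ d * S.comp (X - C c) := by
    have := congrArg (fun P => P.comp (X - C c)) hS
    simp only [comp_assoc, mul_comp, pow_comp, X_comp, add_comp, C_comp, sub_add_cancel,
      comp_X] at this
    exact this
  set T := S.comp (X - C c) with hT
  have hT0 : T ≠ 0 := by rintro h0; rw [h0, mul_zero] at hQ; exact hQ0 hQ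
  have hTd : T.natDegree = 0 := by
    have h1 := congrArg natDegree hQ
    rw [natDegree_mul (pow_ne_zero _ (X_sub_C_ne_zero c)) hT0, natDegree_pow,
      natDegree_X_sub_C] at h1
    omega
  obtain ⟨s, hs⟩ : ∃ s, T = C s := ⟨_, eq_C_of_natDegree_eq_zero hTd⟩
  have hs0 : s ≠ 0 := by rintro rfl; exact hT0 (by simpa using hs)
  rw [hs] at hQ
  have hc : c = 0 := by
    have h1 := hco (d - 1) (by omega)
    rw [hq, hQ, coeff_mul_C, sub_eq_add_neg, ← C_neg, coeff_X_add_C_pow] at h1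
    have h2 : d - (d - 1) = 1 := by omega
    have h3 : d.choose (d - 1) = d := by
      rw [Nat.choose_symm_of_eq_add (show d = (d - 1) + 1 by omega)]; simp
    rw [h2, h3, pow_one] at h1
    have h4 : (d : ℝ) ≠ 0 := by positivity
    simpa [hs0, h4] using h1
  intro i hi
  rw [← hco i hi, hQ, hc]
  simp [coeff_X_pow, hi.ne]

end Poly

section Inner
variable {n : ℕ} {X : Type*}

/-- The function `F` becomes a normal crossing along the ultrafilter. -/
def Good (l : Ultrafilter X) (ξ : X → (Fin n → ℝ) × ℝ) (F : (Fin n → ℝ) × ℝ → ℝ) : Prop :=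
  ∃ (ξ' : X → (Fin n → ℝ) × ℝ) (φ : (Fin n → ℝ) × ℝ → (Fin n → ℝ) × ℝ),
    Chart (l : Filter X) ξ' ξ φ ∧ NCP (fun z => F (φ z))

lemma Good.pull {l : Ultrafilter X} {ξ ξ₁ : X → (Fin n → ℝ) × ℝ}
    {Φ : (Fin n → ℝ) × ℝ → (Fin n → ℝ) × ℝ} {F F₁ : (Fin n → ℝ) × ℝ → ℝ}
    (hc : Chart (l : Filter X) ξ₁ ξ Φ) (he : (fun z => F (Φ z)) =ᶠ[𝓝 0] F₁)
    (h : Good l ξ₁ F₁) : Good l ξ F := by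
  obtain ⟨ξ', φ, h1, h2⟩ := h
  exact ⟨ξ', _, h1.comp hc, h2.congr (h1.tendsto.eventually he)⟩

lemma Good.of_NCP {l : Ultrafilter X} {ξ : X → (Fin n → ℝ) × ℝ} {F : (Fin n → ℝ) × ℝ → ℝ}
    (hξ : Tendsto ξ l (𝓝 0)) (h : NCP F) : Good l ξ F :=
  ⟨ξ, id, ⟨hξ, analyticAt_id, rfl, Eventually.of_forall fun _ => rfl⟩, h⟩

lemma tendsto_fst_zero {Y : Type*} {l : Filter Y} {ξ : Y → (Fin n → ℝ) × ℝ}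
    (h : Tendsto ξ l (𝓝 0)) : Tendsto (fun p => (ξ p).1) l (𝓝 0) :=
  (continuous_fst.tendsto' (0 : (Fin n → ℝ) × ℝ) 0 rfl).comp h

lemma tendsto_snd_zero {Y : Type*} {l : Filter Y} {ξ : Y → (Fin n → ℝ) × ℝ}
    (h : Tendsto ξ l (𝓝 0)) : Tendsto (fun p => (ξ p).2) l (𝓝 0) :=
  (continuous_snd.tendsto' (0 : (Fin n → ℝ) × ℝ) 0 rfl).comp h

lemma NC.ncp {M : (Fin n → ℝ) → ℝ} (hM : NC M) {φ : (Fin n → ℝ) × ℝ → (Fin n → ℝ)}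
    (hφ : AnalyticAt ℝ φ 0) (hφ0 : φ 0 = 0) (h : ∀ i, NCP (fun z => φ z i)) :
    NCP (fun z => M (φ z)) := by
  obtain ⟨α, u, hu, hu0, he⟩ := hM
  refine ((NCP.unit (analytic_comp_zero hu hφ hφ0) (by simpa [hφ0] using hu0)).mul
    (NCP.mono (α := α) h)).congr ?_
  exact (tendsto_of_analytic_zero hφ hφ0).eventually he

lemma NC.ncp_fst {M : (Fin n → ℝ) → ℝ} (hM : NC M) :
    NCP (fun z : (Fin n → ℝ) × ℝ => M z.1) :=
  hM.ncp analyticAt_fst rfl fun i => NCP.fst i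

/-- The induction statement. -/
def Step (l : Ultrafilter X) (n d : ℕ) : Prop :=
  ∀ (ξ : X → (Fin n → ℝ) × ℝ) (M : (Fin n → ℝ) → ℝ) (g : (Fin n → ℝ) × ℝ → ℝ),
    Tendsto ξ l (𝓝 0) → NC M → AnalyticAt ℝ g 0 → (∀ k < d, (Dy^[k] g) 0 = 0) →
    (Dy^[d] g) 0 ≠ 0 → Good l ξ (fun z => M z.1 * g z)

lemma core2 (l : Ultrafilter X) (d : ℕ) (hd : 1 ≤ d) (ih : ∀ k < d, Step l n k)
    (ξ : X → (Fin n → ℝ) × ℝ) (M : (Fin n → ℝ) → ℝ) (g : (Fin n → ℝ) × ℝ → ℝ)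
    (hξ : Tendsto ξ l (𝓝 0)) (hM : NC M) (b : ℕ → (Fin n → ℝ) → ℝ) (β : Fin n → ℕ)
    (v : (Fin n → ℝ) × ℝ → ℝ) (hβ : β ≠ 0) (hb : ∀ i, AnalyticAt ℝ (b i) 0)
    (hv : AnalyticAt ℝ v 0) (hv0 : v 0 ≠ 0) (hb1 : b (d - 1) 0 = 0) (hex : ∃ i < d, b i 0 ≠ 0)
    (hg : ∀ᶠ z in 𝓝 0, g z = ∑ i ∈ Finset.range d, b i z.1 * mono β z.1 ^ (d - i) * z.2 ^ i
      + z.2 ^ d * v z) :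
    Good l ξ (fun z => M z.1 * g z) := by
  have h1 := tendsto_fst_zero hξ
  have h2 := tendsto_snd_zero hξ
  by_cases hcase : ∃ C, ∀ᶠ p in (l : Filter X), |(ξ p).2| ≤ C * |mono β (ξ p).1|
  · obtain ⟨C, hC⟩ := hcase
    obtain ⟨c, hc⟩ := ultra_lim l (fun p => (ξ p).2 / mono β (ξ p).1) |C| (by
      filter_upwards [hC] with p hp
      rw [abs_div]
      refine div_le_of_le_mul₀ (abs_nonneg _) (abs_nonneg _) (hp.trans ?_)
      exact mul_le_mul_of_nonneg_right (le_abs_self C) (abs_nonneg _))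
    let Φ : (Fin n → ℝ) × ℝ → (Fin n → ℝ) × ℝ := fun z => (z.1, mono β z.1 * (c + z.2))
    have hmono : AnalyticAt ℝ (fun z : (Fin n → ℝ) × ℝ => mono β z.1) 0 :=
      AnalyticAt.fun_comp (mono_analytic β _) analyticAt_fst
    have hcz : AnalyticAt ℝ (fun z : (Fin n → ℝ) × ℝ => c + z.2) 0 :=
      analyticAt_const.add analyticAt_snd
    have hΦ : AnalyticAt ℝ Φ 0 := analyticAt_fst.prod (hmono.mul hcz)
    have hΦ0 : ∀ t, Φ (0, t) = 0 := fun t => by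
      simp [Φ, mono_apply_zero hβ]
    have hch : Chart (l : Filter X) (fun p => ((ξ p).1, (ξ p).2 / mono β (ξ p).1 - c)) ξ Φ := by
      refine ⟨?_, hΦ, hΦ0 0, ?_⟩
      · have := h1.prodMk_nhds (hc.sub_const c)
        rwa [sub_self] at this
      · filter_upwards [hC] with p hp
        ext1
        · rfl
        · simp only [Φ, add_sub_cancel]
          by_cases hm : mono β (ξ p).1 = 0
          · rw [hm, abs_zero, mul_zero] at hp
            rw [hm, zero_mul, abs_nonpos_iff.1 hp]
          · field_simp
    have hbz : ∀ i, AnalyticAt ℝ (fun z : (Fin n → ℝ) × ℝ => b i z.1) 0 := fun i =>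
      AnalyticAt.fun_comp (hb i) analyticAt_fst
    have hvΦ : AnalyticAt ℝ (fun z => v (Φ z)) 0 := analytic_comp_zero hv hΦ (hΦ0 0)
    let g2 : (Fin n → ℝ) × ℝ → ℝ := fun z =>
      ∑ i ∈ Finset.range d, b i z.1 * (c + z.2) ^ i + (c + z.2) ^ d * v (Φ z)
    have hg2 : AnalyticAt ℝ g2 0 :=
      (Finset.analyticAt_fun_sum _ fun i _ => (hbz i).mul (hcz.pow i)).add ((hcz.pow d).mul hvΦ)
    have hk : ∃ k, k < d ∧ (Dy^[k] g2) 0 ≠ 0 := by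
      by_contra hcon
      push Not at hcon
      obtain ⟨A, V, hA, hV, hAV, hA1, -⟩ := taylor d g2 hg2
      have hA0 : ∀ i < d, A i 0 = 0 := by
        intro i hi
        have h3 := (hA1 i hi).self_of_nhds
        have h4 := hcon i hi
        have h5 : ((0 : Fin n → ℝ), (0 : ℝ)) = 0 := rfl
        rw [h5, h4] at h3
        have h6 : (i.factorial : ℝ) ≠ 0 := by positivity
        rcases mul_eq_zero.1 h3.symm with h | h
        · exact absurd h h6
        · exact h
      obtain ⟨i, hi, hi0⟩ := hex
      refine hi0 (poly_contra d hd (fun i => b i 0) c (v 0) hv0 hb1 (fun t => V (0, t)) ?_ ?_ i hi)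
      · have h5 : Tendsto (fun t : ℝ => ((0 : Fin n → ℝ), t)) (𝓝 0) (𝓝 0) :=
          (Continuous.prodMk_right (0 : Fin n → ℝ)).tendsto' 0 0 rfl
        exact hV.continuousAt.tendsto.comp h5
      · have h5 : Tendsto (fun t : ℝ => ((0 : Fin n → ℝ), t)) (𝓝 0) (𝓝 0) :=
          (Continuous.prodMk_right (0 : Fin n → ℝ)).tendsto' 0 0 rfl
        filter_upwards [h5.eventually hAV] with t ht
        simp only [g2, hΦ0] at ht
        rw [ht, Finset.sum_eq_zero, zero_add]
        intro j hj
        rw [hA0 j (Finset.mem_range.1 hj), zero_mul]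
    classical
    have hfind := Nat.find_spec hk
    have hfind' : ∀ k < Nat.find hk, (Dy^[k] g2) 0 = 0 := by
      intro k hk'
      by_contra hne
      exact Nat.find_min hk hk' ⟨hk'.trans hfind.1, hne⟩
    have hM1 : NC (fun x => M x * mono β x ^ d) := by
      obtain ⟨α, hα⟩ := hM
      have : IsMono (mono β : (Fin n → ℝ) → ℝ) β :=
        ⟨fun _ => 1, analyticAt_const, one_ne_zero, Eventually.of_forall fun x => by simp⟩
      exact ⟨_, hα.mul (this.pow d)⟩
    refine Good.pull hch ?_ (ih _ hfind.1 _ _ g2 hch.1 hM1 hg2 hfind' hfind.2)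
    filter_upwards [hch.tendsto.eventually hg] with z hz
    rw [hz]
    simp only [Φ, g2]
    rw [mul_assoc, mul_add (mono β z.1 ^ d), Finset.mul_sum]
    congr 2
    · refine Finset.sum_congr rfl fun i hi => ?_
      have hid : d = (d - i) + i := by have := Finset.mem_range.1 hi; omega
      conv_rhs => rw [hid, pow_add]
      rw [mul_pow]
      ring
    · rw [mul_pow]; ring
  · have hC : ∀ C, ∀ᶠ p in (l : Filter X), C * |mono β (ξ p).1| < |(ξ p).2| := by
      intro C
      have := fun h => hcase ⟨C, h⟩
      filter_upwards [Ultrafilter.eventually_not.2 this] with p hp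
      exact not_le.1 hp
    have hy : ∀ᶠ p in (l : Filter X), (ξ p).2 ≠ 0 := by
      filter_upwards [hC 0] with p hp h0
      rw [h0] at hp; simp at hp
    have hw : Tendsto (fun p => mono β (ξ p).1 / (ξ p).2) l (𝓝 0) := by
      rw [Metric.tendsto_nhds]
      intro ε hε
      filter_upwards [hC ε⁻¹, hy] with p hp hp0
      rw [Real.dist_eq, sub_zero, abs_div, div_lt_iff₀ (abs_pos.2 hp0)]
      rwa [inv_mul_lt_iff₀ hε] at hp
    obtain ⟨ξ', φ, W, hch, hN1, hN2, hW, hWe⟩ := toric l _ β ξ rfl hξ hy hw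
    have hW0 : W 0 = 0 := by
      have h3 : Tendsto (fun p => W (ξ' p)) l (𝓝 (W 0)) := hW.continuousAt.tendsto.comp hch.1
      refine tendsto_nhds_unique h3 (hw.congr' ?_)
      filter_upwards [hch.1.eventually hWe, hch.2.2.2, hy] with p h4 h5 h6
      rw [h5] at h4
      rw [h4]; field_simp
    refine ⟨ξ', φ, hch, ?_⟩
    have hφ1 : AnalyticAt ℝ (fun z => (φ z).1) 0 := AnalyticAt.fun_comp analyticAt_fst hch.2.1
    have hφ10 : (φ 0).1 = 0 := by rw [hch.2.2.1]; rfl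
    have hbφ : ∀ i, AnalyticAt ℝ (fun z => b i (φ z).1) 0 := fun i =>
      analytic_comp_zero (hb i) hφ1 hφ10
    have hvφ : AnalyticAt ℝ (fun z => v (φ z)) 0 := analytic_comp_zero hv hch.2.1 hch.2.2.1
    have hunit : NCP (fun z => ∑ i ∈ Finset.range d, b i (φ z).1 * W z ^ (d - i) + v (φ z)) := by
      refine NCP.unit ((Finset.analyticAt_fun_sum _ fun i _ =>
        (hbφ i).mul (hW.pow (d - i))).add hvφ) ?_
      simp only [hW0, hch.2.2.1]
      rw [Finset.sum_eq_zero, zero_add]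
      · exact hv0
      · intro i hi
        have : d - i ≠ 0 := by have := Finset.mem_range.1 hi; omega
        rw [zero_pow this, mul_zero]
    refine ((hM.ncp hφ1 hφ10 hN1).mul ((hN2.pow d).mul hunit)).congr ?_
    filter_upwards [hch.tendsto.eventually hg, hWe] with z hz hz2
    rw [hz]
    congr 1
    rw [mul_add, Finset.mul_sum]
    congr 1
    refine Finset.sum_congr rfl fun i hi => ?_
    rw [hz2]
    have hid : d = (d - i) + i := by have := Finset.mem_range.1 hi; omega
    conv_rhs => rw [hid, pow_add]
    rw [show d - i + i - i = d - i by omega, mul_pow]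
    ring

lemma core (l : Ultrafilter X) (hU : LU l n) (d : ℕ) (hd : 1 ≤ d) (ih : ∀ k < d, Step l n k)
    (ξ : X → (Fin n → ℝ) × ℝ) (M : (Fin n → ℝ) → ℝ) (g : (Fin n → ℝ) × ℝ → ℝ)
    (hξ : Tendsto ξ l (𝓝 0)) (hM : NC M) (a : ℕ → (Fin n → ℝ) → ℝ)
    (v : (Fin n → ℝ) × ℝ → ℝ) (ha : ∀ i, AnalyticAt ℝ (a i) 0)
    (hv : AnalyticAt ℝ v 0) (hv0 : v 0 ≠ 0) (ha0 : ∀ i < d, a i 0 = 0)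
    (ha1 : a (d - 1) =ᶠ[𝓝 0] 0)
    (hg : ∀ᶠ z in 𝓝 0, g z = ∑ i ∈ Finset.range d, a i z.1 * z.2 ^ i + z.2 ^ d * v z) :
    Good l ξ (fun z => M z.1 * g z) := by
  have hfst : Tendsto (fun z : (Fin n → ℝ) × ℝ => z.1) (𝓝 0) (𝓝 0) :=
    tendsto_fst_zero tendsto_id
  by_cases hex : ∃ i < d, ¬ a i =ᶠ[𝓝 0] 0
  · obtain ⟨ξ', φ, β, b, hch, hNC, hβ, hb, hab, hb0, hbz⟩ :=
      prep l hU d (fun p => (ξ p).1) (tendsto_fst_zero hξ) M hM a ha ha0 hex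
    let Φ : (Fin n → ℝ) × ℝ → (Fin n → ℝ) × ℝ := fun z => (φ z.1, z.2)
    have hΦ : AnalyticAt ℝ Φ 0 :=
      (AnalyticAt.fun_comp (f := fun z : (Fin n → ℝ) × ℝ => z.1) hch.2.1 analyticAt_fst).prod
        analyticAt_snd
    have hΦ0 : Φ 0 = 0 := by simp [Φ, hch.2.2.1]
    have hC : Chart (l : Filter X) (fun p => (ξ' p, (ξ p).2)) ξ Φ := by
      refine ⟨hch.1.prodMk_nhds (tendsto_snd_zero hξ), hΦ, hΦ0, ?_⟩
      filter_upwards [hch.2.2.2] with p hp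
      ext1
      · exact hp
      · rfl
    refine Good.pull (F₁ := fun z => M (φ z.1) * g (Φ z)) hC
      (Eventually.of_forall fun z => rfl) ?_
    refine core2 l d hd ih _ (fun x => M (φ x)) (fun z => g (Φ z)) hC.1 hNC b β
      (fun z => v (Φ z)) hβ hb (analytic_comp_zero hv hΦ hΦ0) (by simpa [hΦ0] using hv0)
      (by rw [hbz _ ha1]; rfl) hb0 ?_
    have hall : ∀ᶠ z : (Fin n → ℝ) × ℝ in 𝓝 0, ∀ i ∈ Finset.range d,
        a i (φ z.1) = b i z.1 * mono β z.1 ^ (d - i) := by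
      rw [Filter.eventually_all_finset]
      intro i hi
      exact hfst.eventually (hab i (Finset.mem_range.1 hi))
    filter_upwards [hC.tendsto.eventually hg, hall] with z hz hz2
    rw [hz]
    congr 1
    refine Finset.sum_congr rfl fun i hi => ?_
    rw [← hz2 i hi]
  · push Not at hex
    refine Good.of_NCP hξ ?_
    refine (hM.ncp_fst.mul ((NCP.snd.pow d).mul (NCP.unit hv hv0))).congr ?_
    have hall : ∀ᶠ z : (Fin n → ℝ) × ℝ in 𝓝 0, ∀ i ∈ Finset.range d, a i z.1 = 0 := by
      rw [Filter.eventually_all_finset]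
      intro i hi
      exact hfst.eventually (hex i (Finset.mem_range.1 hi))
    filter_upwards [hg, hall] with z hz hz2
    rw [hz, Finset.sum_eq_zero, zero_add]
    intro i hi
    rw [hz2 i hi, zero_mul]

lemma inner_step (l : Ultrafilter X) (hU : LU l n) (d : ℕ) : Step l n d := by
  induction d using Nat.strong_induction_on with
  | _ d ih =>
  intro ξ M g hξ hM hg hlow hD
  rcases Nat.eq_zero_or_pos d with rfl | hd
  · exact Good.of_NCP hξ (hM.ncp_fst.mul (NCP.unit hg hD))
  obtain ⟨ψ, hψ, hψ0, hψe⟩ := exists_implicit (Dy_iter_analytic hg (d - 1))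
    (hlow (d - 1) (by omega)) (by
      rw [← Function.iterate_succ_apply' Dy, Nat.succ_eq_add_one, Nat.sub_add_cancel hd]
      exact hD)
  let Φ : (Fin n → ℝ) × ℝ → (Fin n → ℝ) × ℝ := fun z => (z.1, z.2 + ψ z.1)
  have hΦ : AnalyticAt ℝ Φ 0 :=
    analyticAt_fst.prod (analyticAt_snd.add
      (AnalyticAt.fun_comp (f := fun z : (Fin n → ℝ) × ℝ => z.1) hψ analyticAt_fst))
  have hΦ0 : Φ 0 = 0 := by simp [Φ, hψ0]
  have hC : Chart (l : Filter X) (fun p => ((ξ p).1, (ξ p).2 - ψ (ξ p).1)) ξ Φ := by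
    refine ⟨?_, hΦ, hΦ0, Eventually.of_forall fun p => by simp [Φ]⟩
    have h1 := tendsto_fst_zero hξ
    have := h1.prodMk_nhds
      ((tendsto_snd_zero hξ).sub ((tendsto_of_analytic_zero hψ hψ0).comp h1))
    rwa [sub_self] at this
  have hg1 : AnalyticAt ℝ (fun z => g (Φ z)) 0 := analytic_comp_zero hg hΦ hΦ0
  have htr := fun k => Dy_iter_translate hg hψ hψ0 k
  have htr0 : ∀ k, (Dy^[k] (fun z => g (Φ z))) 0 = (Dy^[k] g) 0 := by
    intro k
    have := (htr k).self_of_nhds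
    simp only [Prod.fst_zero, Prod.snd_zero, hψ0, add_zero] at this
    exact this
  obtain ⟨a, v, ha, hv, hav, ha1, hv1⟩ := taylor d (fun z => g (Φ z)) hg1
  have hax : Tendsto (fun x : Fin n → ℝ => (x, (0:ℝ))) (𝓝 0) (𝓝 0) :=
    (Continuous.prodMk_left (0:ℝ)).tendsto' 0 0 rfl
  refine Good.pull (F₁ := fun z => M z.1 * g (Φ z)) hC (Eventually.of_forall fun z => rfl) ?_
  refine core l hU d hd ih _ M _ hC.1 hM a v ha hv ?_ ?_ ?_ hav
  · intro h0
    have h3 := hv1.self_of_nhds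
    have h5 : ((0 : Fin n → ℝ), (0 : ℝ)) = 0 := rfl
    rw [h5, htr0, h0, mul_zero] at h3
    exact hD h3
  · intro i hi
    have h3 := (ha1 i hi).self_of_nhds
    have h5 : ((0 : Fin n → ℝ), (0 : ℝ)) = 0 := rfl
    rw [h5, htr0, hlow i hi] at h3
    rcases mul_eq_zero.1 h3.symm with h | h
    · exact absurd h (by positivity)
    · exact h
  · filter_upwards [ha1 (d - 1) (by omega), hψe, hax.eventually (htr (d - 1))] with x h3 h4 h5
    rw [h3] at h5
    simp only [zero_add] at h5
    rw [h4] at h5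
    rcases mul_eq_zero.1 h5 with h | h
    · exact absurd h (by positivity)
    · exact h

end Inner
end Loj

namespace Loj
open Filter Topology

section Uniformization
variable {n : ℕ} {X : Type*}

lemma exists_order {F : (Fin n → ℝ) × ℝ → ℝ} (hF : AnalyticAt ℝ F 0)
    (h : ¬ (fun t : ℝ => F (0, t)) =ᶠ[𝓝 0] 0) : ∃ k, (Dy^[k] F) 0 ≠ 0 := by
  by_contra hcon
  push Not at hcon
  have hax : Tendsto (fun t : ℝ => ((0 : Fin n → ℝ), t)) (𝓝 0) (𝓝 0) :=
    (Continuous.prodMk_right (0 : Fin n → ℝ)).tendsto' 0 0 rfl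
  have h1 : AnalyticAt ℝ (fun t : ℝ => F (0, t)) 0 :=
    AnalyticAt.fun_comp (f := fun t : ℝ => ((0 : Fin n → ℝ), t)) (g := F) hF
      (analyticAt_const.prod analyticAt_id)
  obtain ⟨m, g, hg, hg0, he⟩ := h1.exists_eventuallyEq_pow_smul_nonzero_iff.2 h
  obtain ⟨A, V, hA, hV, hAV, hA1, -⟩ := taylor (m + 1) F hF
  have hA0 : ∀ i < m + 1, A i 0 = 0 := by
    intro i hi
    have h3 := (hA1 i hi).self_of_nhds
    have h5 : ((0 : Fin n → ℝ), (0 : ℝ)) = 0 := rfl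
    rw [h5, hcon i] at h3
    rcases mul_eq_zero.1 h3.symm with h | h
    · exact absurd h (by positivity)
    · exact h
  have h6 : ∀ᶠ t in 𝓝[≠] (0:ℝ), g t = t * V (0, t) := by
    filter_upwards [he.filter_mono nhdsWithin_le_nhds,
      (hax.eventually hAV).filter_mono nhdsWithin_le_nhds, self_mem_nhdsWithin] with t h3 h4 h5
    have h5' : t ≠ 0 := h5
    rw [h3, Finset.sum_eq_zero, zero_add, sub_zero, smul_eq_mul, pow_succ, mul_assoc] at h4
    · exact mul_left_cancel₀ (pow_ne_zero m h5') h4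
    · intro i hi
      rw [hA0 i (Finset.mem_range.1 hi), zero_mul]
  have h7 : Tendsto g (𝓝[≠] 0) (𝓝 (g 0)) := hg.continuousAt.tendsto.mono_left nhdsWithin_le_nhds
  have h8 : Tendsto (fun t : ℝ => t * V (0, t)) (𝓝[≠] 0) (𝓝 (0 * V 0)) :=
    ((tendsto_id (α := ℝ) (x := 𝓝 0)).mul (hV.continuousAt.tendsto.comp hax)).mono_left
      nhdsWithin_le_nhds
  have h9 := tendsto_nhds_unique (h7.congr' h6) h8
  rw [zero_mul] at h9
  exact hg0 h9

lemma lu_zero (l : Ultrafilter X) : LU l 0 := by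
  intro ξ f hξ hf h0
  have hf0 : f 0 ≠ 0 := by
    intro h
    apply h0
    refine Eventually.of_forall fun x => ?_
    rw [Subsingleton.elim x 0, h]; rfl
  exact ⟨ξ, id, ⟨hξ, analyticAt_id, rfl, Eventually.of_forall fun _ => rfl⟩, 0, f, hf, hf0,
    Eventually.of_forall fun x => by simp [mono]⟩

lemma lu_succ (l : Ultrafilter X) (hU : LU l n) : LU l (n + 1) := by
  classical
  intro ξ f hξ hf hne
  by_cases hf0 : f 0 ≠ 0
  · exact ⟨ξ, id, ⟨hξ, analyticAt_id, rfl, Eventually.of_forall fun _ => rfl⟩, 0, f, hf, hf0,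
      Eventually.of_forall fun x => by simp [mono_zero]⟩
  push Not at hf0
  obtain ⟨v, hv⟩ := exists_direction hf hne
  have hv0 : v ≠ 0 := by
    rintro rfl
    apply hv
    refine Eventually.of_forall fun t => ?_
    simp [hf0]
  obtain ⟨i, hi⟩ : ∃ i, v i ≠ 0 := Function.ne_iff.1 hv0
  let A : (Fin n → ℝ) × ℝ → Fin (n + 1) → ℝ := fun z =>
    i.insertNth (z.2 * v i) (fun k => z.1 k + z.2 * v (i.succAbove k))
  have hA : AnalyticAt ℝ A 0 := by
    refine AnalyticAt.pi fun j => ?_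
    rcases Fin.eq_self_or_eq_succAbove i j with rfl | ⟨k, rfl⟩
    · simp only [A, Fin.insertNth_apply_same]
      exact analyticAt_snd.mul analyticAt_const
    · simp only [A, Fin.insertNth_apply_succAbove]
      exact (analyticAt_pfst k 0).add (analyticAt_snd.mul analyticAt_const)
  have hA0 : A 0 = 0 := by
    funext j
    rcases Fin.eq_self_or_eq_succAbove i j with rfl | ⟨k, rfl⟩ <;> simp [A]
  have hAt : ∀ t : ℝ, A (0, t) = t • v := by
    intro t
    funext j
    rcases Fin.eq_self_or_eq_succAbove i j with rfl | ⟨k, rfl⟩ <;> simp [A]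
  have hξ' := fun j => tendsto_pi_nhds.1 hξ j
  have hC : Chart (l : Filter X)
      (fun p => ((fun k => ξ p (i.succAbove k) - ξ p i / v i * v (i.succAbove k) : Fin n → ℝ),
        ξ p i / v i)) ξ A := by
    refine ⟨?_, hA, hA0, Eventually.of_forall fun p => ?_⟩
    · have h1 : Tendsto (fun p => ξ p i / v i) l (𝓝 0) := by
        simpa using (hξ' i).div_const (v i)
      refine Tendsto.prodMk_nhds (x := (0 : Fin n → ℝ)) (y := (0:ℝ)) ?_ h1
      rw [tendsto_pi_nhds]
      intro k
      simpa using (hξ' (i.succAbove k)).sub (h1.mul_const (v (i.succAbove k)))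
    · funext j
      rcases Fin.eq_self_or_eq_succAbove i j with rfl | ⟨k, rfl⟩
      · simp [A, hi]
      · simp [A]
  have hF : AnalyticAt ℝ (fun z => f (A z)) 0 := analytic_comp_zero hf hA hA0
  have hk := exists_order hF (by simpa only [hAt] using hv)
  have hgood := inner_step l hU (Nat.find hk) _ (fun _ => 1) _ hC.1
    ⟨0, fun _ => 1, analyticAt_const, one_ne_zero,
      Eventually.of_forall fun x => by simp [mono_zero]⟩ hF
    (fun k h => not_not.1 (Nat.find_min hk h)) (Nat.find_spec hk)
  obtain ⟨ξ', φ, hch, α, k, u, hu, hu0, he⟩ := hgood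
  let B : (Fin (n + 1) → ℝ) → (Fin n → ℝ) × ℝ := fun w => (fun j => w j.castSucc, w (Fin.last n))
  have hB : AnalyticAt ℝ B 0 :=
    AnalyticAt.prod (f := fun w : Fin (n + 1) → ℝ => fun j : Fin n => w j.castSucc)
      (AnalyticAt.pi fun j => analyticAt_coord j.castSucc 0) (analyticAt_coord (Fin.last n) 0)
  have hB0 : B 0 = 0 := rfl
  have hCB : Chart (l : Filter X)
      (fun p => (Fin.snoc (α := fun _ => ℝ) (ξ' p).1 (ξ' p).2 : Fin (n + 1) → ℝ)) ξ' B := by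
    refine ⟨?_, hB, hB0, Eventually.of_forall fun p => ?_⟩
    · rw [tendsto_pi_nhds]
      intro j
      refine Fin.lastCases ?_ (fun j => ?_) j
      · simpa using tendsto_snd_zero hch.1
      · simpa using tendsto_pi_nhds.1 (tendsto_fst_zero hch.1) j
    · ext j <;> simp [B]
  refine ⟨_, _, (hCB.comp hch).comp hC, Fin.snoc (α := fun _ => ℕ) α k, fun w => u (B w),
    analytic_comp_zero hu hB hB0, by simpa [hB0] using hu0, ?_⟩
  filter_upwards [hCB.tendsto.eventually he] with w hw
  simp only [one_mul] at hw
  rw [hw]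
  simp [mono, Fin.prod_univ_castSucc, B]

lemma lu_all (l : Ultrafilter X) (n : ℕ) : LU l n := by
  induction n with
  | zero => exact lu_zero l
  | succ n ih => exact lu_succ l ih

end Uniformization

section Final
variable {n : ℕ}

lemma mono_curve (α : Fin n → ℕ) (i : Fin n) (z : Fin n → ℝ) (s : ℝ) :
    mono α (z + s • Pi.single i (z i)) = (1 + s) ^ α i * mono α z := by
  classical
  have h : ∀ j, (z + s • (Pi.single i (z i) : Fin n → ℝ)) j ^ α j =
      (if j = i then (1 + s) ^ α i else 1) * z j ^ α j := by
    intro j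
    rcases eq_or_ne j i with rfl | hj
    · simp only [Pi.add_apply, Pi.smul_apply, Pi.single_eq_same, smul_eq_mul, if_true]
      rw [← mul_pow]; ring
    · simp [hj]
  unfold mono
  rw [Finset.prod_congr rfl fun j _ => h j, Finset.prod_mul_distrib]
  simp

lemma euler {u : (Fin n → ℝ) → ℝ} (α : Fin n → ℕ) (i : Fin n) (z : Fin n → ℝ)
    (hu : DifferentiableAt ℝ u z) :
    fderiv ℝ (fun x => u x * mono α x) z (Pi.single i (z i)) =
      fderiv ℝ u z (Pi.single i (z i)) * mono α z + u z * (α i * mono α z) := by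
  have hcurve : HasDerivAt (fun s : ℝ => z + s • (Pi.single i (z i) : Fin n → ℝ))
      (Pi.single i (z i)) 0 := by
    simpa using ((hasDerivAt_id (0:ℝ)).smul_const (Pi.single i (z i) : Fin n → ℝ)).const_add z
  have h0 : z + (0:ℝ) • (Pi.single i (z i) : Fin n → ℝ) = z := by simp
  have hG : DifferentiableAt ℝ (fun x => u x * mono α x) z :=
    hu.mul (mono_analytic α z).differentiableAt
  have h1 : HasDerivAt (fun s : ℝ => u (z + s • (Pi.single i (z i) : Fin n → ℝ)) *
      mono α (z + s • (Pi.single i (z i) : Fin n → ℝ)))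
      (fderiv ℝ (fun x => u x * mono α x) z (Pi.single i (z i))) 0 := by
    have := hG.hasFDerivAt
    rw [← h0] at this
    have h2 := HasFDerivAt.comp_hasDerivAt (0:ℝ) this hcurve
    rw [h0] at h2
    exact h2
  have h2 : HasDerivAt (fun s : ℝ => u (z + s • (Pi.single i (z i) : Fin n → ℝ)))
      (fderiv ℝ u z (Pi.single i (z i))) 0 := by
    have := hu.hasFDerivAt
    rw [← h0] at this
    have h2 := HasFDerivAt.comp_hasDerivAt (0:ℝ) this hcurve
    rw [h0] at h2
    exact h2
  have h3 : HasDerivAt (fun s : ℝ => mono α (z + s • (Pi.single i (z i) : Fin n → ℝ)))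
      (α i * mono α z) 0 := by
    simp only [mono_curve]
    have := (((hasDerivAt_id (0:ℝ)).const_add 1).pow (α i)).mul_const (mono α z)
    simpa using this
  have h4 := h1.unique (h2.mul h3)
  rw [h4]
  simp

lemma grad_nc {G : (Fin n → ℝ) → ℝ} {α : Fin n → ℕ} (hG : IsMono G α) (hα : α ≠ 0) :
    ∃ (θ C : ℝ), θ < 1 ∧ 0 < C ∧ ∀ᶠ z in 𝓝 0, G z ≠ 0 → |G z| ^ θ ≤ C * ‖fderiv ℝ G z‖ := by
  classical
  obtain ⟨u, hu, hu0, he⟩ := hG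
  set N := ∑ j, α j with hN
  have hN0 : N ≠ 0 := by
    intro h
    apply hα
    funext j
    simp only [hN, Finset.sum_eq_zero_iff, Finset.mem_univ, true_imp_iff] at h
    exact h j
  have hu0' : 0 < |u 0| := abs_pos.2 hu0
  set K := ‖fderiv ℝ u 0‖ + 1 with hK
  have hKpos : 0 < K := by positivity
  refine ⟨1 - (N : ℝ)⁻¹, 2 * (2 / |u 0|) ^ ((N : ℝ)⁻¹), by
    have : 0 < (N : ℝ)⁻¹ := by positivity
    linarith, by positivity, ?_⟩
  have e1 : ∀ᶠ z in 𝓝 0, |u 0| / 2 < |u z| :=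
    hu.continuousAt.abs.eventually_const_lt (by linarith)
  have e2 : ∀ᶠ z in 𝓝 0, ‖fderiv ℝ u z‖ < K :=
    hu.fderiv.continuousAt.norm.eventually_lt_const (by linarith)
  have e3 : ∀ᶠ z : Fin n → ℝ in 𝓝 0, ‖z‖ < |u 0| / (4 * K) :=
    (continuous_norm.tendsto' (0 : Fin n → ℝ) 0 norm_zero).eventually_lt_const (by positivity)
  filter_upwards [e1, e2, e3, eventually_eventually_nhds.2 he, hu.eventually_analyticAt] with
    z h1 h2 h3 h4 h5 hGz
  have hGe : G z = u z * mono α z := h4.self_of_nhds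
  have hfd : fderiv ℝ G z = fderiv ℝ (fun x => u x * mono α x) z := Filter.EventuallyEq.fderiv_eq h4
  have hne : (Finset.univ.filter fun j => α j ≠ 0).Nonempty := by
    obtain ⟨j, hj⟩ := Function.ne_iff.1 hα
    exact ⟨j, by simpa using hj⟩
  obtain ⟨i, hi, hmin⟩ := Finset.exists_min_image _ (fun j => |z j|) hne
  have hαi : α i ≠ 0 := (Finset.mem_filter.1 hi).2
  have hm : |z i| ^ N ≤ |mono α z| := by
    rw [hN, ← Finset.prod_pow_eq_pow_sum, mono, Finset.abs_prod]
    refine Finset.prod_le_prod (fun j _ => by positivity) fun j _ => ?_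
    rw [abs_pow]
    by_cases hj : α j = 0
    · simp [hj]
    · exact pow_le_pow_left₀ (abs_nonneg _) (hmin j (by simpa using hj)) _
  have hzi : |z i| ≤ ‖z‖ := norm_le_pi_norm z i
  have hsing : ‖(Pi.single i (z i) : Fin n → ℝ)‖ = |z i| := by
    rw [Pi.norm_single, Real.norm_eq_abs]
  have heul := euler α i z h5.differentiableAt
  rw [← hfd] at heul
  have hL : |fderiv ℝ G z (Pi.single i (z i))| ≤ ‖fderiv ℝ G z‖ * |z i| := by
    have := (fderiv ℝ G z).le_opNorm (Pi.single i (z i))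
    rwa [hsing, Real.norm_eq_abs] at this
  have hLu : |fderiv ℝ u z (Pi.single i (z i))| ≤ |u z| / 2 := by
    have h6 := (fderiv ℝ u z).le_opNorm (Pi.single i (z i))
    rw [hsing, Real.norm_eq_abs] at h6
    have h7 : ‖fderiv ℝ u z‖ * |z i| ≤ K * (|u 0| / (4 * K)) :=
      mul_le_mul h2.le (hzi.trans h3.le) (abs_nonneg _) hKpos.le
    have h8 : K * (|u 0| / (4 * K)) = |u 0| / 4 := by field_simp
    linarith
  have hGm : |G z| = |u z| * |mono α z| := by rw [hGe, abs_mul]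
  have key : |G z| / 2 ≤ ‖fderiv ℝ G z‖ * |z i| := by
    refine le_trans ?_ hL
    rw [heul]
    have h6 : |u z * (α i * mono α z)| = α i * |G z| := by
      rw [hGm, abs_mul, abs_mul, Nat.abs_cast]; ring
    have h7 : |fderiv ℝ u z (Pi.single i (z i)) * mono α z| ≤ |G z| / 2 := by
      rw [abs_mul, hGm]
      have := mul_le_mul_of_nonneg_right hLu (abs_nonneg (mono α z))
      linarith
    have h8 : (1:ℝ) ≤ α i := by exact_mod_cast Nat.one_le_iff_ne_zero.2 hαi
    have h9 := abs_sub_abs_le_abs_add (u z * (α i * mono α z))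
      (fderiv ℝ u z (Pi.single i (z i)) * mono α z)
    rw [add_comm] at h9
    have h10 := mul_le_mul_of_nonneg_right h8 (abs_nonneg (G z))
    linarith
  have hGpos : 0 < |G z| := abs_pos.2 hGz
  have hz2 : |z i| ≤ (2 / |u 0|) ^ ((N : ℝ)⁻¹) * |G z| ^ ((N : ℝ)⁻¹) := by
    rw [← Real.mul_rpow (by positivity) (by positivity),
      ← Real.pow_rpow_inv_natCast (abs_nonneg (z i)) hN0]
    refine Real.rpow_le_rpow (by positivity) ?_ (by positivity)
    refine hm.trans ?_
    rw [hGm, div_mul_eq_mul_div, le_div_iff₀ hu0']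
    have := mul_le_mul_of_nonneg_right h1.le (abs_nonneg (mono α z))
    linarith
  have hpow : 0 < |G z| ^ ((N : ℝ)⁻¹) := Real.rpow_pos_of_pos hGpos _
  rw [Real.rpow_sub hGpos, Real.rpow_one, div_le_iff₀ hpow]
  have := mul_le_mul_of_nonneg_left hz2 (norm_nonneg (fderiv ℝ G z))
  linarith

lemma main {E : Type*} [NormedAddCommGroup E] [NormedSpace ℝ E] [CompleteSpace E] (T : (Fin n → ℝ) ≃L[ℝ] E)
    (f : E → ℝ) (hf : AnalyticAt ℝ f 0) (y : ℕ → E) (hy : Tendsto y atTop (𝓝 0))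
    (θ : ℕ → ℝ) (hθ : Tendsto θ atTop (𝓝 1)) (hθ0 : ∀ k, θ k ≠ 0)
    (h : ∀ k, ‖fderiv ℝ f (y k)‖ < |f (y k) - f 0| ^ θ k) : False := by
  have hne : ∀ k, f (y k) - f 0 ≠ 0 := by
    intro k h0
    have := h k
    rw [h0, abs_zero, Real.zero_rpow (hθ0 k)] at this
    exact absurd this (not_lt.2 (norm_nonneg _))
  let l : Ultrafilter ℕ := Filter.hyperfilter ℕ
  have hl : (l : Filter ℕ) ≤ atTop := by
    rw [← Nat.cofinite_eq_atTop]; exact Filter.hyperfilter_le_cofinite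
  let F : (Fin n → ℝ) → ℝ := fun x => f (T x) - f 0
  have hT : AnalyticAt ℝ (fun x => T x) 0 := T.analyticAt 0
  have hF : AnalyticAt ℝ F 0 := (analytic_comp_zero hf hT (by simp)).sub analyticAt_const
  have hξ : Tendsto (fun k => T.symm (y k)) atTop (𝓝 0) := by
    have := (T.symm.continuous.tendsto 0).comp hy
    rwa [map_zero] at this
  have hF0 : ¬ F =ᶠ[𝓝 0] 0 := by
    intro h0
    obtain ⟨k, hk⟩ := (hξ.eventually h0).exists
    apply hne k
    simpa [F] using hk
  obtain ⟨ξ', φ, hch, α, hα⟩ := lu_all l n _ F (hξ.mono_left hl) hF hF0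
  have hα0 : α ≠ 0 := by
    rintro rfl
    obtain ⟨u, hu, hu0, he⟩ := hα
    have := he.self_of_nhds
    simp only [mono_zero, mul_one, hch.2.2.1] at this
    apply hu0
    rw [← this]; simp [F]
  obtain ⟨θ₀, C, hθ₀, hC, hev⟩ := grad_nc hα hα0
  let Φ : (Fin n → ℝ) → E := fun z => T (φ z)
  have hΦ : AnalyticAt ℝ Φ 0 := analytic_comp_zero hT hch.2.1 hch.2.2.1
  have hΦ0 : Φ 0 = 0 := by simp [Φ, hch.2.2.1]
  set K := ‖fderiv ℝ Φ 0‖ + 1 with hK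
  have hKpos : 0 < K := by positivity
  have hK1 : ∀ᶠ z in 𝓝 0, ‖fderiv ℝ Φ z‖ < K :=
    (ContinuousAt.norm hΦ.fderiv.continuousAt).eventually_lt_const (by linarith)
  have hev2 : ∀ᶠ z in 𝓝 0, F (φ z) ≠ 0 → |F (φ z)| ^ θ₀ ≤ C * (K * ‖fderiv ℝ f (Φ z)‖) := by
    filter_upwards [hev, hK1, hΦ.eventually_analyticAt,
      (tendsto_of_analytic_zero hΦ hΦ0).eventually hf.eventually_analyticAt] with z h1 h2 h3 h4 h5
    refine (h1 h5).trans (mul_le_mul_of_nonneg_left ?_ hC.le)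
    have h6 : fderiv ℝ (fun x => F (φ x)) z = (fderiv ℝ f (Φ z)).comp (fderiv ℝ Φ z) := by
      have := (h4.differentiableAt.hasFDerivAt.comp z h3.differentiableAt.hasFDerivAt).sub_const
        (f 0)
      exact this.fderiv
    rw [h6, mul_comm K]
    exact (ContinuousLinearMap.opNorm_comp_le _ _).trans
      (mul_le_mul_of_nonneg_left h2.le (norm_nonneg _))
  have hyl := hy.mono_left hl
  have hfy : Tendsto (fun k => |f (y k) - f 0|) l (𝓝 0) := by
    have := ((hf.continuousAt.tendsto.comp hyl).sub_const (f 0)).abs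
    simpa using this
  have hδ : 0 < (1 - θ₀) / 2 := by linarith
  have hlim : Tendsto (fun k => C * K * |f (y k) - f 0| ^ ((1 - θ₀) / 2)) l (𝓝 0) := by
    have := (hfy.rpow_const (p := (1 - θ₀) / 2) (Or.inr hδ.le)).const_mul (C * K)
    rwa [Real.zero_rpow hδ.ne', mul_zero] at this
  have hθl : ∀ᶠ k in (l : Filter ℕ), (1 + θ₀) / 2 < θ k :=
    (hθ.mono_left hl).eventually_const_lt (by linarith)
  obtain ⟨k, hk1, hk2, hk3, hk4, hk5⟩ := ((hch.1.eventually hev2).and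
    (hch.2.2.2.and (hθl.and ((hfy.eventually_lt_const one_pos).and
      (hlim.eventually_lt_const one_pos))))).exists
  rw [hk2] at hk1
  have hΦk : Φ (ξ' k) = y k := by simp [Φ, hk2]
  simp only [F, hΦk, ContinuousLinearEquiv.apply_symm_apply] at hk1
  have ha := hk1 (hne k)
  have hpos : 0 < |f (y k) - f 0| := abs_pos.2 (hne k)
  have hb : |f (y k) - f 0| ^ θ k ≤ |f (y k) - f 0| ^ (θ₀ + (1 - θ₀) / 2) :=
    Real.rpow_le_rpow_of_exponent_ge hpos hk4.le (by linarith)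
  rw [Real.rpow_add hpos] at hb
  have hc : C * (K * ‖fderiv ℝ f (y k)‖) ≤
      C * (K * (|f (y k) - f 0| ^ θ₀ * |f (y k) - f 0| ^ ((1 - θ₀) / 2))) := by
    have := ((h k).le.trans hb)
    gcongr
  have hd : 0 < |f (y k) - f 0| ^ θ₀ := Real.rpow_pos_of_pos hpos _
  have he := ha.trans hc
  have hf' : C * (K * (|f (y k) - f 0| ^ θ₀ * |f (y k) - f 0| ^ ((1 - θ₀) / 2))) =
      (C * K * |f (y k) - f 0| ^ ((1 - θ₀) / 2)) * |f (y k) - f 0| ^ θ₀ := by ring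
  rw [hf'] at he
  have hg := mul_lt_mul_of_pos_right hk5 hd
  linarith

end Final
end Loj

theorem lojasiewicz_gradient_inequality
    (n : ℕ) (hn : 1 ≤ n)
    (f : EuclideanSpace ℝ (Fin n) → ℝ)
    (V : Set (EuclideanSpace ℝ (Fin n)))
    (hVopen : IsOpen V) (hV0 : (0 : EuclideanSpace ℝ (Fin n)) ∈ V)
    (hf : AnalyticOn ℝ f V) :
    ∃ θ : ℝ, θ ∈ Set.Ioo (0 : ℝ) 1 ∧
      ∃ U : Set (EuclideanSpace ℝ (Fin n)),
        IsOpen U ∧ (0 : EuclideanSpace ℝ (Fin n)) ∈ U ∧ U ⊆ V ∧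
        ∀ y ∈ U, |f y - f 0| ^ θ ≤ ‖gradient f y‖ := by
  by_contra hcon
  push Not at hcon
  have hfa : AnalyticAt ℝ f 0 := (hVopen.analyticOn_iff_analyticOnNhd.1 hf) 0 hV0
  have hθ : ∀ k : ℕ, 1 - 1 / ((k : ℝ) + 2) ∈ Set.Ioo (0:ℝ) 1 := by
    intro k
    have h1 : (0:ℝ) < k + 2 := by positivity
    constructor
    · rw [sub_pos, div_lt_one h1]
      have : (0:ℝ) ≤ k := Nat.cast_nonneg k
      linarith
    · have : 0 < 1 / ((k : ℝ) + 2) := by positivity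
      linarith
  have hpt : ∀ k : ℕ, ∃ y ∈ V ∩ Metric.ball (0 : EuclideanSpace ℝ (Fin n)) (1 / ((k : ℝ) + 1)),
      ‖gradient f y‖ < |f y - f 0| ^ (1 - 1 / ((k : ℝ) + 2)) := fun k =>
    hcon _ (hθ k) _ (hVopen.inter Metric.isOpen_ball)
      ⟨hV0, Metric.mem_ball_self (by positivity)⟩ Set.inter_subset_left
  choose y hy hy2 using hpt
  refine Loj.main (EuclideanSpace.equiv (Fin n) ℝ).symm f hfa y ?_
    (fun k => 1 - 1 / ((k : ℝ) + 2)) ?_ (fun k => (hθ k).1.ne') ?_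
  · rw [tendsto_zero_iff_norm_tendsto_zero]
    refine squeeze_zero (fun k => norm_nonneg _) (fun k => ?_)
      (tendsto_one_div_add_atTop_nhds_zero_nat (𝕜 := ℝ))
    have := (hy k).2
    rw [mem_ball_zero_iff] at this
    exact this.le
  · have h1 := (Filter.tendsto_add_atTop_iff_nat 1).2
      (tendsto_one_div_add_atTop_nhds_zero_nat (𝕜 := ℝ))
    have h2 := h1.const_sub 1
    rw [sub_zero] at h2
    refine h2.congr fun k => ?_
    push_cast
    ring
  · intro k
    have := hy2 k
    rwa [gradient, LinearIsometryEquiv.norm_map] at this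
end

section
/- Let f be a real-valued function that is real analytic on an open neighborhood of 0 in ℝⁿ. Then there exists an open neighborhood U of 0, contained in the domain of f, such that f(y) = f(0) for every y ∈ U with ∇f(y) = 0; that is, f takes the single value f(0) on its critical set near 0. -/
open Filter Topology
namespace LU
noncomputable section

variable {E : Type*} [NormedAddCommGroup E] [NormedSpace ℝ E]

/-- Division operator on multilinear maps. -/
def Q (e : E) (L : E →L[ℝ] E) : (k : ℕ) →
    ((ContinuousMultilinearMap ℝ (fun _ : Fin (k+1) => E) ℝ) →L[ℝ]
      (ContinuousMultilinearMap ℝ (fun _ : Fin k => E) ℝ))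
  | 0 => (ContinuousLinearMap.apply ℝ _ e).comp
      (continuousMultilinearCurryLeftEquiv ℝ (fun _ : Fin 1 => E) ℝ).toContinuousLinearEquiv.toContinuousLinearMap
  | (k+1) => (ContinuousLinearMap.apply ℝ _ e).comp
      (continuousMultilinearCurryLeftEquiv ℝ (fun _ : Fin (k+2) => E) ℝ).toContinuousLinearEquiv.toContinuousLinearMap
     + (continuousMultilinearCurryLeftEquiv ℝ (fun _ : Fin (k+1) => E) ℝ).symm.toContinuousLinearEquiv.toContinuousLinearMap.comp
       (((ContinuousLinearMap.compL ℝ E _ _ (Q e L k)).comp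
         ((ContinuousLinearMap.compL ℝ E E _).flip L)).comp
        (continuousMultilinearCurryLeftEquiv ℝ (fun _ : Fin (k+2) => E) ℝ).toContinuousLinearEquiv.toContinuousLinearMap)

lemma Q_zero_apply (e : E) (L : E →L[ℝ] E) (p) : Q e L 0 p = p.curryLeft e := rfl

lemma Q_succ_apply (e : E) (L : E →L[ℝ] E) (k : ℕ) (p) (x : E) :
    Q e L (k+1) p (fun _ => x) = p.curryLeft e (fun _ => x) + Q e L k (p.curryLeft (L x)) (fun _ => x) := rfl

lemma Q_succ_apply' (e : E) (L : E →L[ℝ] E) (k : ℕ) (p) (x : Fin (k+1) → E) :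
    Q e L (k+1) p x = p.curryLeft e x + Q e L k (p.curryLeft (L (x 0))) (Fin.tail x) := rfl

lemma Q_spec (e : E) (l : E →L[ℝ] ℝ) (L : E →L[ℝ] E) (hL : ∀ x, x = L x + l x • e) (k : ℕ)
    (p : ContinuousMultilinearMap ℝ (fun _ : Fin (k+1) => E) ℝ) (x : E) :
    p (fun _ => x) = p (fun _ => L x) + l x * Q e L k p (fun _ => x) := by
  have key : ∀ (k : ℕ) (p : ContinuousMultilinearMap ℝ (fun _ : Fin (k+1) => E) ℝ) (y : E),
      p (fun _ => y) = p.curryLeft y (fun _ => y) := by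
    intro k p y
    rw [ContinuousMultilinearMap.curryLeft_apply]
    congr 1; ext i; refine Fin.cases ?_ ?_ i <;> simp
  have key2 : ∀ (k : ℕ) (p : ContinuousMultilinearMap ℝ (fun _ : Fin (k+1) => E) ℝ),
      p.curryLeft x = p.curryLeft (L x) + l x • p.curryLeft e := by
    intro k p
    conv_lhs => rw [hL x]
    rw [map_add, map_smul]
  induction k with
  | zero =>
    rw [key, key _ _ (L x), key2, Q_zero_apply]
    rw [show (fun _ : Fin 0 => L x) = (fun _ : Fin 0 => x) from Subsingleton.elim _ _]
    simp only [add_apply, smul_apply, smul_eq_mul]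
  | succ k ih =>
    rw [Q_succ_apply, key, key2, key _ _ (L x)]
    have := ih (p.curryLeft (L x))
    simp only [add_apply, smul_apply, this, smul_eq_mul]
    ring

lemma Q_norm (e : E) (L : E →L[ℝ] E) (B : ℝ) (h1 : 1 ≤ B) (hB : ‖e‖ + ‖L‖ ≤ B) (k : ℕ)
    (p : ContinuousMultilinearMap ℝ (fun _ : Fin (k+1) => E) ℝ) :
    ‖Q e L k p‖ ≤ B ^ (k+1) * ‖p‖ := by
  have hc : ∀ (k : ℕ) (p : ContinuousMultilinearMap ℝ (fun _ : Fin (k+1) => E) ℝ) (y : E),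
      ‖p.curryLeft y‖ ≤ ‖p‖ * ‖y‖ := by
    intro k p y
    have := p.curryLeft.le_opNorm y
    rwa [ContinuousMultilinearMap.curryLeft_norm] at this
  have hn := norm_nonneg p
  have he := norm_nonneg e
  have hLn := norm_nonneg L
  induction k with
  | zero =>
    rw [Q_zero_apply]
    refine (hc _ p e).trans ?_
    rw [mul_comm]; gcongr; simp; linarith
  | succ k ih =>
    refine ContinuousMultilinearMap.opNorm_le_bound (by positivity) fun m => ?_
    rw [Q_succ_apply']
    have h2 : ‖(p.curryLeft e) m‖ ≤ ‖p‖ * ‖e‖ * ∏ i, ‖m i‖ :=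
      (ContinuousMultilinearMap.le_opNorm _ _).trans (by gcongr; exact hc _ p e)
    have h3 : ‖Q e L k (p.curryLeft (L (m 0))) (Fin.tail m)‖ ≤ (B^(k+1) * (‖p‖ * (‖L‖ * ‖m 0‖))) * ∏ i, ‖Fin.tail m i‖ := by
      refine (ContinuousMultilinearMap.le_opNorm _ _).trans ?_
      gcongr
      refine (ih _ (norm_nonneg _)).trans ?_
      gcongr
      refine (hc _ p _).trans ?_
      gcongr
      exact L.le_opNorm _
    refine (norm_add_le _ _).trans ((add_le_add h2 h3).trans ?_)
    rw [Fin.prod_univ_succ]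
    have : (∏ i : Fin k, ‖Fin.tail m i‖) = ∏ i : Fin k, ‖m i.succ‖ := rfl
    rw [this]
    set P := ∏ i : Fin k, ‖m i.succ‖ with hP
    have hP0 : 0 ≤ P := Finset.prod_nonneg fun _ _ => norm_nonneg _
    have hB1 : 1 ≤ B ^ (k+1) := one_le_pow₀ h1
    have : ‖e‖ + B^(k+1) * ‖L‖ ≤ B^(k+1+1) := by
      calc ‖e‖ + B^(k+1) * ‖L‖ ≤ B^(k+1) * ‖e‖ + B^(k+1) * ‖L‖ := by nlinarith
        _ = B^(k+1) * (‖e‖ + ‖L‖) := by ring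
        _ ≤ B^(k+1) * B := by gcongr
        _ = _ := by ring
    calc _ = (‖e‖ + B^(k+1) * ‖L‖) * (‖p‖ * (‖m 0‖ * P)) := by ring
      _ ≤ B^(k+1+1) * (‖p‖ * (‖m 0‖ * P)) := by gcongr
      _ = _ := by ring

/-- Hadamard-type division for analytic functions. -/
theorem div_lemma (e : E) (l : E →L[ℝ] ℝ) (L : E →L[ℝ] E) (hL : ∀ x, x = L x + l x • e)
    (f : E → ℝ) (hf : AnalyticAt ℝ f 0) :
    ∃ u : E → ℝ, AnalyticAt ℝ u 0 ∧ ∀ᶠ x in 𝓝 0, f x = f (L x) + l x * u x := by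
  obtain ⟨p, hp⟩ := hf
  obtain ⟨r, hr⟩ := hp
  let q : FormalMultilinearSeries ℝ E ℝ := fun k => Q e L k (p (k+1))
  obtain ⟨C, r0, hC, hr0, hbd⟩ := p.le_mul_pow_of_radius_pos (hr.r_pos.trans_le hr.r_le)
  set B := 1 + ‖e‖ + ‖L‖ with hB
  have he := norm_nonneg e
  have hLn := norm_nonneg L
  have hB1 : 1 ≤ B := by linarith
  have hq : 0 < q.radius := by
    let s : NNReal := ⟨(B * r0)⁻¹, by positivity⟩
    have hs : (0 : ENNReal) < s := by
      simp only [ENNReal.coe_pos]; rw [← NNReal.coe_pos]; change (0:ℝ) < (B * r0)⁻¹; positivity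
    refine hs.trans_le (q.le_radius_of_bound (B * r0 * C) fun n => ?_)
    have h1 : ‖q n‖ ≤ B^(n+1) * (C * r0^(n+1)) :=
      (Q_norm e L B hB1 (by linarith) n _).trans (by gcongr; exact hbd _)
    change ‖q n‖ * ((B * r0)⁻¹) ^ n ≤ _
    calc _ ≤ B^(n+1) * (C * r0^(n+1)) * ((B * r0)⁻¹) ^ n := by gcongr
      _ = B * r0 * C := by rw [inv_pow, mul_pow]; field_simp; ring
  have hqs := q.hasFPowerSeriesOnBall hq
  refine ⟨q.sum, hqs.analyticAt, ?_⟩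
  have e1 : ∀ᶠ x : E in 𝓝 0, x ∈ Metric.eball (0:E) q.radius := Metric.eball_mem_nhds _ hq
  have e2 : ∀ᶠ x : E in 𝓝 0, x ∈ Metric.eball (0:E) r := Metric.eball_mem_nhds _ hr.r_pos
  have e3 : ∀ᶠ x : E in 𝓝 0, L x ∈ Metric.eball (0:E) r := by
    have : Tendsto L (𝓝 0) (𝓝 0) := by simpa using L.continuous.tendsto 0
    exact this e2
  filter_upwards [e1, e2, e3] with x h1 h2 h3
  have s1 := hqs.hasSum h1
  have s2 := hr.hasSum h2
  have s3 := hr.hasSum h3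
  rw [zero_add] at s1 s2 s3
  have s4 := (hasSum_nat_add_iff' 1).2 (s2.sub s3)
  have s5 := s1.mul_left (l x)
  have : (fun n => (p (n+1) fun _ => x) - (p (n+1) fun _ => L x)) = fun n => l x * q n fun _ => x := by
    ext n
    rw [Q_spec e l L hL n (p (n+1)) x]; simp [q]
  rw [this] at s4
  have := s4.unique s5
  have h0 : (p 0 fun _ => x) = p 0 fun _ => L x := by congr 1; ext i; exact i.elim0
  simp [h0] at this
  linarith

end
end LU
open Filter Topology
namespace LU
noncomputable section

variable {E : Type*} [NormedAddCommGroup E] [NormedSpace ℝ E]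

lemma an_comp {F G : Type*} [NormedAddCommGroup F] [NormedSpace ℝ F] [NormedAddCommGroup G] [NormedSpace ℝ G]
    {g : F → G} {f : E → F} (hg : AnalyticAt ℝ g 0) (hf : AnalyticAt ℝ f 0) (h0 : f 0 = 0) :
    AnalyticAt ℝ (fun x => g (f x)) 0 :=
  AnalyticAt.fun_comp (by rw [h0]; exact hg) hf

lemma an_tendsto {F : Type*} [NormedAddCommGroup F] [NormedSpace ℝ F]
    {f : E → F} (hf : AnalyticAt ℝ f 0) (h0 : f 0 = 0) : Tendsto f (𝓝 0) (𝓝 0) := by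
  have := hf.continuousAt.tendsto
  rwa [h0] at this

lemma analytic_nzd (f g : E → ℝ) (hf : AnalyticAt ℝ f 0) (hg : AnalyticAt ℝ g 0)
    (h : ∀ᶠ x in 𝓝 0, f x * g x = 0) : (∀ᶠ x in 𝓝 0, f x = 0) ∨ (∀ᶠ x in 𝓝 0, g x = 0) := by
  by_contra hcon
  rw [not_or] at hcon
  obtain ⟨h1, h2⟩ := hcon
  have hall := (hf.eventually_analyticAt.and hg.eventually_analyticAt).and h
  obtain ⟨r, hr, hball⟩ := Metric.eventually_nhds_iff_ball.1 hall
  apply h2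
  have : ∃ y ∈ Metric.ball (0:E) r, f y ≠ 0 := by
    by_contra hc
    push Not at hc
    exact h1 (Metric.eventually_nhds_iff_ball.2 ⟨r, hr, hc⟩)
  obtain ⟨y, hy, hfy⟩ := this
  have hgy : g =ᶠ[𝓝 y] 0 := by
    have c1 := (hball y hy).1.1.continuousAt.eventually_ne hfy
    filter_upwards [c1, Metric.isOpen_ball.mem_nhds hy] with z hz hz2
    have := (hball z hz2).2
    exact (mul_eq_zero.1 this).resolve_left hz
  have := AnalyticOnNhd.eqOn_zero_of_preconnected_of_eventuallyEq_zero (𝕜 := ℝ) (U := Metric.ball (0:E) r)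
    (f := g) (fun z hz => (hball z hz).1.2) (convex_ball _ _).isPreconnected hy hgy
  exact Metric.eventually_nhds_iff_ball.2 ⟨r, hr, fun z hz => this hz⟩

lemma analytic_prod_ne {ι : Type*} (s : Finset ι) (f : ι → E → ℝ) (hf : ∀ i ∈ s, AnalyticAt ℝ (f i) 0)
    (h : ∀ i ∈ s, ¬ ∀ᶠ x in 𝓝 0, f i x = 0) : ¬ ∀ᶠ x in 𝓝 0, ∏ i ∈ s, f i x = 0 := by
  classical
  induction s using Finset.induction_on with
  | empty => simp; exact NeBot.ne inferInstance
  | insert a s ha ih =>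
    intro hc
    simp only [Finset.prod_insert ha] at hc
    rcases analytic_nzd _ _ (hf a (by simp)) (Finset.analyticAt_fun_prod s fun i hi => hf i (by simp [hi])) hc with h1 | h1
    · exact h a (by simp) h1
    · exact ih (fun i hi => hf i (by simp [hi])) (fun i hi => h i (by simp [hi])) h1

/-- Partial derivative in the last direction. -/
def D (h : E × ℝ → ℝ) : E × ℝ → ℝ := fun p => fderiv ℝ h p (0, 1)

lemma D_analytic {h : E × ℝ → ℝ} {p} (hh : AnalyticAt ℝ h p) : AnalyticAt ℝ (D h) p :=
  AnalyticAt.fun_comp (g := fun A : (E × ℝ) →L[ℝ] ℝ => A (0, 1)) (f := fderiv ℝ h)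
    ((ContinuousLinearMap.apply ℝ ℝ ((0:E), (1:ℝ))).analyticAt _) hh.fderiv

lemma D_iter_analytic {h : E × ℝ → ℝ} {p} (hh : AnalyticAt ℝ h p) (i : ℕ) : AnalyticAt ℝ (D^[i] h) p := by
  induction i with
  | zero => exact hh
  | succ i ih => rw [Function.iterate_succ_apply']; exact D_analytic ih

lemma D_eq_deriv {h : E × ℝ → ℝ} {p : E × ℝ} (hh : DifferentiableAt ℝ h p) :
    D h p = deriv (fun s => h (p.1, s)) p.2 := by
  have h1 : HasDerivAt (fun s : ℝ => (p.1, s)) ((0:E), (1:ℝ)) p.2 :=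
    (hasDerivAt_const _ _).prodMk (hasDerivAt_id _)
  have h2 : HasFDerivAt h (fderiv ℝ h p) ((fun s : ℝ => (p.1, s)) p.2) := hh.hasFDerivAt
  exact (h2.comp_hasDerivAt p.2 h1).deriv.symm

lemma slice {h : E × ℝ → ℝ} (hh : AnalyticAt ℝ h 0) (i : ℕ) :
    ∀ᶠ p in 𝓝 (0 : E × ℝ), D^[i] h p = iteratedDeriv i (fun s => h (p.1, s)) p.2 := by
  induction i with
  | zero => simp
  | succ i ih =>
    filter_upwards [ih.eventually_nhds, (D_iter_analytic hh i).eventually_analyticAt] with p hp hp2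
    rw [Function.iterate_succ_apply', D_eq_deriv hp2.differentiableAt, iteratedDeriv_succ]
    apply Filter.EventuallyEq.deriv_eq
    have : Tendsto (fun s : ℝ => (p.1, s)) (𝓝 p.2) (𝓝 p) := by
      have : Continuous (fun s : ℝ => (p.1, s)) := by fun_prop
      exact this.tendsto p.2
    exact this.eventually hp

lemma tendsto_mk0 : Tendsto (fun x : E => (x, (0:ℝ))) (𝓝 0) (𝓝 0) := by
  have : Continuous (fun x : E => (x, (0:ℝ))) := by fun_prop
  exact this.tendsto 0

lemma tendsto_0mk : Tendsto (fun t : ℝ => ((0:E), t)) (𝓝 0) (𝓝 0) := by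
  have : Continuous (fun x : ℝ => ((0:E), x)) := by fun_prop
  exact this.tendsto 0

/-- Taylor expansion in the last variable with analytic coefficients and remainder. -/
theorem taylor {h : E × ℝ → ℝ} (hh : AnalyticAt ℝ h 0) (k : ℕ) :
    ∃ u : E × ℝ → ℝ, AnalyticAt ℝ u 0 ∧ ∀ᶠ p in 𝓝 (0 : E × ℝ),
      h p = ∑ i ∈ Finset.range k, (D^[i] h (p.1, 0) / i.factorial) * p.2 ^ i + p.2 ^ k * u p := by
  induction k with
  | zero => exact ⟨h, hh, by simp⟩
  | succ k ih =>
    obtain ⟨u, hu, hexp⟩ := ih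
    obtain ⟨v, hv, hdiv⟩ := div_lemma ((0:E), (1:ℝ)) (ContinuousLinearMap.snd ℝ E ℝ)
      ((ContinuousLinearMap.inl ℝ E ℝ).comp (ContinuousLinearMap.fst ℝ E ℝ))
      (by rintro ⟨x, t⟩; simp) u hu
    refine ⟨v, hv, ?_⟩
    have hk : ∀ᶠ x in 𝓝 (0:E), u (x, 0) = D^[k] h (x, 0) / k.factorial := by
      have hs := fun i => tendsto_mk0.eventually (slice hh i)
      have hs' : ∀ᶠ x in 𝓝 (0:E), ∀ i ∈ Finset.range (k+1),
          D^[i] h (x, 0) = iteratedDeriv i (fun s => h (x, s)) 0 :=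
        (Filter.eventually_all_finset _).2 fun i _ => hs i
      filter_upwards [hs', tendsto_mk0.eventually hexp.eventually_nhds,
        tendsto_mk0.eventually hu.eventually_analyticAt,
        tendsto_mk0.eventually hh.eventually_analyticAt] with x h1 h2 h3 h4
      have ha : AnalyticAt ℝ (fun s : ℝ => h (x, s)) 0 :=
        AnalyticAt.fun_comp (g := h) (f := fun s : ℝ => (x, s)) h4 (by fun_prop)
      obtain ⟨F, hF, hFe⟩ := ha.exists_eq_sum_add_pow_mul (k+1)
      have ht : Tendsto (fun s : ℝ => (x, s)) (𝓝 0) (𝓝 (x, 0)) := by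
        have : Continuous (fun s : ℝ => (x, s)) := by fun_prop
        exact this.tendsto 0
      have heq : ∀ᶠ t in 𝓝[≠] (0:ℝ), u (x, t) = D^[k] h (x, 0) / k.factorial + t * F t := by
        filter_upwards [(ht.eventually h2).filter_mono nhdsWithin_le_nhds, self_mem_nhdsWithin] with t ht1 ht2
        have e1 := hFe t
        rw [ht1, Finset.sum_range_succ] at e1
        have e2 : ∑ i ∈ Finset.range k, (t ^ i / i.factorial) • iteratedDeriv i (fun s => h (x, s)) 0
            = ∑ i ∈ Finset.range k, (D^[i] h (x, 0) / i.factorial) * t ^ i := by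
          refine Finset.sum_congr rfl fun i hi => ?_
          rw [h1 i (by simp at hi ⊢; omega), smul_eq_mul]; ring
        rw [e2, ← h1 k (by simp)] at e1
        have ht0 : t ^ k ≠ 0 := pow_ne_zero _ ht2
        apply mul_left_cancel₀ ht0
        simp only [smul_eq_mul] at e1
        rw [pow_succ] at e1
        linear_combination e1
      have l1 : Tendsto (fun t : ℝ => u (x, t)) (𝓝[≠] 0) (𝓝 (u (x, 0))) :=
        (h3.continuousAt.tendsto.comp ht).mono_left nhdsWithin_le_nhds
      have l2 : Tendsto (fun t : ℝ => D^[k] h (x, 0) / k.factorial + t * F t) (𝓝[≠] 0)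
          (𝓝 (D^[k] h (x, 0) / k.factorial)) := by
        have : Tendsto (fun t : ℝ => D^[k] h (x, 0) / k.factorial + t * F t) (𝓝 0)
          (𝓝 (D^[k] h (x, 0) / k.factorial + 0 * F 0)) :=
          tendsto_const_nhds.add (tendsto_id.mul hF.continuousAt.tendsto)
        rw [zero_mul, add_zero] at this
        exact this.mono_left nhdsWithin_le_nhds
      exact tendsto_nhds_unique l1 (l2.congr' (heq.mono fun _ h => h.symm))
    have hk' : ∀ᶠ p in 𝓝 (0 : E × ℝ), u (p.1, 0) = D^[k] h (p.1, 0) / k.factorial := by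
      have : Tendsto (fun p : E × ℝ => p.1) (𝓝 0) (𝓝 0) := continuous_fst.tendsto' _ _ rfl
      exact this.eventually hk
    filter_upwards [hexp, hdiv, hk'] with p h1 h2 h3
    rw [Finset.sum_range_succ, h1, h2]
    simp only [ContinuousLinearMap.comp_apply, ContinuousLinearMap.inl_apply, ContinuousLinearMap.coe_fst',
      ContinuousLinearMap.coe_snd']
    rw [h3]; ring

theorem implicit [CompleteSpace E] {F : E × ℝ → ℝ} (hF : AnalyticAt ℝ F 0) (h0 : F 0 = 0) (h1 : D F 0 ≠ 0) :
    ∃ φ : E → ℝ, AnalyticAt ℝ φ 0 ∧ φ 0 = 0 ∧ ∀ᶠ x in 𝓝 0, F (x, φ x) = 0 := by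
  have cdf : ContDiffAt ℝ ⊤ F 0 := hF.contDiffAt
  have if2 : (fderiv ℝ F 0 ∘L .inr ℝ E ℝ).IsInvertible := by
    refine ⟨ContinuousLinearEquiv.unitsEquivAut ℝ (Units.mk0 _ h1), ?_⟩
    ext
    simp [D]
  refine ⟨cdf.implicitFunction (by simp) if2, (cdf.contDiffAt_implicitFunction (by simp) if2).analyticAt,
    cdf.implicitFunction_apply_self (by simp) if2, ?_⟩
  have := cdf.eventually_apply_implicitFunction (by simp) if2
  rwa [h0] at this

/-- Tschirnhausen shift. -/
theorem shift_D {h : E × ℝ → ℝ} (hh : AnalyticAt ℝ h 0) {φ : E → ℝ} (hφ : AnalyticAt ℝ φ 0) (h0 : φ 0 = 0)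
    (i : ℕ) : ∀ᶠ p in 𝓝 (0 : E × ℝ), D^[i] (fun p => h (p.1, p.2 + φ p.1)) p = D^[i] h (p.1, p.2 + φ p.1) := by
  have hS : AnalyticAt ℝ (fun p : E × ℝ => (p.1, p.2 + φ p.1)) 0 :=
    analyticAt_fst.prod (analyticAt_snd.fun_add (an_comp hφ analyticAt_fst rfl))
  have hS0 : (fun p : E × ℝ => (p.1, p.2 + φ p.1)) 0 = 0 := by simp [h0]
  have hh' : AnalyticAt ℝ (fun p : E × ℝ => h (p.1, p.2 + φ p.1)) 0 := an_comp hh hS hS0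
  have ht := an_tendsto hS hS0
  filter_upwards [slice hh' i, ht.eventually (slice hh i)] with p h1 h2
  rw [h1, h2, iteratedDeriv_comp_add_const (f := fun s => h (p.1, s))]

end
end LU
open Filter Topology
namespace LU
noncomputable section

variable {ι κ : Type*} [Fintype ι] [Fintype κ]

/-- Monomial function. -/
def mon (α : ι → ℕ) (x : ι → ℝ) : ℝ := ∏ i, x i ^ α i

lemma mon_add (α β : ι → ℕ) (x : ι → ℝ) : mon (α + β) x = mon α x * mon β x := by
  simp [mon, pow_add, Finset.prod_mul_distrib]

lemma mon_zero (x : ι → ℝ) : mon (0 : ι → ℕ) x = 1 := by simp [mon]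

lemma mon_smul (k : ℕ) (α : ι → ℕ) (x : ι → ℝ) : mon (k • α) x = mon α x ^ k := by
  simp [mon, mul_comm k, pow_mul, Finset.prod_pow]

lemma mon_single [DecidableEq ι] (i : ι) (x : ι → ℝ) : mon (Pi.single i 1) x = x i := by
  unfold mon
  rw [Finset.prod_eq_single i]
  · simp
  · intro b _ hb; simp [hb]
  · simp

lemma proj_analytic (i : ι) (z : ι → ℝ) : AnalyticAt ℝ (fun x : ι → ℝ => x i) z :=
  (ContinuousLinearMap.proj (R := ℝ) (φ := fun _ : ι => ℝ) i).analyticAt z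

lemma mon_analytic (α : ι → ℕ) (z : ι → ℝ) : AnalyticAt ℝ (mon α) z :=
  Finset.analyticAt_fun_prod _ fun i _ => (proj_analytic i z).fun_pow _

lemma mon_at_zero {α : ι → ℕ} (h : α ≠ 0) : mon α 0 = 0 := by
  obtain ⟨i, hi⟩ := Function.ne_iff.1 h
  exact Finset.prod_eq_zero (Finset.mem_univ i) (by simpa using hi)

/-- `f` is the monomial `α` times an analytic unit near `0`. -/
def MUe (α : ι → ℕ) (f : (ι → ℝ) → ℝ) : Prop :=
  ∃ u : (ι → ℝ) → ℝ, AnalyticAt ℝ u 0 ∧ u 0 ≠ 0 ∧ ∀ᶠ x in 𝓝 0, f x = mon α x * u x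

lemma MUe.congr {α : ι → ℕ} {f g : (ι → ℝ) → ℝ} (h : MUe α f) (hfg : ∀ᶠ x in 𝓝 0, g x = f x) : MUe α g := by
  obtain ⟨u, a, b, c⟩ := h
  exact ⟨u, a, b, by filter_upwards [c, hfg] with x h1 h2; rw [h2, h1]⟩

lemma MUe.mul {α β : ι → ℕ} {f g : (ι → ℝ) → ℝ} (h : MUe α f) (h' : MUe β g) :
    MUe (α + β) (fun x => f x * g x) := by
  obtain ⟨u, a, b, c⟩ := h
  obtain ⟨u', a', b', c'⟩ := h'
  refine ⟨fun x => u x * u' x, a.fun_mul a', mul_ne_zero b b', ?_⟩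
  filter_upwards [c, c'] with x h1 h2
  rw [h1, h2, mon_add]; ring

lemma MUe.unit {u : (ι → ℝ) → ℝ} (a : AnalyticAt ℝ u 0) (b : u 0 ≠ 0) : MUe 0 u :=
  ⟨u, a, b, by simp [mon_zero]⟩

lemma MUe.monomial (α : ι → ℕ) : MUe α (mon α) :=
  ⟨fun _ => 1, analyticAt_const, by simp, by simp⟩

lemma MUe.pow {α : ι → ℕ} {f : (ι → ℝ) → ℝ} (h : MUe α f) (k : ℕ) : MUe (k • α) (fun x => f x ^ k) := by
  obtain ⟨u, a, b, c⟩ := h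
  refine ⟨fun x => u x ^ k, a.fun_pow k, pow_ne_zero _ b, ?_⟩
  filter_upwards [c] with x h1
  rw [h1, mon_smul]; ring

lemma MUe.prod {τ : Type*} (s : Finset τ) {α : τ → ι → ℕ} {f : τ → (ι → ℝ) → ℝ} (h : ∀ t ∈ s, MUe (α t) (f t)) :
    MUe (∑ t ∈ s, α t) (fun x => ∏ t ∈ s, f t x) := by
  classical
  induction s using Finset.induction_on with
  | empty => simpa using MUe.unit (ι := ι) (u := fun _ => 1) analyticAt_const (by simp)
  | insert a s ha ih =>
    simp only [Finset.sum_insert ha, Finset.prod_insert ha]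
    exact (h a (by simp)).mul (ih fun t ht => h t (by simp [ht]))

lemma MUe.analytic {α : ι → ℕ} {f : (ι → ℝ) → ℝ} (h : MUe α f) : AnalyticAt ℝ f 0 := by
  obtain ⟨u, a, b, c⟩ := h
  exact ((mon_analytic α 0).fun_mul a).congr (c.mono fun _ h => h.symm)

lemma eventually_dense (i : ι) {f g : (ι → ℝ) → ℝ} (hf : AnalyticAt ℝ f 0) (hg : AnalyticAt ℝ g 0)
    (h : ∀ᶠ x in 𝓝 0, x i * f x = x i * g x) : ∀ᶠ x in 𝓝 0, f x = g x := by
  have : ∀ᶠ x : ι → ℝ in 𝓝 0, x i * (f x - g x) = 0 := by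
    filter_upwards [h] with x hx; linarith
  rcases analytic_nzd (fun x : ι → ℝ => x i) (fun x => f x - g x) (proj_analytic i 0) (hf.fun_sub hg) this with h1 | h1
  · exfalso
    classical
    have ht : Tendsto (fun t : ℝ => (Pi.single i t : ι → ℝ)) (𝓝 0) (𝓝 0) :=
      (continuous_single i).tendsto' _ _ (by simp)
    have h2 := ht.eventually h1
    simp only [Pi.single_eq_same] at h2
    have h3 : ∀ᶠ x in 𝓝[≠] (0:ℝ), x = 0 := h2.filter_mono nhdsWithin_le_nhds
    obtain ⟨x, hx, hx'⟩ := (h3.and self_mem_nhdsWithin).exists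
    exact hx' hx
  · filter_upwards [h1] with x hx; linarith

lemma MUe.ne {α : ι → ℕ} {f : (ι → ℝ) → ℝ} (h : MUe α f) : ¬ ∀ᶠ x in 𝓝 0, f x = 0 := by
  intro hz
  obtain ⟨u, a, b, c⟩ := h
  have h1 : ∀ᶠ x in 𝓝 0, mon α x = 0 := by
    filter_upwards [c, hz, a.continuousAt.eventually_ne b] with x h1 h2 h3
    rw [h2] at h1
    exact (mul_eq_zero.1 h1.symm).resolve_right h3
  have ht : Tendsto (fun t : ℝ => (fun _ => t : ι → ℝ)) (𝓝 0) (𝓝 0) := by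
    have : Continuous (fun t : ℝ => (fun _ => t : ι → ℝ)) := by fun_prop
    exact this.tendsto 0
  have h2 := ht.eventually h1
  have h3 : ∀ᶠ t in 𝓝[≠] (0:ℝ), mon α (fun _ => t) = 0 := h2.filter_mono nhdsWithin_le_nhds
  obtain ⟨t, hx, hx'⟩ := (h3.and self_mem_nhdsWithin).exists
  exact Finset.prod_ne_zero_iff.2 (fun i _ => pow_ne_zero _ hx') hx

lemma div_coord [DecidableEq ι] (i : ι) {f : (ι → ℝ) → ℝ} (hf : AnalyticAt ℝ f 0)
    (h : ∀ᶠ x in 𝓝 0, f (Function.update x i 0) = 0) :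
    ∃ u, AnalyticAt ℝ u 0 ∧ ∀ᶠ x in 𝓝 0, f x = x i * u x := by
  let l := ContinuousLinearMap.proj (R := ℝ) (φ := fun _ : ι => ℝ) i
  let e : ι → ℝ := Pi.single i 1
  let L : (ι → ℝ) →L[ℝ] (ι → ℝ) := ContinuousLinearMap.id ℝ _ - l.smulRight e
  have hL : ∀ x, L x = Function.update x i 0 := by
    intro x; ext k
    by_cases hk : k = i
    · subst hk; simp [L, l, e]
    · simp [L, l, e, hk]
  obtain ⟨u, hu, h2⟩ := div_lemma e l L (by intro x; simp [L]) f hf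
  refine ⟨u, hu, ?_⟩
  filter_upwards [h2, h] with x h1 h2
  rw [h1, hL, h2]; simp [l]

lemma MUe.factor (N : ℕ) : ∀ {α : ι → ℕ} {f g : (ι → ℝ) → ℝ}, ∑ i, α i = N → AnalyticAt ℝ f 0 →
    AnalyticAt ℝ g 0 → MUe α (fun x => f x * g x) → ∃ β, MUe β f := by
  classical
  induction N with
  | zero =>
    intro α f g hN hf hg h
    obtain ⟨u, a, b, c⟩ := h
    have hα : α = 0 := by ext i; simpa using (Finset.sum_eq_zero_iff.1 hN) i (Finset.mem_univ i)
    subst hα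
    refine ⟨0, MUe.unit hf ?_⟩
    have := c.self_of_nhds
    rw [mon_zero, one_mul] at this
    intro h0; simp only [h0, zero_mul] at this; exact b this.symm
  | succ N ih =>
    intro α f g hN hf hg h
    obtain ⟨u, a, b, c⟩ := h
    obtain ⟨i, hi⟩ : ∃ i, α i ≠ 0 := by
      by_contra hc; push Not at hc; simp [hc] at hN
    set α' : ι → ℕ := Function.update α i (α i - 1) with hα'
    have hαe : α = α' + Pi.single i 1 := by
      ext k; by_cases hk : k = i
      · subst hk; simp [hα']; omega
      · simp [hα', hk]
    have hN' : ∑ i, α' i = N := by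
      rw [hαe] at hN
      simp [Finset.sum_add_distrib] at hN
      exact hN
    have hcont : Continuous (fun x : ι → ℝ => Function.update x i 0) := by fun_prop
    have ht : Tendsto (fun x : ι → ℝ => Function.update x i 0) (𝓝 0) (𝓝 0) :=
      hcont.tendsto' _ _ (by ext k; by_cases hk : k = i <;> simp [hk, Function.update_apply])
    have hP : AnalyticAt ℝ (fun x : ι → ℝ => Function.update x i 0) 0 := by
      rw [analyticAt_pi_iff]
      intro k
      by_cases hk : k = i
      · subst hk; simpa using analyticAt_const
      · simpa [hk, Function.update_apply] using proj_analytic k _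
    have hP0 : Function.update (0 : ι → ℝ) i 0 = 0 := by
      ext k; by_cases hk : k = i <;> simp [hk, Function.update_apply]
    have hz : ∀ᶠ x in 𝓝 0, f (Function.update x i 0) * g (Function.update x i 0) = 0 := by
      filter_upwards [ht.eventually c] with x hx
      rw [hx, mul_eq_zero]; left
      exact Finset.prod_eq_zero (Finset.mem_univ i) (by simp [hi])
    rcases analytic_nzd _ _ (an_comp hf hP hP0) (an_comp hg hP hP0) hz with h1 | h1
    · obtain ⟨v, hv, hfv⟩ := div_coord i hf h1
      obtain ⟨β, hβ⟩ := ih hN' hv hg ⟨u, a, b, eventually_dense i (hv.fun_mul hg) ((mon_analytic _ _).fun_mul a) (by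
        filter_upwards [c, hfv] with x h1 h2
        rw [h2, hαe, mon_add, mon_single] at h1
        linear_combination h1)⟩
      refine ⟨Pi.single i 1 + β, ((MUe.monomial (Pi.single i 1)).mul hβ).congr ?_⟩
      filter_upwards [hfv] with x hx
      rw [hx, mon_single]
    · obtain ⟨v, hv, hfv⟩ := div_coord i hg h1
      exact ih hN' hf hv ⟨u, a, b, eventually_dense i (hf.fun_mul hv) ((mon_analytic _ _).fun_mul a) (by
        filter_upwards [c, hfv] with x h1 h2
        rw [h2, hαe, mon_add, mon_single] at h1
        linear_combination h1)⟩

/-- Monomial map with exponent matrix `A`. -/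
def MonMap (A : ι → κ → ℕ) (π : (κ → ℝ) → (ι → ℝ)) : Prop := ∀ i, MUe (A i) (fun x => π x i)

def act (A : ι → κ → ℕ) (α : ι → ℕ) : κ → ℕ := ∑ i, α i • A i

lemma act_apply (A : ι → κ → ℕ) (α : ι → ℕ) (k : κ) : act A α k = ∑ i, α i * A i k := by
  simp [act]

lemma act_mono (A : ι → κ → ℕ) {α β : ι → ℕ} (h : α ≤ β) : act A α ≤ act A β := by
  intro k
  rw [act_apply, act_apply]
  exact Finset.sum_le_sum fun i _ => Nat.mul_le_mul_right _ (h i)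

lemma act_smul (A : ι → κ → ℕ) (m : ℕ) (α : ι → ℕ) : act A (m • α) = m • act A α := by
  ext k
  simp [act_apply, Finset.mul_sum, mul_assoc]

lemma MonMap.analytic {A : ι → κ → ℕ} {π} (h : MonMap A π) : AnalyticAt ℝ π 0 :=
  analyticAt_pi_iff.2 fun i => (h i).analytic

lemma MUe.pullback {α : ι → ℕ} {f : (ι → ℝ) → ℝ} (hf : MUe α f) {A : ι → κ → ℕ} {π} (h : MonMap A π)
    (h0 : π 0 = 0) : MUe (act A α) (fun x => f (π x)) := by
  obtain ⟨u, a, b, c⟩ := hf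
  have h1 : MUe (act A α) (fun x => mon α (π x)) :=
    MUe.prod Finset.univ fun i _ => (h i).pow (α i)
  have h2 : MUe 0 (fun x => u (π x)) := MUe.unit (an_comp a h.analytic h0) (by rwa [h0])
  have := h1.mul h2
  rw [add_zero] at this
  exact this.congr ((an_tendsto h.analytic h0).eventually c)

lemma MonMap.comp {μ : Type*} [Fintype μ] {A : ι → κ → ℕ} {π} (h : MonMap A π) {B : κ → μ → ℕ} {σ}
    (h' : MonMap B σ) (h0 : σ 0 = 0) : MonMap (fun i => act B (A i)) (fun x => π (σ x)) :=
  fun i => (h i).pullback h' h0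

lemma act_act {μ : Type*} [Fintype μ] (A : ι → κ → ℕ) (B : κ → μ → ℕ) (α : ι → ℕ) :
    act (fun i => act B (A i)) α = act B (act A α) := by
  ext m
  simp only [act_apply, Finset.mul_sum, Finset.sum_mul]
  rw [Finset.sum_comm]
  simp [mul_assoc]

lemma MonMap_id [DecidableEq ι] : MonMap (fun i : ι => Pi.single i 1) (fun x => x) :=
  fun i => (MUe.monomial _).congr (by simp [mon_single])

lemma act_id [DecidableEq ι] (α : ι → ℕ) : act (fun i : ι => Pi.single i 1) α = α := by
  ext k; simp [act_apply, Pi.single_apply]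

end
end LU
open Filter Topology
namespace LU
noncomputable section

/-- `V` is a lift of the ultrafilter `U` along the analytic map germ `π`. -/
structure Pull {E F : Type*} [NormedAddCommGroup E] [NormedSpace ℝ E] [NormedAddCommGroup F] [NormedSpace ℝ F]
    (U : Ultrafilter E) (π : F → E) (V : Ultrafilter F) : Prop where
  an : AnalyticAt ℝ π 0
  zero : π 0 = 0
  le : (V : Filter F) ≤ 𝓝 0
  map : V.map π = U

section
variable {E F G : Type*} [NormedAddCommGroup E] [NormedSpace ℝ E] [NormedAddCommGroup F] [NormedSpace ℝ F]
  [NormedAddCommGroup G] [NormedSpace ℝ G]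

lemma Pull.comp {U : Ultrafilter E} {π : F → E} {V : Ultrafilter F} {σ : G → F} {W : Ultrafilter G}
    (h : Pull U π V) (h' : Pull V σ W) : Pull U (fun x => π (σ x)) W where
  an := an_comp h.an h'.an h'.zero
  zero := by rw [h'.zero, h.zero]
  le := h'.le
  map := by rw [← h.map, ← h'.map]; rfl

lemma Pull.eventually {U : Ultrafilter E} {π : F → E} {V : Ultrafilter F} (h : Pull U π V) {P : E → Prop} :
    (∀ᶠ x in (U : Filter E), P x) ↔ ∀ᶠ z in (V : Filter F), P (π z) := by
  rw [← h.map]; rfl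

lemma Pull.of_section {U : Ultrafilter E} {π : F → E} (s : E → F) (an : AnalyticAt ℝ π 0) (h0 : π 0 = 0)
    (hs : Tendsto s U (𝓝 0)) (hsec : ∀ᶠ x in (U : Filter E), π (s x) = x) : Pull U π (U.map s) where
  an := an
  zero := h0
  le := hs
  map := by
    apply Ultrafilter.coe_injective
    rw [Ultrafilter.coe_map, Ultrafilter.coe_map, Filter.map_map]
    conv_rhs => rw [← Filter.map_id (f := (U : Filter E))]
    exact Filter.map_congr hsec

lemma Pull.id {U : Ultrafilter E} (h : (U : Filter E) ≤ 𝓝 0) : Pull U (fun x => x) U where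
  an := analyticAt_id
  zero := rfl
  le := h
  map := Ultrafilter.map_id U

lemma Pull.le_base {U : Ultrafilter E} {π : F → E} {V : Ultrafilter F} (h : Pull U π V) : (U : Filter E) ≤ 𝓝 0 := by
  rw [← h.map]
  exact (an_tendsto h.an h.zero).mono_left h.le

/-- Lifting along a product map. -/
lemma Pull.prod {U : Ultrafilter (E × ℝ)} (hU : (U : Filter (E × ℝ)) ≤ 𝓝 0) {σ : F → E} {V : Ultrafilter F}
    (h : Pull (U.map Prod.fst) σ V) : ∃ W : Ultrafilter (F × ℝ), Pull U (fun p => (σ p.1, p.2)) W := by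
  have hne : (comap (Prod.fst : F × ℝ → F) (V : Filter F) ⊓
      comap (fun p : F × ℝ => (σ p.1, p.2)) (U : Filter (E × ℝ))).NeBot := by
    rw [Filter.inf_neBot_iff]
    rintro s ⟨A, hA, hAs⟩ t ⟨B, hB, hBt⟩
    have h1 : Set.image σ A ∈ (U.map Prod.fst : Ultrafilter E) := by
      rw [← h.map]; exact Filter.image_mem_map hA
    have h2 : Set.preimage Prod.fst (Set.image σ A) ∈ U := h1
    obtain ⟨⟨x, t⟩, hx1, hx2⟩ := U.nonempty_of_mem (Filter.inter_mem h2 hB)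
    obtain ⟨z, hz, hzx⟩ := hx1
    simp only at hzx
    refine ⟨(z, t), hAs hz, hBt ?_⟩
    change (σ z, t) ∈ B
    rw [hzx]; exact hx2
  obtain ⟨W, hW⟩ := @Ultrafilter.exists_le _ _ hne
  have hmap : W.map (fun p : F × ℝ => (σ p.1, p.2)) = U := by
    apply Ultrafilter.coe_injective
    refine (Ultrafilter.unique _ ?_)
    rw [Ultrafilter.coe_map]
    exact Filter.map_le_iff_le_comap.2 (hW.trans inf_le_right)
  refine ⟨W, ⟨(an_comp h.an analyticAt_fst rfl).prod analyticAt_snd, by simp [h.zero], ?_, hmap⟩⟩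
  have t1 : Tendsto (Prod.fst : F × ℝ → F) W (𝓝 0) :=
    (Filter.map_le_iff_le_comap.2 (hW.trans inf_le_left)).trans h.le
  have t2 : Tendsto (Prod.snd : F × ℝ → ℝ) W (𝓝 0) := by
    have : Tendsto (fun p : F × ℝ => (σ p.1, p.2)) W (𝓝 0) := by
      have h3 : Tendsto (fun p : F × ℝ => (σ p.1, p.2)) W U := by
        rw [← hmap]; exact tendsto_map
      exact h3.mono_right hU
    have h4 : Tendsto (Prod.snd : E × ℝ → ℝ) (𝓝 0) (𝓝 0) := continuous_snd.tendsto' _ _ rfl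
    exact h4.comp this
  have := t1.prodMk_nhds t2
  exact this

end

variable {ι : Type*} [Fintype ι] [DecidableEq ι]

lemma ultra_sign (U : Ultrafilter (ι → ℝ)) (i : ι) :
    ∃ ε : ℝ, ε ≠ 0 ∧ ∀ᶠ x in (U : Filter (ι → ℝ)), ε * |x i| = x i := by
  by_cases h : ∀ᶠ x in (U : Filter (ι → ℝ)), 0 ≤ x i
  · refine ⟨1, by norm_num, ?_⟩
    filter_upwards [h] with x hx
    rw [abs_of_nonneg hx, one_mul]
  · refine ⟨-1, by norm_num, ?_⟩
    rw [← Ultrafilter.eventually_not] at h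
    filter_upwards [h] with x hx
    rw [abs_of_neg (not_le.1 hx)]; ring

lemma root_tendsto {U : Ultrafilter (ι → ℝ)} (hU : (U : Filter (ι → ℝ)) ≤ 𝓝 0) (i : ι) (p : ℕ) (hp : p ≠ 0) :
    Tendsto (fun x : ι → ℝ => |x i| ^ ((p : ℝ)⁻¹)) U (𝓝 0) := by
  have hp' : (0:ℝ) < (p:ℝ)⁻¹ := by positivity
  have : Continuous (fun x : ι → ℝ => |x i| ^ ((p : ℝ)⁻¹)) :=
    Continuous.rpow_const (by fun_prop) (fun x => Or.inr hp'.le)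
  exact (this.tendsto' 0 0 (by simp [Real.zero_rpow hp'.ne'])).mono_left hU

lemma root_pow (a : ℝ) (p : ℕ) (hp : p ≠ 0) : (|a| ^ ((p : ℝ)⁻¹)) ^ p = |a| :=
  Real.rpow_inv_natCast_pow (abs_nonneg a) hp

lemma power_map {U : Ultrafilter (ι → ℝ)} (hU : (U : Filter (ι → ℝ)) ≤ 𝓝 0) (N : ℕ) (hN : N ≠ 0) :
    ∃ (A : ι → ι → ℕ) (π : (ι → ℝ) → (ι → ℝ)) (V : Ultrafilter (ι → ℝ)), Pull U π V ∧ MonMap A π ∧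
      ∀ α, act A α = N • α := by
  choose ε hε0 hε using ultra_sign U
  have hM : MonMap (fun i => N • Pi.single i 1) (fun (z : ι → ℝ) i => ε i * z i ^ N) := by
    intro i
    have h1 : MUe 0 (fun _ : ι → ℝ => ε i) := MUe.unit analyticAt_const (hε0 i)
    have := h1.mul ((MonMap_id (ι := ι) i).pow N)
    rwa [zero_add] at this
  have h0 : (fun i => ε i * (0 : ι → ℝ) i ^ N) = 0 := by ext i; simp [hN]
  refine ⟨fun i => N • Pi.single i 1, fun z i => ε i * z i ^ N, _,
    Pull.of_section (fun x i => |x i| ^ ((N : ℝ)⁻¹)) hM.analytic h0 ?_ ?_, hM, ?_⟩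
  · exact tendsto_pi_nhds.2 fun i => root_tendsto hU i N hN
  · filter_upwards [(Filter.eventually_all).2 hε] with x hx
    ext i
    rw [root_pow _ _ hN, hx]
  · intro α; ext k
    simp [act_apply, Pi.single_apply, mul_comm]

/-- Exponent matrix of the weighted blow-up chart. -/
def chartA (i j : ι) (p q b : ℕ) : ι → ι → ℕ := fun k =>
  if k = i then p • Pi.single i 1 else if k = j then q • Pi.single i 1 + b • Pi.single j 1 else Pi.single k 1

lemma chart_act_i {i j : ι} (hij : i ≠ j) (p q b : ℕ) (α : ι → ℕ) :
    act (chartA i j p q b) α i = α i * p + α j * q := by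
  rw [act_apply, Finset.sum_eq_add i j hij]
  · simp [chartA, hij, hij.symm]
  · rintro c - ⟨h1, h2⟩; simp [chartA, h1, h2, Pi.single_apply, h1.symm]
  · simp
  · simp

lemma chart_act_j {i j : ι} (hij : i ≠ j) (p q b : ℕ) (α : ι → ℕ) :
    act (chartA i j p q b) α j = α j * b := by
  rw [act_apply, Finset.sum_eq_single j]
  · simp [chartA, hij.symm]
  · intro c _ h1
    by_cases h2 : c = i
    · simp [chartA, h2, Pi.single_apply, hij.symm]
    · simp [chartA, h1, h2, Pi.single_apply, h1.symm]
  · simp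

lemma chart_act_k {i j k : ι} (hi : k ≠ i) (hj : k ≠ j) (p q b : ℕ) (α : ι → ℕ) :
    act (chartA i j p q b) α k = α k := by
  rw [act_apply, Finset.sum_eq_single k]
  · simp [chartA, hi, hj]
  · intro c _ h1
    by_cases h2 : c = i
    · simp [chartA, h2, hi]
    · by_cases h3 : c = j
      · subst h3
        simp [chartA, h2, hi, hj]
      · simp [chartA, h2, h3, Pi.single_apply, h1.symm]
  · simp

lemma chart {U : Ultrafilter (ι → ℝ)} (hU : (U : Filter (ι → ℝ)) ≤ 𝓝 0) {i j : ι} (hij : i ≠ j) (p q : ℕ)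
    (hp : p ≠ 0) (hq : q ≠ 0) (h : ∀ᶠ x in (U : Filter (ι → ℝ)), |x j| ^ p ≤ |x i| ^ q) :
    ∃ (b : ℕ) (π : (ι → ℝ) → (ι → ℝ)) (V : Ultrafilter (ι → ℝ)), Pull U π V ∧ MonMap (chartA i j p q b) π := by
  obtain ⟨ε, hε0, hε⟩ := ultra_sign U i
  set w : (ι → ℝ) → ℝ := fun x => |x i| ^ ((p : ℝ)⁻¹) with hw
  set v : (ι → ℝ) → ℝ := fun x => x j / w x ^ q with hv
  have hwp : ∀ x, w x ^ p = |x i| := fun x => root_pow _ _ hp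
  have hw0 : ∀ x, 0 ≤ w x := fun x => by positivity
  have hle : ∀ᶠ x in (U : Filter (ι → ℝ)), |x j| ≤ w x ^ q := by
    filter_upwards [h] with x hx
    rw [← hwp, ← pow_mul, mul_comm, pow_mul] at hx
    exact (pow_le_pow_iff_left₀ (abs_nonneg _) (pow_nonneg (hw0 x) _) hp).1 hx
  have hv1 : ∀ᶠ x in (U : Filter (ι → ℝ)), v x ∈ Set.Icc (-1:ℝ) 1 := by
    filter_upwards [hle] with x hx
    rw [Set.mem_Icc, ← abs_le]
    change |x j / w x ^ q| ≤ 1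
    rw [abs_div, abs_of_nonneg (pow_nonneg (hw0 x) q)]
    exact div_le_one_of_le₀ hx (pow_nonneg (hw0 x) q)
  obtain ⟨v0, -, hv0⟩ := isCompact_Icc.ultrafilter_le_nhds (U.map v) (le_principal_iff.2 hv1)
  have hv0' : Tendsto v U (𝓝 v0) := hv0
  set π : (ι → ℝ) → (ι → ℝ) := fun z k => if k = i then ε * z i ^ p else if k = j then z i ^ q * (z j + v0) else z k with hπ
  let b : ℕ := if v0 = 0 then 1 else 0
  have hM : MonMap (chartA i j p q b) π := by
    intro k
    by_cases hk : k = i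
    · subst hk
      have h1 : MUe 0 (fun _ : ι → ℝ => ε) := MUe.unit analyticAt_const hε0
      have := h1.mul ((MonMap_id (ι := ι) k).pow p)
      rw [zero_add] at this
      simpa [hπ, chartA] using this
    · by_cases hk2 : k = j
      · subst hk2
        have h1 : MUe (b • Pi.single k 1) (fun z : ι → ℝ => z k + v0) := by
          by_cases hz : v0 = 0
          · simpa [b, hz] using MonMap_id (ι := ι) k
          · simpa [b, hz] using MUe.unit (u := fun z : ι → ℝ => z k + v0) ((proj_analytic k 0).fun_add analyticAt_const) (by simpa using hz)
        have := ((MonMap_id (ι := ι) i).pow q).mul h1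
        simpa [hπ, chartA, hk] using this
      · simpa [hπ, chartA, hk, hk2] using MonMap_id (ι := ι) k
  have h0 : π 0 = 0 := by
    ext k
    by_cases hk : k = i
    · simp [hπ, hk, hp]
    · by_cases hk2 : k = j <;> simp [hπ, hk, hk2, hq, hij.symm]
  refine ⟨b, π, _, Pull.of_section (fun x k => if k = i then w x else if k = j then v x - v0 else x k)
    hM.analytic h0 ?_ ?_, hM⟩
  · refine tendsto_pi_nhds.2 fun k => ?_
    by_cases hk : k = i
    · simpa [hk] using root_tendsto hU i p hp
    · by_cases hk2 : k = j
      · simpa [hk, hk2, hij.symm] using hv0'.sub_const v0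
      · simp only [hk, hk2, if_false]
        exact ((continuous_apply k).tendsto' (0 : ι → ℝ) 0 rfl).mono_left hU
  · filter_upwards [hε, hle] with x hx hx2
    ext k
    by_cases hk : k = i
    · simp [hπ, hk, hwp, hx]
    · by_cases hk2 : k = j
      · subst hk2
        simp only [hπ, hk, if_false, if_true, hv, sub_add_cancel]
        by_cases hz : w x ^ q = 0
        · rw [hz] at hx2
          rw [hz, zero_mul]
          exact (abs_nonpos_iff.1 hx2).symm
        · exact mul_div_cancel₀ _ hz
      · simp [hπ, hk, hk2]

lemma chart_measure {i j : ι} (hij : i ≠ j) (p q b : ℕ) (α β : ι → ℕ) (hne : α i ≠ β i)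
    (he : α i * p + α j * q = β i * p + β j * q) :
    (Finset.univ.filter fun k => act (chartA i j p q b) α k ≠ act (chartA i j p q b) β k).card <
      (Finset.univ.filter fun k => α k ≠ β k).card := by
  apply Finset.card_lt_card
  rw [Finset.ssubset_iff_of_subset]
  · refine ⟨i, by simpa using hne, ?_⟩
    simp [chart_act_i hij, he]
  · intro k
    simp only [Finset.mem_filter, Finset.mem_univ, true_and]
    by_cases hk : k = i
    · subst hk; simp [chart_act_i hij, he]
    · by_cases hk2 : k = j
      · subst hk2
        rw [chart_act_j hij, chart_act_j hij]
        intro h h'; rw [h'] at h; exact h rfl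
      · rw [chart_act_k hk hk2, chart_act_k hk hk2]; exact id

/-- Any two monomials become comparable along an ultrafilter after a monomial map. -/
theorem compare (N : ℕ) : ∀ {U : Ultrafilter (ι → ℝ)} (_ : (U : Filter (ι → ℝ)) ≤ 𝓝 0) (α β : ι → ℕ)
    (_ : (Finset.univ.filter fun k => α k ≠ β k).card ≤ N),
    ∃ (A : ι → ι → ℕ) (π : (ι → ℝ) → (ι → ℝ)) (V : Ultrafilter (ι → ℝ)), Pull U π V ∧ MonMap A π ∧
      (act A α ≤ act A β ∨ act A β ≤ act A α) := by
  induction N with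
  | zero =>
    intro U hU α β hN
    refine ⟨_, _, U, Pull.id hU, MonMap_id, Or.inl ?_⟩
    rw [act_id, act_id]
    simp [Finset.filter_eq_empty_iff] at hN
    intro k; exact (@hN k).le
  | succ N ih =>
    intro U hU α β hN
    by_cases hab : α ≤ β ∨ β ≤ α
    · exact ⟨_, _, U, Pull.id hU, MonMap_id, by rwa [act_id, act_id]⟩
    · rw [not_or] at hab
      obtain ⟨h1, h2⟩ := hab
      simp only [Pi.le_def, not_forall, not_le] at h1 h2
      obtain ⟨i, hi⟩ := h1
      obtain ⟨j, hj⟩ := h2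
      have hij : i ≠ j := by rintro rfl; omega
      set p := β j - α j with hp
      set q := α i - β i with hq
      have hp0 : p ≠ 0 := by omega
      have hq0 : q ≠ 0 := by omega
      have he : α i * p + α j * q = β i * p + β j * q := by
        have e1 : α i = β i + q := by omega
        have e2 : β j = α j + p := by omega
        rw [e1, e2]; ring
      have main : ∃ (A : ι → ι → ℕ) (π : (ι → ℝ) → (ι → ℝ)) (V : Ultrafilter (ι → ℝ)), Pull U π V ∧ MonMap A π ∧
          (Finset.univ.filter fun k => act A α k ≠ act A β k).card < (Finset.univ.filter fun k => α k ≠ β k).card := by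
        by_cases hc : ∀ᶠ x in (U : Filter (ι → ℝ)), |x j| ^ p ≤ |x i| ^ q
        · obtain ⟨b, π, V, hV, hM⟩ := chart hU hij p q hp0 hq0 hc
          exact ⟨_, π, V, hV, hM, chart_measure hij p q b α β (by omega) he⟩
        · rw [← Ultrafilter.eventually_not] at hc
          obtain ⟨b, π, V, hV, hM⟩ := chart hU hij.symm q p hq0 hp0 (hc.mono fun x hx => (not_le.1 hx).le)
          exact ⟨_, π, V, hV, hM, chart_measure hij.symm q p b α β (by omega) (by omega)⟩
      obtain ⟨A, π, V, hV, hM, hlt⟩ := main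
      obtain ⟨B, σ, W, hW, hM', hcmp⟩ := ih hV.le (act A α) (act A β) (by omega)
      exact ⟨_, _, W, hV.comp hW, hM.comp hM' hW.zero, by rwa [act_act, act_act]⟩

/-- A finite nonempty family of monomials gets a divisibility-minimal element. -/
theorem compare_family {τ : Type*} (s : Finset τ) (hs : s.Nonempty) (α : τ → ι → ℕ)
    {U : Ultrafilter (ι → ℝ)} (hU : (U : Filter (ι → ℝ)) ≤ 𝓝 0) :
    ∃ (A : ι → ι → ℕ) (π : (ι → ℝ) → (ι → ℝ)) (V : Ultrafilter (ι → ℝ)), Pull U π V ∧ MonMap A π ∧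
      ∃ t₀ ∈ s, ∀ t ∈ s, act A (α t₀) ≤ act A (α t) := by
  classical
  induction hs using Finset.Nonempty.cons_induction with
  | singleton a => exact ⟨_, _, U, Pull.id hU, MonMap_id, a, by simp, by simp⟩
  | cons a s ha hs ih =>
    obtain ⟨A, π, V, hV, hM, t₀, ht₀, hmin⟩ := ih
    obtain ⟨B, σ, W, hW, hM', hcmp⟩ := compare _ hV.le (act A (α a)) (act A (α t₀)) le_rfl
    refine ⟨_, _, W, hV.comp hW, hM.comp hM' hW.zero, ?_⟩
    simp only [act_act]
    rcases hcmp with h | h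
    · refine ⟨a, by simp, fun t ht => ?_⟩
      rcases Finset.mem_cons.1 ht with rfl | ht
      · exact le_rfl
      · exact h.trans (act_mono _ (hmin t ht))
    · refine ⟨t₀, by simp [ht₀], fun t ht => ?_⟩
      rcases Finset.mem_cons.1 ht with rfl | ht
      · exact h
      · exact act_mono _ (hmin t ht)

end
end LU
open Filter Topology
namespace LU
noncomputable section

/-- `f` becomes a monomial times a unit along some lift of `U`. -/
def Good {n : ℕ} (U : Ultrafilter ((Fin n → ℝ) × ℝ)) (f : (Fin n → ℝ) × ℝ → ℝ) : Prop :=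
  ∃ (π : (Fin (n+1) → ℝ) → (Fin n → ℝ) × ℝ) (V : Ultrafilter (Fin (n+1) → ℝ)) (α : Fin (n+1) → ℕ),
    Pull U π V ∧ MUe α (fun x => f (π x))

lemma Good.of_pull {n : ℕ} {U V : Ultrafilter ((Fin n → ℝ) × ℝ)} {f π} (h : Pull U π V)
    (hg : Good V (fun p => f (π p))) : Good U f := by
  obtain ⟨σ, W, α, hW, hM⟩ := hg
  exact ⟨_, W, α, h.comp hW, hM⟩

lemma Good.congr {n : ℕ} {U : Ultrafilter ((Fin n → ℝ) × ℝ)} {f g : (Fin n → ℝ) × ℝ → ℝ}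
    (hg : Good U g) (h : ∀ᶠ p in 𝓝 0, f p = g p) : Good U f := by
  obtain ⟨σ, W, α, hW, hM⟩ := hg
  exact ⟨σ, W, α, hW, hM.congr ((an_tendsto hW.an hW.zero).eventually h)⟩

/-- The coordinate change to `n+1` variables. -/
def split {n : ℕ} (x : Fin (n+1) → ℝ) : (Fin n → ℝ) × ℝ := (fun i => x i.succ, x 0)

lemma split_tail {n : ℕ} : MonMap (fun i : Fin n => Pi.single i.succ 1) (fun (x : Fin (n+1) → ℝ) (i : Fin n) => x i.succ) :=
  fun i => (MUe.monomial _).congr (by simp [mon_single])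

lemma split_analytic {n : ℕ} : AnalyticAt ℝ (split (n := n)) 0 :=
  (split_tail.analytic).prod (proj_analytic 0 0)

lemma split_zero {n : ℕ} : split (0 : Fin (n+1) → ℝ) = 0 := rfl

lemma to_split {n : ℕ} {U : Ultrafilter ((Fin n → ℝ) × ℝ)} (hU : (U : Filter ((Fin n → ℝ) × ℝ)) ≤ 𝓝 0) :
    ∃ V, Pull U (split (n := n)) V := by
  refine ⟨_, Pull.of_section (fun p => Fin.cons p.2 p.1) split_analytic split_zero ?_ ?_⟩
  · refine tendsto_pi_nhds.2 fun i => ?_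
    refine Tendsto.mono_left ?_ hU
    induction i using Fin.cases with
    | zero =>
      simp only [Fin.cons_zero]
      exact continuous_snd.tendsto' _ _ rfl
    | succ i =>
      simp only [Fin.cons_succ]
      have : Continuous (fun p : (Fin n → ℝ) × ℝ => p.1 i) := by fun_prop
      exact this.tendsto' _ _ rfl
  · exact Eventually.of_forall fun p => by simp [split]

lemma good_simple {n : ℕ} {U : Ultrafilter ((Fin n → ℝ) × ℝ)} (hU : (U : Filter ((Fin n → ℝ) × ℝ)) ≤ 𝓝 0)
    {M : (Fin n → ℝ) → ℝ} {μ} (hM : MUe μ M) (d : ℕ) {u : (Fin n → ℝ) × ℝ → ℝ} (hu : AnalyticAt ℝ u 0)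
    (hu0 : u 0 ≠ 0) : Good U (fun p => M p.1 * (p.2 ^ d * u p)) := by
  obtain ⟨V, hV⟩ := to_split hU
  refine ⟨split, V, _, hV, (hM.pullback split_tail rfl).mul ((((MonMap_id 0).pow d)).mul
    (MUe.unit (u := fun x => u (split x)) (an_comp hu split_analytic split_zero) (by rw [split_zero]; exact hu0)))⟩

/-- Divisibility of monomial-times-unit germs. -/
lemma MUe.div {ι : Type*} [Fintype ι] {α β : ι → ℕ} {f g : (ι → ℝ) → ℝ} (hf : MUe α f) (hg : MUe β g) (h : α ≤ β) :
    ∃ w : (ι → ℝ) → ℝ, AnalyticAt ℝ w 0 ∧ ∀ᶠ x in 𝓝 0, g x = f x * w x := by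
  obtain ⟨u, a, b, c⟩ := hf
  obtain ⟨u', a', b', c'⟩ := hg
  refine ⟨fun x => mon (β - α) x * (u' x / u x), (mon_analytic _ 0).fun_mul (a'.fun_div a b), ?_⟩
  filter_upwards [c, c', a.continuousAt.eventually_ne b] with x h1 h2 h3
  have : mon β x = mon α x * mon (β - α) x := by
    rw [← mon_add]; congr 1; ext i; exact (Nat.add_sub_of_le (h i)).symm
  rw [h1, h2, this]; field_simp

lemma bound_of_div {n : ℕ} {U : Ultrafilter ((Fin n → ℝ) × ℝ)} {κ : Type*} [Fintype κ]
    {π : (κ → ℝ) → (Fin n → ℝ) × ℝ} {V} (hV : Pull U π V) {γ : Fin n → ℕ} {w : (κ → ℝ) → ℝ} (hw : AnalyticAt ℝ w 0)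
    (h : ∀ᶠ x in 𝓝 0, (π x).2 = mon γ (π x).1 * w x) :
    ∃ C : ℝ, ∀ᶠ p in (U : Filter ((Fin n → ℝ) × ℝ)), |p.2| ≤ C * |mon γ p.1| := by
  refine ⟨|w 0| + 1, hV.eventually.2 (Filter.Eventually.filter_mono hV.le ?_)⟩
  have : ∀ᶠ x in 𝓝 0, |w x| < |w 0| + 1 := hw.continuousAt.abs.eventually_lt continuousAt_const (by simp)
  filter_upwards [h, this] with x h1 h2
  rw [h1, abs_mul, mul_comm]
  gcongr

/-- The region where the last variable dominates. -/
lemma regionB {n : ℕ} {U : Ultrafilter ((Fin n → ℝ) × ℝ)} (hU : (U : Filter ((Fin n → ℝ) × ℝ)) ≤ 𝓝 0)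
    {M : (Fin n → ℝ) → ℝ} {μ} (hM : MUe μ M) (d : ℕ) {u : (Fin n → ℝ) × ℝ → ℝ} (hu : AnalyticAt ℝ u 0)
    (hu0 : u 0 ≠ 0) (c : ℕ → (Fin n → ℝ) → ℝ) (hc : ∀ i, AnalyticAt ℝ (c i) 0) (γ : Fin n → ℕ)
    (hno : ¬ ∃ C : ℝ, ∀ᶠ p in (U : Filter ((Fin n → ℝ) × ℝ)), |p.2| ≤ C * |mon γ p.1|) :
    Good U (fun p => M p.1 * (∑ i ∈ Finset.range d, mon γ p.1 ^ (d - i) * c i p.1 * p.2 ^ i + p.2 ^ d * u p)) := by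
  obtain ⟨V, hV⟩ := to_split hU
  have hγ : MUe _ (fun x : Fin (n+1) → ℝ => mon γ (split x).1) := (MUe.monomial γ).pullback split_tail rfl
  have ht : MUe (Pi.single 0 1) (fun x : Fin (n+1) → ℝ => (split x).2) := MonMap_id 0
  obtain ⟨A, σ, W, hW, hMM, hcmp⟩ := compare _ hV.le _ _ le_rfl
  have hγ2 := hγ.pullback hMM hW.zero
  have ht2 := ht.pullback hMM hW.zero
  have hM2 := (hM.pullback split_tail rfl).pullback hMM hW.zero
  have hP := hV.comp hW
  rcases hcmp with h | h
  · obtain ⟨w, hw, hwe⟩ := hγ2.div ht2 h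
    exact absurd (bound_of_div hP hw hwe) hno
  · obtain ⟨w, hw, hwe⟩ := ht2.div hγ2 h
    have hw0 : w 0 = 0 := by
      by_contra hne
      apply hno
      refine bound_of_div hP (hw.inv hne) ?_
      filter_upwards [hwe, hw.continuousAt.eventually_ne hne] with x h1 h2
      rw [h1, Pi.inv_apply]; field_simp
    have hs1 : AnalyticAt ℝ (fun x => (split (σ x)).1) 0 := analyticAt_fst.fun_comp hP.an
    have hs0 : (split (σ 0)).1 = 0 := by rw [hP.zero]; rfl
    have han : AnalyticAt ℝ (fun x => ∑ i ∈ Finset.range d, c i (split (σ x)).1 * w x ^ (d - i) + u (split (σ x))) 0 :=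
      (Finset.analyticAt_fun_sum _ fun i _ => (an_comp (hc i) hs1 hs0).fun_mul (hw.fun_pow _)).fun_add (an_comp hu hP.an hP.zero)
    refine ⟨_, W, _, hP, (hM2.mul ((ht2.pow d).mul (MUe.unit han ?_))).congr ?_⟩
    · rw [hP.zero, hw0, Finset.sum_eq_zero, zero_add]
      · exact hu0
      · intro i hi
        have := Finset.mem_range.1 hi
        rw [zero_pow (by omega), mul_zero]
    · filter_upwards [hwe] with x hx
      simp only [hx]
      change _ * _ = M (split (σ x)).1 * _
      congr 1
      rw [mul_add, Finset.mul_sum]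
      congr 1
      refine Finset.sum_congr rfl fun i hi => ?_
      have := Finset.mem_range.1 hi
      have e : (split (σ x)).2 ^ d = (split (σ x)).2 ^ (d - i) * (split (σ x)).2 ^ i := by
        rw [← pow_add]; congr 1; omega
      rw [e]; ring

lemma poly_ne (d : ℕ) (a : ℕ → ℝ) (s0 u0 : ℝ) (hu0 : u0 ≠ 0) (hd : a (d - 1) = 0) (i₀ : ℕ) (hi₀ : i₀ < d)
    (ha : a i₀ ≠ 0) :
    ∃ k < d, iteratedDeriv k (fun s : ℝ => ∑ i ∈ Finset.range d, a i * (s + s0) ^ i + (s + s0) ^ d * u0) 0 ≠ 0 := by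
  classical
  by_contra hcon
  push Not at hcon
  let P : Polynomial ℝ := ∑ i ∈ Finset.range d, Polynomial.C (a i) * Polynomial.X ^ i + Polynomial.C u0 * Polynomial.X ^ d
  have hP : (fun s : ℝ => ∑ i ∈ Finset.range d, a i * (s + s0) ^ i + (s + s0) ^ d * u0) =
      fun s => (Polynomial.taylor s0 P).eval s := by
    ext s
    rw [Polynomial.taylor_eval]
    simp [P, Polynomial.eval_finsetSum]
    ring
  have hcoef : ∀ k, P.coeff k = (if k < d then a k else 0) + if k = d then u0 else 0 := by
    intro k
    simp [P, Polynomial.finsetSum_coeff, Polynomial.coeff_C_mul, Polynomial.coeff_X_pow]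
  rw [hP] at hcon
  have hk : ∀ k < d, (Polynomial.taylor s0 P).coeff k = 0 := by
    intro k hk
    have h1 := hcon k hk
    have h2 : ∀ (Q : Polynomial ℝ) (k : ℕ), iteratedDeriv k (fun s => Q.eval s) =
        fun s => (Polynomial.derivative^[k] Q).eval s := by
      intro Q k
      induction k with
      | zero => simp
      | succ k ih =>
        rw [iteratedDeriv_succ, ih]
        ext s
        rw [Polynomial.deriv, Function.iterate_succ_apply']
    rw [h2] at h1
    simp only at h1
    rw [← Polynomial.coeff_zero_eq_eval_zero, Polynomial.coeff_iterate_derivative] at h1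
    simp only [zero_add, Nat.descFactorial_self, nsmul_eq_mul, mul_eq_zero, Nat.cast_eq_zero] at h1
    exact h1.resolve_left (Nat.factorial_ne_zero k)
  have hdeg : P.natDegree = d := by
    apply Polynomial.natDegree_eq_of_le_of_coeff_ne_zero
    · rw [Polynomial.natDegree_le_iff_coeff_eq_zero]
      intro N hN
      rw [hcoef, if_neg (by omega), if_neg (by omega), add_zero]
    · rw [hcoef]; simpa using hu0
  have hT : Polynomial.taylor s0 P = Polynomial.C u0 * Polynomial.X ^ d := by
    ext k
    rw [Polynomial.coeff_C_mul, Polynomial.coeff_X_pow]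
    rcases lt_trichotomy k d with h | h | h
    · rw [hk k h, if_neg h.ne, mul_zero]
    · rw [if_pos h, h]
      have h3 := Polynomial.coeff_taylor_natDegree (r := s0) (f := P)
      rw [Polynomial.leadingCoeff, hdeg, hcoef] at h3
      simpa using h3
    · rw [if_neg h.ne', mul_zero]
      apply Polynomial.coeff_eq_zero_of_natDegree_lt
      rwa [Polynomial.natDegree_taylor, hdeg]
  have hPe : P = Polynomial.C u0 * (Polynomial.X + Polynomial.C (-s0)) ^ d := by
    have h3 := congrArg (Polynomial.taylor (-s0)) hT
    rwa [Polynomial.taylor_taylor, neg_add_cancel, Polynomial.taylor_zero, Polynomial.taylor_mul,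
      Polynomial.taylor_C, Polynomial.taylor_X_pow] at h3
  have hs0 : s0 = 0 := by
    have h1 := hcoef (d-1)
    rw [hPe, Polynomial.coeff_C_mul, Polynomial.coeff_X_add_C_pow] at h1
    have e : d - (d-1) = 1 := by omega
    rw [if_pos (by omega), if_neg (by omega), hd, e] at h1
    have e2 : d.choose (d-1) = d := by rw [Nat.choose_symm (by omega)]; simp
    rw [e2] at h1
    have hd0 : (d : ℝ) ≠ 0 := by exact_mod_cast (by omega : d ≠ 0)
    simpa [hu0, hd0] using h1
  have h1 := hcoef i₀
  rw [hPe, hs0, if_pos hi₀, if_neg hi₀.ne] at h1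
  simp [Polynomial.coeff_X_pow, hi₀.ne] at h1
  exact ha h1.symm

end
end LU
open Filter Topology
namespace LU
noncomputable section

/-- Statement of the order-`d` step. -/
def SP (n d : ℕ) : Prop := ∀ (M : (Fin n → ℝ) → ℝ) (h : (Fin n → ℝ) × ℝ → ℝ) (U : Ultrafilter ((Fin n → ℝ) × ℝ)),
  AnalyticAt ℝ M 0 → (¬ ∀ᶠ x in 𝓝 0, M x = 0) → AnalyticAt ℝ h 0 → D^[d] h 0 ≠ 0 →
  (U : Filter ((Fin n → ℝ) × ℝ)) ≤ 𝓝 0 → Good U (fun p => M p.1 * h p)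

/-- The region where the monomial dominates: the order drops. -/
lemma regionA {n : ℕ} {U : Ultrafilter ((Fin n → ℝ) × ℝ)} (hU : (U : Filter ((Fin n → ℝ) × ℝ)) ≤ 𝓝 0)
    {M : (Fin n → ℝ) → ℝ} {μ} (hM : MUe μ M) (d : ℕ) (IH : ∀ k < d, SP n k)
    {u : (Fin n → ℝ) × ℝ → ℝ} (hu : AnalyticAt ℝ u 0)
    (hu0 : u 0 ≠ 0) (c : ℕ → (Fin n → ℝ) → ℝ) (hc : ∀ i, AnalyticAt ℝ (c i) 0) (γ : Fin n → ℕ) (hγ : γ ≠ 0)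
    (hd : c (d - 1) 0 = 0) (i₀ : ℕ) (hi₀ : i₀ < d) (hci : c i₀ 0 ≠ 0) (C : ℝ)
    (hC : ∀ᶠ p in (U : Filter ((Fin n → ℝ) × ℝ)), |p.2| ≤ C * |mon γ p.1|) :
    Good U (fun p => M p.1 * (∑ i ∈ Finset.range d, mon γ p.1 ^ (d - i) * c i p.1 * p.2 ^ i + p.2 ^ d * u p)) := by
  set v : (Fin n → ℝ) × ℝ → ℝ := fun p => p.2 / mon γ p.1 with hv
  have hv1 : ∀ᶠ x in (U : Filter ((Fin n → ℝ) × ℝ)), v x ∈ Set.Icc (-|C|) |C| := by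
    filter_upwards [hC] with x hx
    rw [Set.mem_Icc, ← abs_le]
    change |x.2 / mon γ x.1| ≤ |C|
    rw [abs_div]
    refine div_le_of_le_mul₀ (abs_nonneg _) (abs_nonneg _) (hx.trans ?_)
    gcongr
    exact le_abs_self C
  obtain ⟨s0, -, hs0⟩ := isCompact_Icc.ultrafilter_le_nhds (U.map v) (le_principal_iff.2 hv1)
  have hs0' : Tendsto v U (𝓝 s0) := hs0
  have hmon : AnalyticAt ℝ (fun p : (Fin n → ℝ) × ℝ => mon γ p.1) 0 := an_comp (mon_analytic γ 0) analyticAt_fst rfl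
  have hs : AnalyticAt ℝ (fun p : (Fin n → ℝ) × ℝ => p.2 + s0) 0 := analyticAt_snd.fun_add analyticAt_const
  have hsig : AnalyticAt ℝ (fun p : (Fin n → ℝ) × ℝ => (p.1, mon γ p.1 * (p.2 + s0))) 0 :=
    analyticAt_fst.prod (hmon.fun_mul hs)
  have hsig0 : (fun p : (Fin n → ℝ) × ℝ => (p.1, mon γ p.1 * (p.2 + s0))) 0 = 0 := by
    simp [mon_at_zero hγ]
  have hV : Pull U (fun p : (Fin n → ℝ) × ℝ => (p.1, mon γ p.1 * (p.2 + s0))) _ :=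
    Pull.of_section (fun p => (p.1, v p - s0)) hsig hsig0 (by
      have h1 : Tendsto (fun p : (Fin n → ℝ) × ℝ => p.1) U (𝓝 0) :=
        (continuous_fst.tendsto' 0 0 rfl).mono_left hU
      have h2 := hs0'.sub_const s0
      rw [sub_self] at h2
      exact h1.prodMk_nhds h2) (by
      filter_upwards [hC] with p hp
      ext1
      · rfl
      · simp only [sub_add_cancel, hv]
        by_cases hz : mon γ p.1 = 0
        · rw [hz] at hp ⊢
          simp at hp
          simp [hp]
        · exact mul_div_cancel₀ _ hz)
  refine Good.of_pull hV ?_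
  set h1 : (Fin n → ℝ) × ℝ → ℝ := fun p => ∑ i ∈ Finset.range d, c i p.1 * (p.2 + s0) ^ i +
    (p.2 + s0) ^ d * u (p.1, mon γ p.1 * (p.2 + s0)) with hh1
  have h1an : AnalyticAt ℝ h1 0 :=
    (Finset.analyticAt_fun_sum _ fun i _ => (an_comp (hc i) analyticAt_fst rfl).fun_mul (hs.fun_pow _)).fun_add
      ((hs.fun_pow d).fun_mul (an_comp hu hsig hsig0))
  obtain ⟨k, hk, hne⟩ := poly_ne d (fun i => c i 0) s0 (u 0) hu0 hd i₀ hi₀ hci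
  have hM' : MUe (μ + d • γ) (fun x => M x * mon γ x ^ d) := hM.mul ((MUe.monomial γ).pow d)
  have hG := IH k hk _ h1 _ hM'.analytic hM'.ne h1an (by
    rw [(slice h1an k).self_of_nhds]
    have hfun : (fun s => h1 ((0 : (Fin n → ℝ) × ℝ).1, s)) =
        fun s : ℝ => ∑ i ∈ Finset.range d, c i 0 * (s + s0) ^ i + (s + s0) ^ d * u 0 := by
      ext s
      have e0 : mon γ (0 : (Fin n → ℝ)) * (s + s0) = 0 := by rw [mon_at_zero hγ, zero_mul]
      simp only [hh1, Prod.fst_zero, e0]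
      rfl
    rw [hfun]
    exact hne) hV.le
  refine hG.congr (Eventually.of_forall fun p => ?_)
  simp only [hh1]
  rw [mul_assoc]
  congr 1
  rw [mul_add (mon γ p.1 ^ d), Finset.mul_sum]
  congr 1
  · refine Finset.sum_congr rfl fun i hi => ?_
    have := Finset.mem_range.1 hi
    have e : mon γ p.1 ^ d = mon γ p.1 ^ (d - i) * mon γ p.1 ^ i := by
      rw [← pow_add]; congr 1; omega
    rw [e, mul_pow]; ring
  · rw [mul_pow]; ring

lemma MUe.ne_zero_of_exp {ι : Type*} [Fintype ι] {f : (ι → ℝ) → ℝ} (h : MUe 0 f) : f 0 ≠ 0 := by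
  obtain ⟨u, a, b, c⟩ := h
  rw [c.self_of_nhds, mon_zero, one_mul]; exact b

/-- The step once all coefficients are monomials times units. -/
lemma step3 {n : ℕ} {U : Ultrafilter ((Fin n → ℝ) × ℝ)} (hU : (U : Filter ((Fin n → ℝ) × ℝ)) ≤ 𝓝 0)
    {M : (Fin n → ℝ) → ℝ} {μ} (hM : MUe μ M) (d : ℕ) (IH : ∀ k < d, SP n k)
    {u : (Fin n → ℝ) × ℝ → ℝ} (hu : AnalyticAt ℝ u 0)
    (hu0 : u 0 ≠ 0) (c : ℕ → (Fin n → ℝ) → ℝ) (T : Finset ℕ) (hT : ∀ i ∈ T, i < d) (α : ℕ → Fin n → ℕ)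
    (hcT : ∀ i ∈ T, MUe (α i) (c i)) (hcT' : ∀ i < d, i ∉ T → ∀ᶠ x in 𝓝 0, c i x = 0) (hc0 : ∀ i ∈ T, c i 0 = 0)
    (hd : d - 1 ∉ T) :
    Good U (fun p => M p.1 * (∑ i ∈ Finset.range d, c i p.1 * p.2 ^ i + p.2 ^ d * u p)) := by
  classical
  have tfst : Tendsto (fun p : (Fin n → ℝ) × ℝ => p.1) (𝓝 0) (𝓝 0) := continuous_fst.tendsto' 0 0 rfl
  rcases T.eq_empty_or_nonempty with rfl | hne
  · refine (good_simple hU hM d hu hu0).congr ?_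
    have : ∀ᶠ x in 𝓝 (0 : Fin n → ℝ), ∀ i ∈ Finset.range d, c i x = 0 :=
      (Filter.eventually_all_finset _).2 fun i hi => hcT' i (Finset.mem_range.1 hi) (by simp)
    filter_upwards [tfst.eventually this] with p hp
    rw [Finset.sum_eq_zero, zero_add]
    intro i hi; rw [hp i hi, zero_mul]
  have hU1 : ((U.map Prod.fst : Ultrafilter (Fin n → ℝ)) : Filter (Fin n → ℝ)) ≤ 𝓝 0 := tfst.mono_left hU
  obtain ⟨A, π, V, hV, hA, i₀, hi₀, hmin⟩ := compare_family T hne (fun i => (d.factorial / (d - i)) • α i) hU1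
  obtain ⟨B, σ, W, hW, hB, hBact⟩ := power_map hV.le d.factorial (Nat.factorial_ne_zero d)
  have hP := hV.comp hW
  have hAB := hA.comp hB hW.zero
  have hi₀d := hT i₀ hi₀
  have hdvd : ∀ i < d, (d - i) * (d.factorial / (d - i)) = d.factorial := fun i hi =>
    Nat.mul_div_cancel' (Nat.dvd_factorial (by omega) (by omega))
  set γ : Fin n → ℕ := (d.factorial / (d - i₀)) • act A (α i₀) with hγ
  have hex : ∀ i ∈ T, MUe (d.factorial • act A (α i)) (fun x => c i (π (σ x))) := by
    intro i hi
    have := (hcT i hi).pullback hAB hP.zero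
    rwa [act_act, hBact] at this
  have hγ0 : (d - i₀) • γ = d.factorial • act A (α i₀) := by
    rw [hγ, ← mul_smul, hdvd i₀ hi₀d]
  have hγi : ∀ i ∈ T, (d - i) • γ ≤ d.factorial • act A (α i) := by
    intro i hi k
    have h1 := hmin i hi k
    rw [act_smul, act_smul] at h1
    have h2 : (d - i) * γ k ≤ (d - i) * ((d.factorial / (d - i)) • act A (α i)) k := Nat.mul_le_mul_left _ h1
    calc ((d - i) • γ) k = (d - i) * γ k := rfl
      _ ≤ _ := h2
      _ = (d - i) * (d.factorial / (d - i)) * act A (α i) k := by simp [mul_assoc]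
      _ = _ := by rw [hdvd i (hT i hi)]; rfl
  have hγne : γ ≠ 0 := by
    intro hz
    have h1 := hex i₀ hi₀
    rw [← hγ0, hz, smul_zero] at h1
    apply h1.ne_zero_of_exp
    rw [hP.zero, hc0 i₀ hi₀]
  have hw : ∀ i, ∃ w : (Fin n → ℝ) → ℝ, AnalyticAt ℝ w 0 ∧
      (i < d → ∀ᶠ x in 𝓝 0, c i (π (σ x)) = mon γ x ^ (d - i) * w x) ∧ (i = i₀ → w 0 ≠ 0) ∧ (i ∉ T → w 0 = 0) := by
    intro i
    by_cases hi : i ∈ T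
    · by_cases hii : i = i₀
      · subst hii
        have h1 := hex i hi
        rw [← hγ0] at h1
        obtain ⟨w, a, b, e⟩ := h1
        exact ⟨w, a, fun _ => by simpa only [mon_smul] using e, fun _ => b, fun h => absurd hi h⟩
      · obtain ⟨w, a, e⟩ := (MUe.monomial ((d - i) • γ)).div (hex i hi) (hγi i hi)
        exact ⟨w, a, fun _ => by simpa only [mon_smul] using e, fun h => absurd h hii, fun h => absurd hi h⟩
    · refine ⟨fun _ => 0, analyticAt_const, fun hid => ?_, fun h => absurd (h ▸ hi₀) hi, fun _ => rfl⟩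
      simp only [mul_zero]
      exact (an_tendsto hP.an hP.zero).eventually (hcT' i hid hi)
  choose w hwan hwe hwi hwT using hw
  obtain ⟨W', hW'⟩ := Pull.prod hU hP
  have hM2 := hM.pullback hAB hP.zero
  have hu2 := an_comp hu hW'.an hW'.zero
  have hu20 : u (π (σ (0 : (Fin n → ℝ) × ℝ).1), (0 : (Fin n → ℝ) × ℝ).2) ≠ 0 := by
    have := hW'.zero
    rw [this]; exact hu0
  refine Good.of_pull hW' ?_
  have hall : ∀ᶠ x in 𝓝 (0 : Fin n → ℝ), ∀ i ∈ Finset.range d, c i (π (σ x)) = mon γ x ^ (d - i) * w i x :=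
    (Filter.eventually_all_finset _).2 fun i hi => hwe i (Finset.mem_range.1 hi)
  refine Good.congr (g := fun p => M (π (σ p.1)) * (∑ i ∈ Finset.range d, mon γ p.1 ^ (d - i) * w i p.1 * p.2 ^ i
    + p.2 ^ d * u (π (σ p.1), p.2))) ?_ ?_
  · by_cases hC : ∃ C : ℝ, ∀ᶠ p in (W' : Filter ((Fin n → ℝ) × ℝ)), |p.2| ≤ C * |mon γ p.1|
    · obtain ⟨C, hC⟩ := hC
      exact regionA hW'.le hM2 d IH hu2 hu20 w hwan γ hγne (hwT _ hd) i₀ hi₀d (hwi _ rfl) C hC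
    · exact regionB hW'.le hM2 d hu2 hu20 w hwan γ hC
  · filter_upwards [tfst.eventually hall] with p hp
    congr 2
    exact Finset.sum_congr rfl fun i hi => by rw [hp i hi]

/-- Local uniformization statement in `n` variables. -/
def LUn (n : ℕ) : Prop := ∀ f : (Fin n → ℝ) → ℝ, AnalyticAt ℝ f 0 → (¬ ∀ᶠ x in 𝓝 0, f x = 0) →
  ∀ U : Ultrafilter (Fin n → ℝ), (U : Filter (Fin n → ℝ)) ≤ 𝓝 0 →
    ∃ (π : (Fin n → ℝ) → (Fin n → ℝ)) (V : Ultrafilter (Fin n → ℝ)) (α : Fin n → ℕ), Pull U π V ∧ MUe α (fun x => f (π x))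

lemma step2 {n d : ℕ} (hLU : LUn n) (IH : ∀ k < d, SP n k) {M : (Fin n → ℝ) → ℝ} {h : (Fin n → ℝ) × ℝ → ℝ}
    {U : Ultrafilter ((Fin n → ℝ) × ℝ)} (hM : AnalyticAt ℝ M 0) (hM0 : ¬ ∀ᶠ x in 𝓝 0, M x = 0)
    (hh : AnalyticAt ℝ h 0) (hd : D^[d] h 0 ≠ 0) (hlt : ∀ k < d, D^[k] h 0 = 0)
    (hd1 : d ≠ 0 → ∀ᶠ x in 𝓝 0, D^[d-1] h (x, 0) = 0)
    (hU : (U : Filter ((Fin n → ℝ) × ℝ)) ≤ 𝓝 0) : Good U (fun p => M p.1 * h p) := by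
  classical
  have tfst : Tendsto (fun p : (Fin n → ℝ) × ℝ => p.1) (𝓝 0) (𝓝 0) := continuous_fst.tendsto' 0 0 rfl
  obtain ⟨v, hv, hexp⟩ := taylor hh (d+1)
  set c : ℕ → (Fin n → ℝ) → ℝ := fun i x => D^[i] h (x, 0) / i.factorial with hc
  have hca : ∀ i, AnalyticAt ℝ (c i) 0 := fun i =>
    (an_comp (f := fun x : Fin n → ℝ => (x, (0:ℝ))) (D_iter_analytic hh i) (analyticAt_id.prod analyticAt_const) rfl).fun_div
      analyticAt_const (by exact_mod_cast Nat.factorial_ne_zero i)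
  set u : (Fin n → ℝ) × ℝ → ℝ := fun p => c d p.1 + p.2 * v p with hu
  have hua : AnalyticAt ℝ u 0 := (an_comp (hca d) analyticAt_fst rfl).fun_add (analyticAt_snd.fun_mul hv)
  have hu0 : u 0 ≠ 0 := by
    simp only [hu, hc, Prod.snd_zero, zero_mul, add_zero, Prod.fst_zero]
    exact div_ne_zero hd (by exact_mod_cast Nat.factorial_ne_zero d)
  have hc0 : ∀ i < d, c i 0 = 0 := fun i hi => by
    have := hlt i hi
    simp only [hc]
    rw [show ((0 : Fin n → ℝ), (0:ℝ)) = 0 from rfl, this, zero_div]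
  set T := (Finset.range d).filter fun i => ¬ ∀ᶠ x in 𝓝 0, c i x = 0 with hT
  have hprod := analytic_prod_ne T c (fun i _ => hca i) (fun i hi => (Finset.mem_filter.1 hi).2)
  have hprodan : ∀ S : Finset ℕ, AnalyticAt ℝ (fun x => ∏ i ∈ S, c i x) 0 := fun S =>
    Finset.analyticAt_fun_prod _ fun i _ => hca i
  have hU1 : ((U.map Prod.fst : Ultrafilter (Fin n → ℝ)) : Filter (Fin n → ℝ)) ≤ 𝓝 0 := tfst.mono_left hU
  obtain ⟨π, V, β, hV, hβ⟩ := hLU (fun x => M x * ∏ i ∈ T, c i x) (hM.fun_mul (hprodan T))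
    (fun hz => (analytic_nzd _ _ hM (hprodan T) hz).elim hM0 hprod) _ hU1
  obtain ⟨μ, hμ⟩ := MUe.factor _ rfl (an_comp hM hV.an hV.zero) (an_comp (hprodan T) hV.an hV.zero) hβ
  have hα : ∀ i, ∃ α, i ∈ T → MUe α (fun x => c i (π x)) := by
    intro i
    by_cases hi : i ∈ T
    · obtain ⟨α, hα⟩ := MUe.factor (f := fun x => c i (π x)) (g := fun x => M (π x) * ∏ j ∈ T.erase i, c j (π x)) _ rfl
        (an_comp (hca i) hV.an hV.zero) ((an_comp hM hV.an hV.zero).fun_mul (an_comp (g := fun x => ∏ j ∈ T.erase i, c j x) (hprodan (T.erase i)) hV.an hV.zero))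
        (hβ.congr (Eventually.of_forall fun x => by
          rw [← Finset.mul_prod_erase T (fun j => c j (π x)) hi]; ring))
      exact ⟨α, fun _ => hα⟩
    · exact ⟨0, fun h => absurd h hi⟩
  choose α hα using hα
  obtain ⟨W, hW⟩ := Pull.prod hU hV
  refine Good.of_pull hW ?_
  have h3 := step3 hW.le hμ d IH (an_comp hua hW.an hW.zero) (by
    have := hW.zero
    rw [this]; exact hu0) (fun i x => c i (π x)) T (fun i hi => Finset.mem_range.1 (Finset.mem_filter.1 hi).1) α hα
    (by
      intro i hi hiT
      have : ∀ᶠ x in 𝓝 0, c i x = 0 := by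
        by_contra hcon
        exact hiT (Finset.mem_filter.2 ⟨Finset.mem_range.2 hi, hcon⟩)
      exact (an_tendsto hV.an hV.zero).eventually this)
    (by
      intro i hi
      rw [hV.zero]; exact hc0 i (Finset.mem_range.1 (Finset.mem_filter.1 hi).1))
    (by
      intro hmem
      have h1 := Finset.mem_filter.1 hmem
      have h2 := Finset.mem_range.1 h1.1
      refine h1.2 ((hd1 (by omega)).mono fun x hx => ?_)
      simp only [hc]; rw [hx, zero_div])
  refine h3.congr ?_
  filter_upwards [(an_tendsto hW.an hW.zero).eventually hexp] with p hp
  rw [hp, Finset.sum_range_succ]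
  simp only [hu, hc]
  ring

theorem SP_all {n : ℕ} (hLU : LUn n) (d : ℕ) : SP n d := by
  induction d using Nat.strong_induction_on with
  | _ d IH =>
  intro M h U hM hM0 hh hd hU
  by_cases hlt : ∀ k < d, D^[k] h 0 = 0
  swap
  · push Not at hlt
    obtain ⟨k, hk, hne⟩ := hlt
    exact IH k hk M h U hM hM0 hh hne hU
  by_cases hd0 : d = 0
  · exact step2 hLU IH hM hM0 hh hd hlt (fun h => absurd hd0 h) hU
  obtain ⟨φ, hφ, hφ0, hφe⟩ := implicit (D_iter_analytic hh (d-1)) (hlt _ (by omega)) (by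
    rw [← Function.iterate_succ_apply' D, show (d-1).succ = d by omega]; exact hd)
  have hS : AnalyticAt ℝ (fun p : (Fin n → ℝ) × ℝ => (p.1, p.2 + φ p.1)) 0 :=
    analyticAt_fst.prod (analyticAt_snd.fun_add (an_comp hφ analyticAt_fst rfl))
  have hS0 : (fun p : (Fin n → ℝ) × ℝ => (p.1, p.2 + φ p.1)) 0 = 0 := by simp [hφ0]
  have hSm : AnalyticAt ℝ (fun p : (Fin n → ℝ) × ℝ => (p.1, p.2 - φ p.1)) 0 :=
    analyticAt_fst.prod (analyticAt_snd.fun_sub (an_comp hφ analyticAt_fst rfl))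
  have hSm0 : (fun p : (Fin n → ℝ) × ℝ => (p.1, p.2 - φ p.1)) 0 = 0 := by simp [hφ0]
  have hV := Pull.of_section (U := U) (fun p : (Fin n → ℝ) × ℝ => (p.1, p.2 - φ p.1)) hS hS0
    ((an_tendsto hSm hSm0).mono_left hU) (Eventually.of_forall fun p => by simp)
  refine Good.of_pull hV ?_
  have hD : ∀ i, D^[i] (fun p => h (p.1, p.2 + φ p.1)) 0 = D^[i] h 0 := fun i => by
    rw [(shift_D hh hφ hφ0 i).self_of_nhds]
    exact congrArg (D^[i] h) hS0
  refine step2 hLU IH hM hM0 (an_comp hh hS hS0) (by rw [hD]; exact hd) (fun k hk => by rw [hD]; exact hlt k hk) ?_ hV.le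
  intro _
  filter_upwards [tendsto_mk0.eventually (shift_D hh hφ hφ0 (d-1)), hφe] with x h1 h2
  rw [h1]
  simpa using h2

end
end LU
open Filter Topology
namespace LU
noncomputable section

lemma LUn_zero : LUn 0 := by
  intro f hf hne U hU
  refine ⟨_, U, 0, Pull.id hU, MUe.unit hf fun h0 => hne ?_⟩
  exact Eventually.of_forall fun x => by rw [Subsingleton.elim x 0, h0]

lemma line_ne {n : ℕ} {f : (Fin n → ℝ) → ℝ} (hf : AnalyticAt ℝ f 0) (hne : ¬ ∀ᶠ x in 𝓝 0, f x = 0) :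
    ∃ y : Fin n → ℝ, ¬ ∀ᶠ t : ℝ in 𝓝 0, f (t • y) = 0 := by
  obtain ⟨r, hr, hball⟩ := Metric.eventually_nhds_iff_ball.1 hf.eventually_analyticAt
  by_contra hcon
  push Not at hcon
  apply hne
  filter_upwards [Metric.ball_mem_nhds (0 : Fin n → ℝ) hr] with y hy
  have han : AnalyticOnNhd ℝ (fun t : ℝ => f (t • y)) (Set.Icc 0 1) := by
    intro t ht
    have h1 : AnalyticAt ℝ f (t • y) := by
      apply hball
      rw [mem_ball_zero_iff, norm_smul, Real.norm_of_nonneg ht.1]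
      rw [mem_ball_zero_iff] at hy
      calc t * ‖y‖ ≤ 1 * ‖y‖ := by gcongr; exact ht.2
        _ < r := by rwa [one_mul]
    exact AnalyticAt.fun_comp h1 (analyticAt_id.fun_smul analyticAt_const)
  have := han.eqOn_zero_of_preconnected_of_eventuallyEq_zero isPreconnected_Icc (z₀ := 0) (by simp) (hcon y)
    (show (1:ℝ) ∈ Set.Icc (0:ℝ) 1 by simp)
  simpa using this

lemma LUn_succ {n : ℕ} (h : LUn n) : LUn (n+1) := by
  intro f hf hne U hU
  by_cases hf0 : f 0 = 0
  swap
  · exact ⟨_, U, 0, Pull.id hU, MUe.unit hf hf0⟩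
  obtain ⟨y, hy⟩ := line_ne hf hne
  have hy0 : y ≠ 0 := by
    rintro rfl
    exact hy (Eventually.of_forall fun t => by rw [smul_zero, hf0])
  obtain ⟨j, hj⟩ := Function.ne_iff.1 hy0
  simp only [Pi.zero_apply] at hj
  set L : (Fin n → ℝ) × ℝ → (Fin (n+1) → ℝ) := fun p i => j.insertNth (α := fun _ => ℝ) 0 p.1 i + p.2 * y i with hL
  have hLan : AnalyticAt ℝ L 0 := by
    refine analyticAt_pi_iff.2 fun i => ?_
    rcases Fin.eq_self_or_eq_succAbove j i with rfl | ⟨k, rfl⟩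
    · simp only [hL, Fin.insertNth_apply_same]
      exact analyticAt_const.fun_add (analyticAt_snd.fun_mul analyticAt_const)
    · simp only [hL, Fin.insertNth_apply_succAbove]
      exact (an_comp (proj_analytic k 0) analyticAt_fst rfl).fun_add (analyticAt_snd.fun_mul analyticAt_const)
  have hLy : ∀ t : ℝ, L (0, t) = t • y := by
    intro t
    ext i
    rcases Fin.eq_self_or_eq_succAbove j i with rfl | ⟨k, rfl⟩ <;> simp [hL]
  have hL0 : L 0 = 0 := by have := hLy 0; rwa [zero_smul] at this
  have hV := Pull.of_section (U := U) (fun z : Fin (n+1) → ℝ =>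
      ((fun k => z (j.succAbove k) - z j / y j * y (j.succAbove k)), z j / y j)) hLan hL0 (by
    refine Tendsto.mono_left ?_ hU
    have : Continuous (fun z : Fin (n+1) → ℝ =>
      ((fun k : Fin n => z (j.succAbove k) - z j / y j * y (j.succAbove k)), z j / y j)) := by fun_prop
    refine this.tendsto' 0 0 ?_
    simp; rfl) (Eventually.of_forall fun z => by
      ext i
      rcases Fin.eq_self_or_eq_succAbove j i with rfl | ⟨k, rfl⟩
      · simp [hL, hj]
      · simp [hL])
  have hh : AnalyticAt ℝ (fun p => f (L p)) 0 := an_comp hf hLan hL0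
  have hd : ∃ d, D^[d] (fun p => f (L p)) 0 ≠ 0 := by
    by_contra hcon
    push Not at hcon
    apply hy
    have hg : AnalyticAt ℝ (fun t : ℝ => f (t • y)) 0 :=
      an_comp hf (analyticAt_id.fun_smul analyticAt_const) (by simp)
    have hps := hg.hasFPowerSeriesAt
    have hz : (fun k : ℕ => iteratedDeriv k (fun t : ℝ => f (t • y)) 0 / k.factorial) = 0 := by
      ext k
      have h1 := (slice hh k).self_of_nhds
      rw [hcon k] at h1
      have h2 : (fun s : ℝ => f (L ((0 : (Fin n → ℝ) × ℝ).1, s))) = fun t : ℝ => f (t • y) := by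
        ext s; rw [← hLy]; rfl
      rw [h2] at h1
      rw [← show (0:ℝ) = iteratedDeriv k (fun t : ℝ => f (t • y)) 0 from h1]
      simp
    rw [hz, FormalMultilinearSeries.ofScalars_series_eq_zero_of_scalar_zero] at hps
    exact hps.eventually_eq_zero
  obtain ⟨d, hd⟩ := hd
  obtain ⟨σ, W, α, hW, hα⟩ := SP_all h d (fun _ => 1) _ _ analyticAt_const
    (by intro hc; exact one_ne_zero hc.self_of_nhds) hh hd hV.le
  exact ⟨_, W, α, hV.comp hW, by simpa only [one_mul] using hα⟩

theorem LUn_all (n : ℕ) : LUn n := by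
  induction n with
  | zero => exact LUn_zero
  | succ n ih => exact LUn_succ ih

lemma mon_scale {ι : Type*} [Fintype ι] (α : ι → ℕ) (t : ℝ) (x : ι → ℝ) :
    mon α (t • x) = t ^ (∑ i, α i) * mon α x := by
  simp [mon, mul_pow, Finset.prod_mul_distrib, Finset.prod_pow_eq_pow_sum]

/-- A monomial times a unit has no critical points off its zero set. -/
lemma MUe.crit {ι : Type*} [Fintype ι] {α : ι → ℕ} {g : (ι → ℝ) → ℝ} (h : MUe α g) (h0 : g 0 = 0) :
    ∀ᶠ z in 𝓝 0, fderiv ℝ g z = 0 → g z = 0 := by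
  have hg := h.analytic
  obtain ⟨u, a, b, c⟩ := h
  have hα : (∑ i, α i : ℕ) ≠ 0 := by
    intro hz
    have : α = 0 := by
      ext i
      have := (Finset.sum_eq_zero_iff.1 hz) i (Finset.mem_univ i)
      simpa using this
    rw [c.self_of_nhds, this, mon_zero, one_mul] at h0
    exact b h0
  set N := ∑ i, α i with hN
  have hcont : ContinuousAt (fun z => (N : ℝ) * u z + fderiv ℝ u z z) 0 :=
    (continuousAt_const.mul a.continuousAt).add (a.fderiv.continuousAt.clm_apply continuousAt_id)
  have hne : (N : ℝ) * u 0 + fderiv ℝ u 0 0 ≠ 0 := by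
    rw [map_zero, add_zero]
    exact mul_ne_zero (by exact_mod_cast hα) b
  filter_upwards [c.eventually_nhds, hcont.eventually_ne hne, hg.eventually_analyticAt, a.eventually_analyticAt]
    with z h1 h2 h3 h4 hz
  have hline : HasDerivAt (fun t : ℝ => t • z) z 1 := by
    simpa using (hasDerivAt_id (1:ℝ)).smul_const z
  have hd1 : HasDerivAt (fun t : ℝ => g (t • z)) (fderiv ℝ g z z) 1 := by
    have : HasFDerivAt g (fderiv ℝ g z) ((1:ℝ) • z) := by rw [one_smul]; exact h3.differentiableAt.hasFDerivAt
    exact this.comp_hasDerivAt (1:ℝ) hline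
  have hd2 : HasDerivAt (fun t : ℝ => u (t • z)) (fderiv ℝ u z z) 1 := by
    have : HasFDerivAt u (fderiv ℝ u z) ((1:ℝ) • z) := by rw [one_smul]; exact h4.differentiableAt.hasFDerivAt
    exact this.comp_hasDerivAt (1:ℝ) hline
  have hd3 := ((hasDerivAt_pow N (1:ℝ)).mul_const (mon α z)).mul hd2
  have heq : (fun t : ℝ => g (t • z)) =ᶠ[𝓝 1] fun t => t ^ N * mon α z * u (t • z) := by
    have ht : Tendsto (fun t : ℝ => t • z) (𝓝 1) (𝓝 z) := by
      have : Continuous fun t : ℝ => t • z := by fun_prop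
      exact this.tendsto' _ _ (one_smul _ _)
    filter_upwards [ht.eventually h1] with t ht
    rw [ht, mon_scale]
  have := hd1.unique (hd3.congr_of_eventuallyEq heq)
  rw [hz] at this
  simp only [ContinuousLinearMap.zero_apply, one_pow, mul_one, one_smul, one_mul] at this
  have e : mon α z * ((N : ℝ) * u z + fderiv ℝ u z z) = 0 := by rw [this]; ring
  rw [h1.self_of_nhds, (mul_eq_zero.1 e).resolve_right h2, zero_mul]

theorem crit_pi {n : ℕ} {f : (Fin n → ℝ) → ℝ} (hf : AnalyticAt ℝ f 0) (h0 : f 0 = 0) :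
    ∀ᶠ y in 𝓝 0, fderiv ℝ f y = 0 → f y = 0 := by
  by_contra hcon
  have hne : ¬ ∀ᶠ x in 𝓝 0, f x = 0 := fun hz => hcon (hz.mono fun x hx _ => hx)
  have hfr : ∃ᶠ y in 𝓝 0, fderiv ℝ f y = 0 ∧ f y ≠ 0 := by
    rw [Filter.not_eventually] at hcon
    exact hcon.mono fun y hy => by push Not at hy; exact hy
  have hnb : (𝓝 (0 : Fin n → ℝ) ⊓ 𝓟 {y | fderiv ℝ f y = 0 ∧ f y ≠ 0}).NeBot := Filter.frequently_mem_iff_neBot.1 hfr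
  obtain ⟨U, hU⟩ := @Ultrafilter.exists_le _ _ hnb
  obtain ⟨π, V, α, hV, hα⟩ := LUn_all n f hf hne U (hU.trans inf_le_left)
  have hS : ∀ᶠ y in (U : Filter (Fin n → ℝ)), fderiv ℝ f y = 0 ∧ f y ≠ 0 := le_principal_iff.1 (hU.trans inf_le_right)
  have hS2 := hV.eventually.1 hS
  have h1 := hα.crit (by rw [hV.zero, h0])
  have hall : ∀ᶠ z in (V : Filter (Fin n → ℝ)), False := by
    filter_upwards [hS2, hV.le h1, hV.le ((an_tendsto hV.an hV.zero).eventually hf.eventually_analyticAt),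
      hV.le hV.an.eventually_analyticAt] with z h2 h3 h4 h5
    apply h2.2
    apply h3
    have := fderiv_comp z h4.differentiableAt h5.differentiableAt
    change fderiv ℝ (f ∘ π) z = 0
    rw [this, h2.1, ContinuousLinearMap.zero_comp]
  obtain ⟨z, hz⟩ := hall.exists
  exact hz

end
end LU

theorem analytic_constant_on_critical_set
    (n : ℕ)
    (f : EuclideanSpace ℝ (Fin n) → ℝ)
    (V : Set (EuclideanSpace ℝ (Fin n)))
    (hVopen : IsOpen V) (hV0 : (0 : EuclideanSpace ℝ (Fin n)) ∈ V)
    (hf : AnalyticOn ℝ f V) :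
    ∃ U : Set (EuclideanSpace ℝ (Fin n)),
      IsOpen U ∧ (0 : EuclideanSpace ℝ (Fin n)) ∈ U ∧ U ⊆ V ∧
      ∀ y ∈ U, gradient f y = 0 → f y = f 0 := by
  have hfa : AnalyticOnNhd ℝ f V := hVopen.analyticOn_iff_analyticOnNhd.1 hf
  let e := EuclideanSpace.equiv (Fin n) ℝ
  let g : (Fin n → ℝ) → ℝ := fun x => f (e.symm x) - f 0
  have hg : AnalyticAt ℝ g 0 :=
    (LU.an_comp (hfa 0 hV0) (e.symm.toContinuousLinearMap.analyticAt 0) (map_zero e.symm)).fun_sub analyticAt_const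
  have hcr := LU.crit_pi hg (by simp [g])
  have ht : Filter.Tendsto (fun y => e y) (nhds 0) (nhds 0) := e.continuous.tendsto' _ _ (map_zero e)
  have hev := (ht.eventually hcr).and (hVopen.mem_nhds hV0)
  obtain ⟨U, hUs, hUo, hU0⟩ := mem_nhds_iff.1 hev
  refine ⟨U, hUo, hU0, fun y hy => (hUs hy).2, fun y hy hgr => ?_⟩
  have h1 := (hUs hy).1
  have hfd : fderiv ℝ f y = 0 := by
    unfold gradient at hgr
    simpa using hgr
  have h2 : fderiv ℝ g (e y) = 0 := by
    have hd : HasFDerivAt f (fderiv ℝ f y) (e.symm (e y)) := by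
      rw [e.symm_apply_apply]; exact (hfa y (hUs hy).2).differentiableAt.hasFDerivAt
    have h3 := (hd.comp (e y) e.symm.toContinuousLinearMap.hasFDerivAt).sub_const (f 0)
    rw [hfd, ContinuousLinearMap.zero_comp] at h3
    exact h3.fderiv
  have h3 := h1 h2
  simp only [g, e.symm_apply_apply] at h3
  linarith
end
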